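/- Let γ ∈ (71/72, 1) and let P_γ = {p ∈ P : ∃ n ∈ ℕ, p = ⌊n^{1/γ}⌋} be the set of Piatetski–Shapiro primes of type γ. Then every A ⊆ P_γ with positive relative upper density, i.e. limsup_{N→∞} |A ∩ [1,N]| / |P_γ ∩ [1,N]| > 0, contains a nontrivial three-term arithmetic progression. -/

import Mathlib

namespace PSRoth
open Finset

/-- `ee x = exp (2 π i x)`. -/
noncomputable def ee (x : ℝ) : ℂ := Complex.exp ((2 * Real.pi * x : ℝ) * Complex.I)

lemma norm_ee (x : ℝ) : ‖ee x‖ = 1 := by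
  unfold ee; exact Complex.norm_exp_ofReal_mul_I _

lemma ee_add (x y : ℝ) : ee (x + y) = ee x * ee y := by
  unfold ee; rw [← Complex.exp_add]; congr 1; push_cast; ring

lemma ee_zero : ee 0 = 1 := by simp [ee]

lemma ee_int (k : ℤ) : ee k = 1 := by
  unfold ee
  rw [Complex.exp_eq_one_iff]
  exact ⟨k, by push_cast; ring⟩

lemma ee_nat (k : ℕ) : ee k = 1 := by simpa using ee_int k

lemma ee_neg (x : ℝ) : ee (-x) = (starRingEnd ℂ) (ee x) := by
  unfold ee
  rw [← Complex.exp_conj]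
  congr 1
  rw [map_mul, Complex.conj_ofReal, Complex.conj_I]
  push_cast; ring

lemma ee_ne_zero (x : ℝ) : ee x ≠ 0 := Complex.exp_ne_zero _

lemma ee_sub (x y : ℝ) : ee (x - y) = ee x * (starRingEnd ℂ) (ee y) := by
  rw [sub_eq_add_neg, ee_add, ee_neg]

lemma ee_mul_conj (x : ℝ) : ee x * (starRingEnd ℂ) (ee x) = 1 := by
  rw [← ee_sub, sub_self, ee_zero]

lemma ee_nat_mul (n : ℕ) (x : ℝ) : ee (n * x) = ee x ^ n := by
  unfold ee; rw [← Complex.exp_nat_mul]; congr 1; push_cast; ring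

lemma ee_add_int (x : ℝ) (k : ℤ) : ee (x + k) = ee x := by
  rw [ee_add, ee_int, mul_one]

lemma ee_re (x : ℝ) : (ee x).re = Real.cos (2 * Real.pi * x) := by
  unfold ee; exact Complex.exp_ofReal_mul_I_re _

lemma ee_im (x : ℝ) : (ee x).im = Real.sin (2 * Real.pi * x) := by
  unfold ee; exact Complex.exp_ofReal_mul_I_im _

lemma ee_sub_one (x : ℝ) : ee x - 1 = (2 * Real.sin (Real.pi * x) : ℝ) *
    ((-Real.sin (Real.pi * x) : ℝ) + (Real.cos (Real.pi * x) : ℝ) * Complex.I) := by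
  apply Complex.ext
  · simp only [Complex.sub_re, ee_re, Complex.one_re]
    have : 2 * Real.pi * x = 2 * (Real.pi * x) := by ring
    rw [this, Real.cos_two_mul, Real.cos_sq']
    simp [-Complex.ofReal_sin, -Complex.ofReal_cos, -Complex.ofReal_mul]
    ring
  · simp only [Complex.sub_im, ee_im, Complex.one_im]
    have : 2 * Real.pi * x = 2 * (Real.pi * x) := by ring
    rw [this, Real.sin_two_mul]
    simp [-Complex.ofReal_sin, -Complex.ofReal_cos, -Complex.ofReal_mul]

lemma norm_ee_sub_one (x : ℝ) : ‖ee x - 1‖ = 2 * |Real.sin (Real.pi * x)| := by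
  have h1 : ‖((-Real.sin (Real.pi * x) : ℝ) : ℂ) + (Real.cos (Real.pi * x) : ℝ) * Complex.I‖ = 1 := by
    have h := Complex.sq_norm (((-Real.sin (Real.pi * x) : ℝ) : ℂ) + (Real.cos (Real.pi * x) : ℝ) * Complex.I)
    rw [Complex.normSq_add_mul_I] at h
    have h2 := Real.sin_sq_add_cos_sq (Real.pi * x)
    have h3 : ‖((-Real.sin (Real.pi * x) : ℝ) : ℂ) + (Real.cos (Real.pi * x) : ℝ) * Complex.I‖ ^ 2 = 1 := by
      rw [h]; linarith [neg_sq (Real.sin (Real.pi * x))]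
    exact (pow_eq_one_iff_of_nonneg (norm_nonneg _) two_ne_zero).mp h3
  rw [ee_sub_one, norm_mul, h1, mul_one, Complex.norm_real, Real.norm_eq_abs, abs_mul]
  norm_num

lemma norm_ee_sub_one_le (x : ℝ) : ‖ee x - 1‖ ≤ 2 * Real.pi * |x| := by
  rw [norm_ee_sub_one]
  have := Real.abs_sin_le_abs (x := Real.pi * x)
  rw [abs_mul, abs_of_pos Real.pi_pos] at this
  linarith

/-- lower bound away from integers -/
lemma sin_pi_ge {δ x : ℝ} (hδ : 0 ≤ δ) (h1 : δ ≤ x) (h2 : x ≤ 1 - δ) :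
    2 * δ ≤ Real.sin (Real.pi * x) := by
  have hpi := Real.pi_pos
  rcases le_total x (1/2) with h | h
  · have := Real.mul_le_sin (x := Real.pi * x) (by nlinarith) (by nlinarith)
    have e : 2 / Real.pi * (Real.pi * x) = 2 * x := by field_simp
    linarith
  · have := Real.mul_le_sin (x := Real.pi * (1 - x)) (by nlinarith) (by nlinarith)
    have e : 2 / Real.pi * (Real.pi * (1 - x)) = 2 * (1 - x) := by field_simp
    have e2 : Real.sin (Real.pi * (1 - x)) = Real.sin (Real.pi * x) := by
      rw [mul_sub, mul_one, Real.sin_pi_sub]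
    linarith

lemma norm_ee_sub_one_ge_round (x : ℝ) : 4 * |x - round x| ≤ ‖ee x - 1‖ := by
  have h : ee x = ee |x - round x| ∨ ee x = (starRingEnd ℂ) (ee |x - round x|) := by
    have e : ee x = ee (x - round x) := by
      conv_lhs => rw [show x = (x - round x) + (round x : ℤ) by ring, ee_add_int]
    rcases abs_choice (x - round x) with h | h
    · left; rw [h, e]
    · right; rw [h, ← ee_neg, neg_neg, e]
  have h2 : ‖ee x - 1‖ = ‖ee |x - round x| - 1‖ := by
    rcases h with h | h
    · rw [h]
    · rw [h, ← Complex.norm_conj]; simp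
  rw [h2, norm_ee_sub_one]
  have h3 := abs_sub_round x
  have := sin_pi_ge (abs_nonneg (x - round x)) le_rfl (by linarith)
  have := le_abs_self (Real.sin (Real.pi * |x - round x|))
  linarith

/-- geometric sum -/
lemma geom_bound (x : ℝ) (n : ℕ) (hx : x - round x ≠ 0) :
    ‖∑ t ∈ range n, ee (t * x)‖ ≤ 1 / (2 * |x - round x|) := by
  have h0 : 0 < |x - round x| := abs_pos.mpr hx
  have h1 := norm_ee_sub_one_ge_round x
  have h2 : ee x ≠ 1 := by
    intro h; rw [h] at h1; simp at h1; linarith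
  simp_rw [ee_nat_mul]
  rw [geom_sum_eq h2, norm_div]
  have h3 : ‖ee x ^ n - 1‖ ≤ 2 := by
    refine (norm_sub_le _ _).trans ?_
    rw [norm_pow, norm_ee]; norm_num
  rw [div_le_div_iff₀ (by linarith) (by linarith)]
  nlinarith [norm_nonneg (ee x ^ n - 1)]

/-- Kusmin–Landau, discrete. -/
lemma kusmin_landau (f : ℕ → ℝ) (n : ℕ) (k : ℤ) (δ : ℝ) (hδ : 0 < δ)
    (hmono : ∀ i, i + 1 < n → f (i+1) - f i ≤ f (i+2) - f (i+1))
    (hlo : ∀ i, i < n → k + δ ≤ f (i+1) - f i)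
    (hhi : ∀ i, i < n → f (i+1) - f i ≤ k + 1 - δ) :
    ‖∑ i ∈ range n, ee (f i)‖ ≤ 1 / δ := by
  rcases Nat.eq_zero_or_pos n with hn | hn
  · subst hn; simp; exact hδ.le
  set θ : ℕ → ℝ := fun i => f (i+1) - f i - k with hθ
  have hθlo : ∀ i, i < n → δ ≤ θ i := fun i hi => by have := hlo i hi; simp only [hθ]; linarith
  have hθhi : ∀ i, i < n → θ i ≤ 1 - δ := fun i hi => by have := hhi i hi; simp only [hθ]; linarith
  have hsin : ∀ i, i < n → 2 * δ ≤ Real.sin (Real.pi * θ i) := fun i hi =>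
    sin_pi_ge hδ.le (hθlo i hi) (hθhi i hi)
  set c : ℕ → ℝ := fun i => Real.cos (Real.pi * θ i) / Real.sin (Real.pi * θ i) with hc
  have hcb : ∀ i, i < n → |c i| ≤ 1 / (2 * δ) := by
    intro i hi
    have := hsin i hi
    rw [hc]; simp only
    rw [abs_div, abs_of_pos (show 0 < Real.sin (Real.pi * θ i) by linarith)]
    exact div_le_div₀ (by norm_num) (Real.abs_cos_le_one _) (by linarith) this
  set g : ℕ → ℂ := fun i => -(1/2 : ℂ) - (c i : ℂ) / 2 * Complex.I with hg
  have hgrel : ∀ i, i < n → ee (f i) = g i * (ee (f (i+1)) - ee (f i)) := by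
    intro i hi
    have e1 : ee (f (i+1)) = ee (f i) * ee (θ i) := by
      rw [← ee_add]
      rw [show f (i+1) = (f i + θ i) + (k : ℤ) by simp only [hθ]; ring, ee_add_int]
    have hs : Real.sin (Real.pi * θ i) ≠ 0 := by have := hsin i hi; linarith
    have hs' : (Real.sin (Real.pi * θ i) : ℂ) ≠ 0 := by exact_mod_cast hs
    have key : g i * (ee (θ i) - 1) = 1 := by
      rw [ee_sub_one, hg]
      simp only [hc]
      have h2 : ((Real.sin (Real.pi * θ i) : ℝ) : ℂ)^2 + ((Real.cos (Real.pi * θ i) : ℝ) : ℂ)^2 = 1 := by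
        exact_mod_cast Real.sin_sq_add_cos_sq (Real.pi * θ i)
      push_cast [-Complex.ofReal_sin, -Complex.ofReal_cos]
      generalize ((Real.sin (Real.pi * θ i) : ℝ) : ℂ) = s at *
      generalize ((Real.cos (Real.pi * θ i) : ℝ) : ℂ) = t at *
      field_simp
      linear_combination (1:ℂ) * h2 - t^2 * (Complex.I_sq)
    rw [e1]
    linear_combination (-ee (f i)) * key
  have hcmono : ∀ i, i + 1 < n → c (i+1) ≤ c i := by
    intro i hi
    have s1 := hsin i (by omega)
    have s2 := hsin (i+1) hi
    have hm : θ i ≤ θ (i+1) := by have := hmono i hi; simp only [hθ]; linarith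
    simp only [hc]
    rw [div_le_div_iff₀ (by linarith) (by linarith)]
    have h1 : 0 ≤ Real.sin (Real.pi * θ (i+1) - Real.pi * θ i) := by
      apply Real.sin_nonneg_of_nonneg_of_le_pi
      · nlinarith [Real.pi_pos]
      · have := hθhi (i+1) hi
        have := hθlo i (by omega)
        nlinarith [Real.pi_pos]
    rw [Real.sin_sub] at h1
    linarith
  -- summation by parts, by induction
  have hind : ∀ m, m < n → ∑ i ∈ range (m+1), ee (f i) = g m * ee (f (m+1)) - g 0 * ee (f 0)
      - ∑ i ∈ range m, (g (i+1) - g i) * ee (f (i+1)) := by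
    intro m
    induction m with
    | zero => intro h; rw [sum_range_one, hgrel 0 h]; simp; rw [← hgrel 0 h]; linear_combination hgrel 0 h
    | succ m ih =>
      intro h
      rw [sum_range_succ, ih (by omega), sum_range_succ]
      linear_combination hgrel (m+1) h
  obtain ⟨m, rfl⟩ : ∃ m, n = m + 1 := ⟨n - 1, by omega⟩
  rw [hind m (by omega)]
  have hgn : ∀ i, i < m + 1 → ‖g i‖ ≤ 1 / (4 * δ) := by
    intro i hi
    have h1 : ‖ee (f i)‖ = ‖g i‖ * ‖ee (f (i+1)) - ee (f i)‖ := by rw [← norm_mul, ← hgrel i hi]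
    have e1 : ee (f (i+1)) = ee (f i) * ee (θ i) := by
      rw [← ee_add]
      rw [show f (i+1) = (f i + θ i) + (k : ℤ) by simp only [hθ]; ring, ee_add_int]
    have e2 : ‖ee (f (i+1)) - ee (f i)‖ = ‖ee (θ i) - 1‖ := by
      rw [e1, show ee (f i) * ee (θ i) - ee (f i) = ee (f i) * (ee (θ i) - 1) by ring, norm_mul, norm_ee, one_mul]
    rw [norm_ee, e2, norm_ee_sub_one] at h1
    have h2 := hsin i hi
    rw [abs_of_pos (by linarith)] at h1
    rw [le_div_iff₀ (by linarith)]
    nlinarith [norm_nonneg (g i)]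
  have hdiff : ∀ i, i < m → ‖(g (i+1) - g i) * ee (f (i+1))‖ ≤ (c i - c (i+1)) / 2 := by
    intro i hi
    rw [norm_mul, norm_ee, mul_one]
    have : g (i+1) - g i = (((c i - c (i+1)) / 2 : ℝ) : ℂ) * Complex.I := by
      simp only [hg]; push_cast; ring
    rw [this, norm_mul, Complex.norm_I, mul_one, Complex.norm_real, Real.norm_eq_abs,
      abs_of_nonneg (by have := hcmono i (by omega); linarith)]
  have hsum : ‖∑ i ∈ range m, (g (i+1) - g i) * ee (f (i+1))‖ ≤ (c 0 - c m) / 2 := by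
    refine (norm_sum_le _ _).trans ((sum_le_sum (fun i hi => hdiff i (mem_range.mp hi))).trans ?_)
    rw [← sum_div, sum_range_sub']
  have hc0 := (abs_le.mp (hcb 0 (by omega))).2
  have hcm := (abs_le.mp (hcb m (by omega))).1
  have e : 1 / (2 * δ) = 2 * (1 / (4 * δ)) := by field_simp; norm_num
  have e' : 1 / δ = 4 * (1 / (4 * δ)) := by field_simp
  calc _ ≤ ‖g m * ee (f (m+1)) - g 0 * ee (f 0)‖ + ‖∑ i ∈ range m, (g (i+1) - g i) * ee (f (i+1))‖ := norm_sub_le _ _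
    _ ≤ (‖g m * ee (f (m+1))‖ + ‖g 0 * ee (f 0)‖) + (c 0 - c m) / 2 := add_le_add (norm_sub_le _ _) hsum
    _ ≤ (1 / (4 * δ) + 1 / (4 * δ)) + (c 0 - c m) / 2 := by
        rw [norm_mul, norm_mul, norm_ee, norm_ee, mul_one, mul_one]
        gcongr
        · exact hgn m (by omega)
        · exact hgn 0 (by omega)
    _ ≤ 1 / δ := by rw [e']; rw [e] at hc0 hcm; linarith

lemma diff_lower (θ : ℕ → ℝ) (n : ℕ) (l : ℝ)
    (h : ∀ i, i + 1 < n → l ≤ θ (i+1) - θ i) (i d : ℕ) (hd : i + d < n) :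
    d * l ≤ θ (i + d) - θ i := by
  induction d with
  | zero => simp
  | succ d ih =>
    have h1 := ih (by omega)
    have h2 := h (i + d) (by omega)
    rw [← add_assoc]; push_cast; linarith

lemma diff_upper (θ : ℕ → ℝ) (n : ℕ) (l : ℝ)
    (h : ∀ i, i + 1 < n → θ (i+1) - θ i ≤ l) (i d : ℕ) (hd : i + d < n) :
    θ (i + d) - θ i ≤ d * l := by
  induction d with
  | zero => simp
  | succ d ih =>
    have h1 := ih (by omega)
    have h2 := h (i + d) (by omega)
    rw [← add_assoc]; push_cast; linarith

/-- van der Corput second derivative test, discrete. -/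
lemma vdc (f : ℕ → ℝ) (n : ℕ) (l C : ℝ) (hl : 0 < l) (hC : 1 ≤ C)
    (hlo : ∀ i, i + 1 < n → l ≤ (f (i+2) - f (i+1)) - (f (i+1) - f i))
    (hhi : ∀ i, i + 1 < n → (f (i+2) - f (i+1)) - (f (i+1) - f i) ≤ C * l) :
    ‖∑ i ∈ range n, ee (f i)‖ ≤ 4 * (C * l * n + 2) / √l := by
  have hsl : 0 < √l := Real.sqrt_pos.mpr hl
  have hsq : √l * √l = l := Real.mul_self_sqrt hl.le
  have htriv : ∀ s : Finset ℕ, ‖∑ i ∈ s, ee (f i)‖ ≤ s.card := by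
    intro s
    refine (norm_sum_le _ _).trans ?_
    simp [norm_ee]
  rcases Nat.eq_zero_or_pos n with hn | hn
  · subst hn; simp; positivity
  rcases lt_or_ge (1/2) (√l) with hbig | hsmall
  · refine (htriv _).trans ?_
    rw [card_range, le_div_iff₀ hsl]
    have h1 : l * n ≤ C * l * n := by
      have : 0 ≤ l * n := by positivity
      nlinarith
    have h2 : √l * n ≤ 2 * (√l * √l) * n := by
      have : (0:ℝ) ≤ n := by positivity
      have : √l ≤ 2 * (√l * √l) := by nlinarith
      gcongr
    rw [hsq] at h2
    nlinarith
  set δ := √l with hδ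
  set θ : ℕ → ℝ := fun i => f (i+1) - f i with hθ
  have hlow := diff_lower θ n l (fun i hi => by simpa [hθ] using hlo i hi)
  have hupp := diff_upper θ n (C * l) (fun i hi => by simpa [hθ] using hhi i hi)
  have hmono : ∀ i j, i ≤ j → j < n → θ i ≤ θ j := by
    intro i j hij hj
    obtain ⟨d, rfl⟩ := Nat.exists_eq_add_of_le hij
    have := hlow i d hj
    have : 0 ≤ (d:ℝ) * l := by positivity
    linarith
  have hb : ∀ t : ℝ, ∃ b, b ≤ n ∧ ∀ i, i < n → (θ i < t ↔ i < b) := by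
    intro t
    have hex : ∃ i, n ≤ i ∨ t ≤ θ i := ⟨n, Or.inl le_rfl⟩
    classical
    refine ⟨Nat.find hex, Nat.find_min' hex (Or.inl le_rfl), fun i hi => ?_⟩
    constructor
    · intro h
      by_contra hcon
      push Not at hcon
      rcases Nat.find_spec hex with h' | h'
      · omega
      · have := hmono _ _ hcon hi
        linarith
    · intro h
      have := Nat.find_min hex h
      push Not at this
      exact this.2
  choose b hbn hbi using hb
  have hbmono : ∀ s t, s ≤ t → b s ≤ b t := by
    intro s t hst
    by_contra hcon
    push Not at hcon
    have h1 : b t < n := lt_of_lt_of_le hcon (hbn s)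
    have h2 := (hbi s _ h1).mpr hcon
    have h3 := (hbi t _ h1).mp (by linarith)
    omega
  have hlen : ∀ s t, s ≤ t → ((b t - b s : ℕ) : ℝ) ≤ (t - s) / l + 1 := by
    intro s t hst
    rcases Nat.eq_zero_or_pos (b t - b s) with h | h
    · rw [h]; simp
      have : 0 ≤ (t - s) / l := div_nonneg (by linarith) hl.le
      linarith
    · have hn' := hbn t
      have h1 := hlow (b s) (b t - b s - 1) (by omega)
      have e : b s + (b t - b s - 1) = b t - 1 := by omega
      rw [e] at h1
      have h2 := (hbi t (b t - 1) (by omega)).mpr (by omega)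
      have h3 : s ≤ θ (b s) := by
        by_contra hc
        push Not at hc
        have := (hbi s (b s) (by omega)).mp hc
        omega
      have e2 : ((b t - b s : ℕ) : ℝ) = ((b t - b s - 1 : ℕ) : ℝ) + 1 := by
        rw [show b t - b s = (b t - b s - 1) + 1 by omega]; push_cast; simp
      rw [e2]
      have : ((b t - b s - 1 : ℕ) : ℝ) ≤ (t - s) / l := by
        rw [le_div_iff₀ hl]; linarith
      linarith
  have hin : ∀ s i, b s ≤ i → i < n → s ≤ θ i := by
    intro s i h1 h2
    by_contra hc
    push Not at hc
    have := (hbi s i h2).mp hc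
    omega
  -- each integer block
  have hblock : ∀ k : ℤ, ‖∑ i ∈ Ico (b k) (b (k+1)), ee (f i)‖ ≤ 4 / δ := by
    intro k
    have m1 := hbmono k (k + δ) (by linarith)
    have m2 := hbmono (k + δ) (k + 1 - δ) (by linarith)
    have m3 := hbmono (k + 1 - δ) (k + 1) (by linarith)
    rw [← sum_Ico_consecutive _ m1 (m2.trans m3), ← sum_Ico_consecutive _ m2 m3]
    have b1 : ‖∑ i ∈ Ico (b k) (b (k+δ)), ee (f i)‖ ≤ δ / l + 1 := by
      refine (htriv _).trans ?_
      rw [Nat.card_Ico]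
      have := hlen k (k+δ) (by linarith)
      simpa using this
    have b3 : ‖∑ i ∈ Ico (b (k+1-δ)) (b (k+1)), ee (f i)‖ ≤ δ / l + 1 := by
      refine (htriv _).trans ?_
      rw [Nat.card_Ico]
      have := hlen (k+1-δ) (k+1) (by linarith)
      simpa using this
    have b2 : ‖∑ i ∈ Ico (b (k+δ)) (b (k+1-δ)), ee (f i)‖ ≤ 1 / δ := by
      rw [sum_Ico_eq_sum_range]
      have hnn := hbn (k+1-δ)
      apply kusmin_landau (fun i => f (b (k+δ) + i)) _ k δ hsl
      · intro i hi
        have := hlo (b (k+δ) + i) (by omega)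
        have e1 : b (k+δ) + (i+1) = b (k+δ) + i + 1 := by ring
        have e2 : b (k+δ) + (i+2) = b (k+δ) + i + 2 := by ring
        simp only [e1, e2]; linarith
      · intro i hi
        exact hin (k+δ) (b (k+δ) + i) (by omega) (by omega)
      · intro i hi
        exact ((hbi (k+1-δ) (b (k+δ) + i) (by omega)).mpr (by omega)).le
    have e : δ / l = 1 / δ := by rw [← hsq]; field_simp
    rw [e] at b1 b3
    have h2 : 2 ≤ 1 / δ := by rw [le_div_iff₀ hsl]; linarith
    have e4 : 4 / δ = 4 * (1 / δ) := by ring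
    rw [e4]
    refine (norm_add_le _ _).trans ?_
    have := norm_add_le (∑ i ∈ Ico (b (k+δ)) (b (k+1-δ)), ee (f i)) (∑ i ∈ Ico (b (k+1-δ)) (b (k+1)), ee (f i))
    linarith
  have hchain : ∀ (k : ℤ) (m : ℕ), ‖∑ i ∈ Ico (b k) (b (k + m)), ee (f i)‖ ≤ m * (4 / δ) := by
    intro k m
    induction m with
    | zero => simp
    | succ m ih =>
      have m1 := hbmono k (k + m) (by simp)
      have m2 := hbmono (k + m) (k + (m + 1 : ℕ)) (by push_cast; linarith)
      rw [← sum_Ico_consecutive _ m1 m2]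
      have h2 := hblock (k + m)
      push_cast at h2 ⊢
      rw [← add_assoc]
      refine (norm_add_le _ _).trans ?_
      linarith
  set k0 := ⌊θ 0⌋ with hk0
  set k1 := ⌊θ (n-1)⌋ + 1 with hk1
  have hk : k0 ≤ k1 := by
    have := Int.floor_le_floor (hmono 0 (n-1) (by omega) (by omega))
    omega
  have hb0 : b k0 = 0 := by
    by_contra h
    have := (hbi k0 0 hn).mpr (by omega)
    have := Int.floor_le (θ 0)
    linarith
  have hb1 : b k1 = n := by
    have h1 := hbn k1
    by_contra h
    have := hin k1 (n-1) (by omega) (by omega)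
    have := Int.lt_floor_add_one (θ (n-1))
    rw [hk1] at *
    push_cast at *
    linarith
  have hfin := hchain k0 (k1 - k0).toNat
  have hcast : (((k1 - k0).toNat : ℕ) : ℝ) = (k1:ℝ) - k0 := by
    have : (((k1 - k0).toNat : ℕ) : ℤ) = k1 - k0 := Int.toNat_of_nonneg (by omega)
    exact_mod_cast this
  rw [hcast, add_sub_cancel, hb0, hb1, ← range_eq_Ico] at hfin
  refine hfin.trans ?_
  have hu := hupp 0 (n-1) (by omega)
  rw [zero_add] at hu
  have hkk : (k1:ℝ) - k0 ≤ C * l * n + 2 := by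
    have h1 := Int.floor_le (θ (n-1))
    have h2 := Int.lt_floor_add_one (θ 0)
    have h3 : ((n - 1 : ℕ) : ℝ) * (C * l) ≤ n * (C * l) := by
      gcongr
      omega
    rw [hk1, hk0]; push_cast; linarith
  calc ((k1:ℝ) - k0) * (4 / δ) ≤ (C * l * n + 2) * (4 / δ) := by gcongr
    _ = _ := by ring

end PSRoth

namespace PSRoth
open Finset

/-- second difference of `u ^ γ` -/
lemma rpow_second_diff {γ : ℝ} (h0 : 0 < γ) (h1 : γ < 1) {X Y u q : ℝ} (hX : 0 < X) (hq : 0 < q)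
    (hu : X ≤ u) (hY : u + 2 * q ≤ Y) :
    γ * (1 - γ) * q ^ 2 * Y ^ (γ - 2) ≤ 2 * (u + q) ^ γ - u ^ γ - (u + 2 * q) ^ γ ∧
    2 * (u + q) ^ γ - u ^ γ - (u + 2 * q) ^ γ ≤ γ * (1 - γ) * q ^ 2 * X ^ (γ - 2) := by
  have hder : ∀ x : ℝ, 0 < x → HasDerivAt (fun y : ℝ => (y + q) ^ γ - y ^ γ)
      (γ * (x + q) ^ (γ - 1) - γ * x ^ (γ - 1)) x := by
    intro x hx
    have a1 : HasDerivAt (fun y : ℝ => (y + q) ^ γ) (γ * (x + q) ^ (γ - 1)) x := by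
      have := ((hasDerivAt_id x).add_const q).rpow_const (p := γ) (Or.inl (by simp; linarith))
      simpa using this
    exact a1.sub (Real.hasDerivAt_rpow_const (Or.inl hx.ne'))
  have hder2 : ∀ x : ℝ, 0 < x → HasDerivAt (fun y : ℝ => γ * y ^ (γ - 1))
      (γ * ((γ - 1) * x ^ (γ - 1 - 1))) x := by
    intro x hx
    exact (Real.hasDerivAt_rpow_const (Or.inl hx.ne')).const_mul γ
  obtain ⟨ξ, hξ, e1⟩ := exists_hasDerivAt_eq_slope (fun y : ℝ => (y + q) ^ γ - y ^ γ)
    (fun x => γ * (x + q) ^ (γ - 1) - γ * x ^ (γ - 1)) (show u < u + q by linarith)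
    (fun x hx => (hder x (by have := hx.1; linarith)).continuousAt.continuousWithinAt)
    (fun x hx => hder x (by have := hx.1; linarith))
  obtain ⟨ζ, hζ, e2⟩ := exists_hasDerivAt_eq_slope (fun y : ℝ => γ * y ^ (γ - 1))
    (fun x => γ * ((γ - 1) * x ^ (γ - 1 - 1))) (show ξ < ξ + q by linarith)
    (fun x hx => (hder2 x (by have := hx.1; have := hξ.1; linarith)).continuousAt.continuousWithinAt)
    (fun x hx => hder2 x (by have := hx.1; have := hξ.1; linarith))
  have e3 : (ξ + q - ξ) = q := by ring
  have e4 : (u + q - u) = q := by ring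
  rw [e3, eq_div_iff hq.ne'] at e2
  rw [e4, eq_div_iff hq.ne'] at e1
  have e5 : u + q + q = u + 2 * q := by ring
  simp only [e5] at e1 e2
  have hmain : 2 * (u + q) ^ γ - u ^ γ - (u + 2 * q) ^ γ = γ * (1 - γ) * q ^ 2 * ζ ^ (γ - 2) := by
    have e6 : γ - 1 - 1 = γ - 2 := by ring
    rw [e6] at e2
    rw [← e2] at e1
    linear_combination e1
  have hζ1 : X ≤ ζ := by have := hζ.1; have := hξ.1; linarith
  have hζ2 : ζ ≤ Y := by have := hζ.2; have := hξ.2; linarith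
  have hκ : 0 ≤ γ * (1 - γ) * q ^ 2 := by
    have : 0 ≤ 1 - γ := by linarith
    positivity
  rw [hmain]
  constructor
  · exact mul_le_mul_of_nonneg_left (Real.rpow_le_rpow_of_nonpos (by linarith) hζ2 (by linarith)) hκ
  · exact mul_le_mul_of_nonneg_left (Real.rpow_le_rpow_of_nonpos hX hζ1 (by linarith)) hκ

lemma norm_sum_ee_neg {ι : Type*} (s : Finset ι) (f : ι → ℝ) :
    ‖∑ i ∈ s, ee (-(f i))‖ = ‖∑ i ∈ s, ee (f i)‖ := by
  simp_rw [ee_neg]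
  rw [← map_sum, Complex.norm_conj]

lemma phase_bound {γ : ℝ} (h0 : 0 < γ) (h1 : γ < 1) {X B a q β c : ℝ} (n : ℕ) (hX : 0 < X) (hB : 1 ≤ B)
    (hq : 0 < q) (ha : X ≤ a) (hn : a + q * n ≤ B * X) (hc : c ≠ 0) :
    ‖∑ i ∈ range n, ee (β * i + c * (a + q * i) ^ γ)‖ ≤
      4 * (B ^ 2 * (|c| * (γ * (1 - γ) * q ^ 2 * (B * X) ^ (γ - 2))) * n + 2) /
        √(|c| * (γ * (1 - γ) * q ^ 2 * (B * X) ^ (γ - 2))) := by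
  set l := |c| * (γ * (1 - γ) * q ^ 2 * (B * X) ^ (γ - 2)) with hl
  have hBX : 0 < B * X := by positivity
  have h1γ : 0 < 1 - γ := by linarith
  have hlpos : 0 < l := by
    have := abs_pos.mpr hc
    have := Real.rpow_pos_of_pos hBX (γ - 2)
    positivity
  have key : ∀ i : ℕ, i + 1 < n →
      l ≤ |c| * (2 * (a + q * (i+1:ℕ)) ^ γ - (a + q * i) ^ γ - (a + q * (i+2:ℕ)) ^ γ) ∧
      |c| * (2 * (a + q * (i+1:ℕ)) ^ γ - (a + q * i) ^ γ - (a + q * (i+2:ℕ)) ^ γ) ≤ B ^ 2 * l := by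
    intro i hi
    have hin : ((i : ℝ) + 2) ≤ n := by exact_mod_cast (by omega : i + 2 ≤ n)
    have hqi : 0 ≤ q * i := by positivity
    obtain ⟨k1, k2⟩ := rpow_second_diff h0 h1 (X := X) (Y := B * X) (u := a + q * i) (q := q) hX hq
      (by linarith) (by nlinarith)
    have e1 : a + q * (i+1:ℕ) = a + q * i + q := by push_cast; ring
    have e2 : a + q * (i+2:ℕ) = a + q * i + 2 * q := by push_cast; ring
    rw [e1, e2]
    refine ⟨mul_le_mul_of_nonneg_left k1 (abs_nonneg c), ?_⟩
    refine (mul_le_mul_of_nonneg_left k2 (abs_nonneg c)).trans ?_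
    have h3 : X ^ (γ - 2) ≤ B ^ 2 * (B * X) ^ (γ - 2) := by
      rw [Real.mul_rpow (by linarith) hX.le, ← mul_assoc]
      have : 1 ≤ B ^ 2 * B ^ (γ - 2) := by
        rw [← Real.rpow_natCast, ← Real.rpow_add (by linarith)]
        apply Real.one_le_rpow hB
        push_cast; linarith
      have := Real.rpow_pos_of_pos hX (γ - 2)
      nlinarith
    calc |c| * (γ * (1 - γ) * q ^ 2 * X ^ (γ - 2)) ≤ |c| * (γ * (1 - γ) * q ^ 2 * (B ^ 2 * (B * X) ^ (γ - 2))) := by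
          gcongr
      _ = _ := by rw [hl]; ring
  have hB2 : 1 ≤ B ^ 2 := one_le_pow₀ hB
  rcases lt_or_gt_of_ne hc with hneg | hpos
  · refine vdc (fun i => β * i + c * (a + q * i) ^ γ) n l (B^2) hlpos hB2 ?_ ?_ <;>
    · intro i hi
      have := key i hi
      rw [abs_of_neg hneg] at this
      push_cast at *
      linarith
  · rw [← norm_sum_ee_neg]
    refine vdc (fun i => -(β * i + c * (a + q * i) ^ γ)) n l (B^2) hlpos hB2 ?_ ?_ <;>
    · intro i hi
      have := key i hi
      rw [abs_of_pos hpos] at this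
      push_cast at *
      linarith

lemma phase_bound' {γ : ℝ} (h0 : 0 < γ) (h1 : γ < 1) {X B a q β c : ℝ} (n : ℕ) (hX : 0 < X) (hB : 1 ≤ B)
    (hq : 0 < q) (ha : X ≤ a) (hn : a + q * n ≤ B * X) (hc : c ≠ 0) :
    ‖∑ i ∈ range n, ee (β * i + c * (a + q * i) ^ γ)‖ ≤
      4 * B ^ 2 * (|c| ^ (1/2 : ℝ) * (B * X) ^ (γ / 2)) +
        8 / (γ * (1 - γ)) * (|c| ^ (-(1/2) : ℝ) * q⁻¹ * (B * X) ^ (1 - γ / 2)) := by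
  refine (phase_bound h0 h1 n hX hB hq ha hn hc).trans ?_
  have hBX : 0 < B * X := by positivity
  have h1γ : 0 < 1 - γ := by linarith
  have hcp := abs_pos.mpr hc
  set κ := γ * (1 - γ) with hκ
  have hκ0 : 0 < κ := by positivity
  have hκ1 : κ ≤ 1 := by nlinarith
  have hs : √(|c| * (κ * q ^ 2 * (B * X) ^ (γ - 2))) = √κ * (|c| ^ (1/2 : ℝ) * q * (B * X) ^ (γ / 2 - 1)) := by
    rw [show |c| * (κ * q ^ 2 * (B * X) ^ (γ - 2)) = κ * (|c| * (q^2 * (B * X) ^ (γ - 2))) by ring,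
      Real.sqrt_mul hκ0.le, Real.sqrt_mul hcp.le, Real.sqrt_mul (sq_nonneg q), Real.sqrt_sq hq.le,
      Real.sqrt_eq_rpow |c|, Real.sqrt_eq_rpow ((B*X)^(γ-2)), ← Real.rpow_mul hBX.le,
      show (γ - 2) * (1/2) = γ/2 - 1 by ring]
    ring
  have hs0 : 0 < √(|c| * (κ * q ^ 2 * (B * X) ^ (γ - 2))) := by
    apply Real.sqrt_pos.mpr
    have := Real.rpow_pos_of_pos hBX (γ - 2)
    positivity
  have hsplit : 4 * (B ^ 2 * (|c| * (κ * q ^ 2 * (B * X) ^ (γ - 2))) * n + 2) /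
        √(|c| * (κ * q ^ 2 * (B * X) ^ (γ - 2))) =
      4 * B ^ 2 * (√(|c| * (κ * q ^ 2 * (B * X) ^ (γ - 2))) * n) + 8 * (√(|c| * (κ * q ^ 2 * (B * X) ^ (γ - 2))))⁻¹ := by
    set l := |c| * (κ * q ^ 2 * (B * X) ^ (γ - 2)) with hl
    have hl0 : 0 ≤ l := by positivity
    have : √l * √l = l := Real.mul_self_sqrt hl0
    rw [div_eq_iff hs0.ne']
    have h2 : (√l)⁻¹ * √l = 1 := inv_mul_cancel₀ hs0.ne'
    linear_combination (-4 * B^2 * n) * this - 8 * h2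
  rw [hsplit, hs]
  have hsκ1 : √κ ≤ 1 := Real.sqrt_le_one.mpr hκ1
  have hsκ0 : 0 < √κ := Real.sqrt_pos.mpr hκ0
  have hκs : κ ≤ √κ := by
    have := Real.mul_self_sqrt hκ0.le
    nlinarith
  have hc12 : 0 < |c| ^ (1/2:ℝ) := Real.rpow_pos_of_pos hcp _
  have hp : 0 < (B * X) ^ (γ / 2 - 1) := Real.rpow_pos_of_pos hBX _
  gcongr ?_ + ?_
  · have hqn : q * n ≤ B * X := by linarith
    have e : (B * X) ^ (γ / 2) = (B * X) ^ (γ / 2 - 1) * (B * X) := by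
      rw [← Real.rpow_add_one hBX.ne']; congr 1; ring
    rw [e]
    have : √κ * (|c| ^ (1/2:ℝ) * q * (B * X) ^ (γ / 2 - 1)) * n ≤ |c| ^ (1/2:ℝ) * ((B * X) ^ (γ / 2 - 1) * (B * X)) := by
      calc √κ * (|c| ^ (1/2:ℝ) * q * (B * X) ^ (γ / 2 - 1)) * n
          = √κ * (|c| ^ (1/2:ℝ) * ((B * X) ^ (γ / 2 - 1) * (q * n))) := by ring
        _ ≤ 1 * (|c| ^ (1/2:ℝ) * ((B * X) ^ (γ / 2 - 1) * (B * X))) := by gcongr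
        _ = _ := one_mul _
    gcongr
  · rw [mul_inv, mul_inv, mul_inv, ← Real.rpow_neg hcp.le, ← Real.rpow_neg hBX.le,
      show -(γ / 2 - 1) = 1 - γ / 2 by ring, ← mul_assoc]
    have : 8 * (√κ)⁻¹ ≤ 8 / κ := by
      rw [div_eq_mul_inv]
      gcongr
    gcongr

lemma expsum_bound {γ : ℝ} (h0 : 71/72 < γ) (h1 : γ < 1) : ∃ C : ℝ, 0 < C ∧
    ∀ (N β h : ℝ) (a q n : ℕ), 1 ≤ N → 1 ≤ q → N ≤ a → (a:ℝ) + q * n ≤ 5 * N →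
      1 ≤ |h| → |h| ≤ N ^ (1/72 : ℝ) →
      ‖∑ i ∈ range n, ee (β * i + h * ((a + q * i : ℕ) : ℝ) ^ γ)‖ ≤ C * N ^ (0.51 : ℝ) := by
  have hγ0 : 0 < γ := by linarith
  have h1γ : 0 < 1 - γ := by linarith
  refine ⟨4 * 5 ^ 2 * 5 + 8 / (γ * (1 - γ)) * 5, by positivity, ?_⟩
  intro N β h a q n hN hq ha hn hh1 hh2
  have hh0 : h ≠ 0 := by intro h'; rw [h'] at hh1; simp at hh1; linarith
  have hq' : (1:ℝ) ≤ q := by exact_mod_cast hq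
  have := phase_bound' (β := β) hγ0 h1 n (by linarith : 0 < N) (by norm_num : (1:ℝ) ≤ 5) (by linarith) ha hn hh0
  push_cast
  refine this.trans ?_
  have hN0 : 0 < N := by linarith
  have b1 : |h| ^ (1/2:ℝ) ≤ N ^ (1/144:ℝ) := by
    calc |h| ^ (1/2:ℝ) ≤ (N ^ (1/72:ℝ)) ^ (1/2:ℝ) := Real.rpow_le_rpow (abs_nonneg _) hh2 (by norm_num)
      _ = _ := by rw [← Real.rpow_mul hN0.le]; norm_num
  have b2 : (5 * N) ^ (γ / 2) ≤ 5 * N ^ (1/2 : ℝ) := by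
    rw [Real.mul_rpow (by norm_num) hN0.le]
    gcongr ?_ * ?_
    · calc (5:ℝ) ^ (γ/2) ≤ 5 ^ (1:ℝ) := Real.rpow_le_rpow_of_exponent_le (by norm_num) (by linarith)
        _ = 5 := by simp
    · exact Real.rpow_le_rpow_of_exponent_le hN (by linarith)
  have b3 : (5 * N) ^ (1 - γ / 2) ≤ 5 * N ^ (0.51 : ℝ) := by
    rw [Real.mul_rpow (by norm_num) hN0.le]
    gcongr ?_ * ?_
    · calc (5:ℝ) ^ (1 - γ/2) ≤ 5 ^ (1:ℝ) := Real.rpow_le_rpow_of_exponent_le (by norm_num) (by linarith)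
        _ = 5 := by simp
    · exact Real.rpow_le_rpow_of_exponent_le hN (by linarith)
  have b4 : |h| ^ (-(1/2):ℝ) ≤ 1 := Real.rpow_le_one_of_one_le_of_nonpos hh1 (by norm_num)
  have b5 : (q:ℝ)⁻¹ ≤ 1 := inv_le_one_of_one_le₀ hq'
  have b6 : N ^ (1/144:ℝ) * N ^ (1/2:ℝ) ≤ N ^ (0.51:ℝ) := by
    rw [← Real.rpow_add hN0]
    exact Real.rpow_le_rpow_of_exponent_le hN (by norm_num)
  rw [add_mul]
  gcongr ?_ + ?_
  · calc 4 * 5 ^ 2 * (|h| ^ (1/2:ℝ) * (5 * N) ^ (γ / 2)) ≤ 4 * 5 ^ 2 * (N ^ (1/144:ℝ) * (5 * N ^ (1/2 : ℝ))) := by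
          gcongr
      _ = 4 * 5 ^ 2 * 5 * (N ^ (1/144:ℝ) * N ^ (1/2 : ℝ)) := by ring
      _ ≤ _ := by gcongr
  · calc 8 / (γ * (1 - γ)) * (|h| ^ (-(1/2):ℝ) * (q:ℝ)⁻¹ * (5 * N) ^ (1 - γ / 2))
        ≤ 8 / (γ * (1 - γ)) * (1 * 1 * (5 * N ^ (0.51 : ℝ))) := by gcongr
      _ = _ := by ring

lemma rpow_first_diff {γ : ℝ} (h0 : 0 < γ) (h1 : γ < 1) {u v : ℝ} (hu : 0 < u) (huv : u < v) :
    γ * v ^ (γ - 1) * (v - u) ≤ v ^ γ - u ^ γ ∧ v ^ γ - u ^ γ ≤ γ * u ^ (γ - 1) * (v - u) := by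
  have hder : ∀ x : ℝ, 0 < x → HasDerivAt (fun y : ℝ => y ^ γ) (γ * x ^ (γ - 1)) x :=
    fun x hx => Real.hasDerivAt_rpow_const (Or.inl hx.ne')
  obtain ⟨ξ, hξ, e1⟩ := exists_hasDerivAt_eq_slope (fun y : ℝ => y ^ γ)
    (fun x => γ * x ^ (γ - 1)) huv
    (fun x hx => (hder x (by have := hx.1; linarith)).continuousAt.continuousWithinAt)
    (fun x hx => hder x (by have := hx.1; linarith))
  have hvu : 0 < v - u := by linarith
  rw [eq_div_iff hvu.ne'] at e1
  rw [← e1]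
  constructor
  · gcongr ?_ * ?_ * _
    exact Real.rpow_le_rpow_of_nonpos (by have := hξ.1; linarith) hξ.2.le (by linarith)
  · gcongr ?_ * ?_ * _
    exact Real.rpow_le_rpow_of_nonpos hu hξ.1.le (by linarith)

lemma typeII_inner {γ : ℝ} (h0 : 71/72 < γ) (h1 : γ < 1) : ∃ C : ℝ, 0 < C ∧
    ∀ (N K X Q h : ℝ) (k1 k2 a n : ℕ), 1 ≤ K → 1 ≤ X → K * X ≤ N → K ≤ k2 → k2 < k1 → k1 ≤ 2 * K →
      (k1:ℝ) - k2 ≤ Q → X ≤ a → (a:ℝ) + n ≤ 10 * X →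
      1 ≤ |h| → |h| ≤ N ^ (1/72 : ℝ) →
      ‖∑ i ∈ range n, ee (h * ((k1:ℝ) ^ γ - (k2:ℝ) ^ γ) * ((a + i : ℕ) : ℝ) ^ γ)‖ ≤
        C * (N ^ (1/72:ℝ) * Q ^ (1/2:ℝ) * X ^ (1/2:ℝ)) := by
  have hγ0 : 0 < γ := by linarith
  have h1γ : 0 < 1 - γ := by linarith
  refine ⟨4 * 10 ^ 2 * 10 + 8 / (γ * (1 - γ)) * 80, by positivity, ?_⟩
  intro N K X Q h k1 k2 a n hK hX hKX hk2 hk hk1 hQ ha hn hh1 hh2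
  have hk' : (k2:ℝ) + 1 ≤ k1 := by exact_mod_cast hk
  have hk2pos : (0:ℝ) < k2 := by linarith
  have hN1 : 1 ≤ N := by nlinarith
  have hN0 : 0 < N := by linarith
  have hX0 : 0 < X := by linarith
  obtain ⟨d1, d2⟩ := rpow_first_diff hγ0 h1 hk2pos (by linarith : (k2:ℝ) < k1)
  set Δ := (k1:ℝ) ^ γ - (k2:ℝ) ^ γ with hΔ
  have hΔlo : 1/4 * K ^ (γ - 1) ≤ Δ := by
    refine le_trans ?_ d1
    have : (2 * K) ^ (γ - 1) ≤ (k1:ℝ) ^ (γ - 1) :=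
      Real.rpow_le_rpow_of_nonpos (by linarith) hk1 (by linarith)
    have e : (2 * K) ^ (γ - 1) = 2 ^ (γ - 1) * K ^ (γ - 1) := Real.mul_rpow (by norm_num) (by linarith)
    have e2 : (1/2:ℝ) ≤ 2 ^ (γ - 1) := by
      calc (1/2:ℝ) = 2 ^ (-1:ℝ) := by rw [Real.rpow_neg_one]; norm_num
        _ ≤ _ := Real.rpow_le_rpow_of_exponent_le (by norm_num) (by linarith)
    have hKp : 0 < K ^ (γ - 1) := Real.rpow_pos_of_pos (by linarith) _
    have hk1p : 0 < (k1:ℝ) ^ (γ - 1) := Real.rpow_pos_of_pos (by linarith) _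
    calc 1/4 * K ^ (γ - 1) = 1/2 * (1/2 * K ^ (γ - 1)) * 1 := by ring
      _ ≤ γ * (2 ^ (γ - 1) * K ^ (γ - 1)) * (k1 - k2) := by
        gcongr
        · linarith
        · linarith
      _ ≤ γ * (k1:ℝ) ^ (γ - 1) * (k1 - k2) := by
        rw [← e]
        gcongr
        linarith
  have hΔ0 : 0 < Δ := lt_of_lt_of_le (by have := Real.rpow_pos_of_pos (by linarith : 0 < K) (γ-1); positivity) hΔlo
  have hΔhi : Δ ≤ Q := by
    refine d2.trans ?_
    have : (k2:ℝ) ^ (γ - 1) ≤ 1 := Real.rpow_le_one_of_one_le_of_nonpos (by linarith) (by linarith)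
    have h3 : 0 ≤ (k2:ℝ) ^ (γ - 1) := by positivity
    calc γ * (k2:ℝ) ^ (γ - 1) * (k1 - k2) ≤ 1 * 1 * (k1 - k2) := by
          gcongr
          linarith
      _ ≤ Q := by linarith
  have hQ1 : 1 ≤ Q := by linarith
  have hh0 : h ≠ 0 := by intro h'; rw [h'] at hh1; simp at hh1; linarith
  have := phase_bound' (β := 0) (q := 1) hγ0 h1 n hX0 (by norm_num : (1:ℝ) ≤ 10) (by norm_num) ha (by linarith) (mul_ne_zero hh0 hΔ0.ne')
  simp only [zero_mul, zero_add, one_mul, inv_one, mul_one] at this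
  push_cast
  refine this.trans ?_
  rw [abs_mul, abs_of_pos hΔ0]
  have b1 : (|h| * Δ) ^ (1/2:ℝ) ≤ N ^ (1/72:ℝ) * Q ^ (1/2:ℝ) := by
    rw [Real.mul_rpow (abs_nonneg _) hΔ0.le]
    gcongr
    calc |h| ^ (1/2:ℝ) ≤ |h| ^ (1:ℝ) := Real.rpow_le_rpow_of_exponent_le hh1 (by norm_num)
      _ ≤ _ := by simpa using hh2
  have b2 : (10 * X) ^ (γ / 2) ≤ 10 * X ^ (1/2 : ℝ) := by
    rw [Real.mul_rpow (by norm_num) hX0.le]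
    gcongr ?_ * ?_
    · calc (10:ℝ) ^ (γ/2) ≤ 10 ^ (1:ℝ) := Real.rpow_le_rpow_of_exponent_le (by norm_num) (by linarith)
        _ = 10 := by simp
    · exact Real.rpow_le_rpow_of_exponent_le hX (by linarith)
  have b3 : (10 * X) ^ (1 - γ / 2) ≤ 10 * (X ^ ((1 - γ)/2) * X ^ (1/2:ℝ)) := by
    rw [Real.mul_rpow (by norm_num) hX0.le, ← Real.rpow_add hX0]
    gcongr ?_ * ?_
    · calc (10:ℝ) ^ (1 - γ/2) ≤ 10 ^ (1:ℝ) := Real.rpow_le_rpow_of_exponent_le (by norm_num) (by linarith)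
        _ = 10 := by simp
    · exact Real.rpow_le_rpow_of_exponent_le hX (by linarith)
  have b4 : (|h| * Δ) ^ (-(1/2):ℝ) ≤ 8 * K ^ ((1 - γ)/2) := by
    have hK0 : 0 < K := by linarith
    have hKp : 0 < K ^ (γ - 1) := Real.rpow_pos_of_pos hK0 _
    calc (|h| * Δ) ^ (-(1/2):ℝ) ≤ (1/4 * K ^ (γ - 1)) ^ (-(1/2):ℝ) := by
          apply Real.rpow_le_rpow_of_nonpos (by positivity) _ (by norm_num)
          nlinarith
      _ = (1/4:ℝ) ^ (-(1/2):ℝ) * K ^ ((1 - γ)/2) := by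
          rw [Real.mul_rpow (by norm_num) hKp.le, ← Real.rpow_mul hK0.le]
          congr 2; ring
      _ ≤ _ := by
          gcongr
          rw [Real.rpow_neg (by norm_num), ← Real.inv_rpow (by norm_num)]
          calc ((1/4:ℝ)⁻¹) ^ (1/2:ℝ) ≤ ((1/4:ℝ)⁻¹) ^ (1:ℝ) := Real.rpow_le_rpow_of_exponent_le (by norm_num) (by norm_num)
            _ ≤ 8 := by norm_num
  have b5 : K ^ ((1-γ)/2) * X ^ ((1-γ)/2) ≤ N ^ (1/72:ℝ) := by
    rw [← Real.mul_rpow (by linarith) hX0.le]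
    calc (K * X) ^ ((1-γ)/2) ≤ N ^ ((1-γ)/2) := Real.rpow_le_rpow (by positivity) hKX (by linarith)
      _ ≤ _ := Real.rpow_le_rpow_of_exponent_le hN1 (by linarith)
  have b6 : 1 ≤ Q ^ (1/2:ℝ) := Real.one_le_rpow hQ1 (by norm_num)
  rw [add_mul]
  gcongr ?_ + ?_
  · calc 4 * 10 ^ 2 * ((|h| * Δ) ^ (1/2:ℝ) * (10 * X) ^ (γ / 2)) ≤ 4 * 10 ^ 2 * ((N ^ (1/72:ℝ) * Q ^ (1/2:ℝ)) * (10 * X ^ (1/2 : ℝ))) := by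
          gcongr
      _ = _ := by ring
  · calc 8 / (γ * (1 - γ)) * ((|h| * Δ) ^ (-(1/2):ℝ) * (10 * X) ^ (1 - γ / 2))
        ≤ 8 / (γ * (1 - γ)) * ((8 * K ^ ((1 - γ)/2)) * (10 * (X ^ ((1 - γ)/2) * X ^ (1/2:ℝ)))) := by gcongr
      _ = 8 / (γ * (1 - γ)) * 80 * ((K ^ ((1 - γ)/2) * X ^ ((1 - γ)/2)) * 1 * X ^ (1/2:ℝ)) := by ring
      _ ≤ _ := by gcongr

end PSRoth

namespace PSRoth
open Finset

lemma sum_inv_Icc_le (n : ℕ) : ∑ i ∈ Icc 1 n, ((i:ℝ))⁻¹ ≤ 1 + Real.log n := by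
  have h := harmonic_le_one_add_log n
  rw [harmonic_eq_sum_Icc] at h
  push_cast at h
  exact h

lemma sum_inv_Icc_nonneg (n : ℕ) : 0 ≤ ∑ i ∈ Icc 1 n, ((i:ℝ))⁻¹ := by positivity

/-- sum over multiples -/
lemma sum_inv_dvd_le (g Y : ℕ) (hg : 1 ≤ g) :
    ∑ a ∈ (Icc 1 Y).filter (g ∣ ·), ((a:ℝ))⁻¹ ≤ (g:ℝ)⁻¹ * ∑ i ∈ Icc 1 Y, ((i:ℝ))⁻¹ := by
  rw [mul_sum]
  have : (Icc 1 Y).filter (g ∣ ·) ⊆ (Icc 1 Y).image (g * ·) := by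
    intro a ha
    rw [mem_filter, mem_Icc] at ha
    obtain ⟨⟨h1, h2⟩, b, rfl⟩ := ha
    rw [mem_image]
    have hb : 1 ≤ b := by
      rcases Nat.eq_zero_or_pos b with h | h
      · subst h; simp at h1
      · exact h
    refine ⟨b, mem_Icc.mpr ⟨hb, ?_⟩, rfl⟩
    nlinarith
  calc ∑ a ∈ (Icc 1 Y).filter (g ∣ ·), ((a:ℝ))⁻¹ ≤ ∑ a ∈ (Icc 1 Y).image (g * ·), ((a:ℝ))⁻¹ :=
        sum_le_sum_of_subset_of_nonneg this (fun _ _ _ => by positivity)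
    _ = ∑ i ∈ Icc 1 Y, (((g * i : ℕ):ℝ))⁻¹ := by
        rw [sum_image]
        intro a _ b _ h
        exact Nat.eq_of_mul_eq_mul_left (by omega) h
    _ ≤ _ := by
        apply sum_le_sum
        intro i _
        push_cast; rw [mul_inv]

/-- Second moment of the divisor function. -/
lemma sum_tau_sq_le (Y : ℕ) :
    ∑ m ∈ Icc 1 Y, ((m.divisors.card : ℝ)) ^ 2 ≤ Y * (1 + Real.log Y) ^ 3 := by
  set H := ∑ i ∈ Icc 1 Y, ((i:ℝ))⁻¹ with hH
  have hH0 : 0 ≤ H := sum_inv_Icc_nonneg Y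
  have hHle : H ≤ 1 + Real.log Y := sum_inv_Icc_le Y
  have h1 : ∀ m ∈ Icc 1 Y, ((m.divisors.card : ℝ)) ^ 2 =
      ∑ a ∈ Icc 1 Y, ∑ b ∈ Icc 1 Y, if a.lcm b ∣ m then (1:ℝ) else 0 := by
    intro m hm
    rw [mem_Icc] at hm
    have e : (m.divisors.card : ℝ) = ∑ a ∈ Icc 1 Y, if a ∣ m then (1:ℝ) else 0 := by
      rw [← sum_filter, sum_const, nsmul_eq_mul, mul_one]
      congr 2
      ext a
      simp only [Nat.mem_divisors, mem_filter, mem_Icc]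
      constructor
      · rintro ⟨h, h'⟩
        exact ⟨⟨Nat.pos_of_dvd_of_pos h (by omega), (Nat.le_of_dvd (by omega) h).trans hm.2⟩, h⟩
      · rintro ⟨_, h⟩
        exact ⟨h, by omega⟩
    rw [sq, e, sum_mul_sum]
    refine sum_congr rfl fun a _ => sum_congr rfl fun b _ => ?_
    simp only [Nat.lcm_dvd_iff]
    by_cases ha : a ∣ m <;> by_cases hb : b ∣ m <;> simp [ha, hb]
  rw [sum_congr rfl h1, sum_comm]
  have h2 : ∀ a ∈ Icc 1 Y, ∑ m ∈ Icc 1 Y, ∑ b ∈ Icc 1 Y, (if a.lcm b ∣ m then (1:ℝ) else 0)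
      ≤ ∑ b ∈ Icc 1 Y, Y * ((a:ℝ)⁻¹ * (b:ℝ)⁻¹ * ∑ g ∈ Icc 1 Y, if g ∣ a ∧ g ∣ b then (g:ℝ) else 0) := by
    intro a ha
    rw [sum_comm]
    apply sum_le_sum
    intro b hb
    rw [mem_Icc] at ha hb
    have e : ∑ m ∈ Icc 1 Y, (if a.lcm b ∣ m then (1:ℝ) else 0) = ((Y / a.lcm b : ℕ) : ℝ) := by
      rw [← sum_filter, sum_const, nsmul_eq_mul, mul_one, ← Nat.Ioc_filter_dvd_card_eq_div]
      rfl
    rw [e]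
    have hg0 : 0 < a.gcd b := Nat.gcd_pos_of_pos_left _ (by omega)
    have hgs : (a.gcd b : ℝ) ≤ ∑ g ∈ Icc 1 Y, if g ∣ a ∧ g ∣ b then (g:ℝ) else 0 := by
      have hmem : a.gcd b ∈ Icc 1 Y := mem_Icc.mpr ⟨hg0, (Nat.gcd_le_left _ (by omega)).trans ha.2⟩
      have := single_le_sum (f := fun g : ℕ => if g ∣ a ∧ g ∣ b then (g:ℝ) else 0)
        (fun i _ => by split_ifs <;> positivity) hmem
      simpa [Nat.gcd_dvd_left, Nat.gcd_dvd_right] using this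
    have hl : ((a.lcm b : ℕ):ℝ) = a * b / (a.gcd b : ℝ) := by
      rw [eq_div_iff (by positivity)]
      have := Nat.gcd_mul_lcm a b
      rw [← Nat.cast_mul, ← Nat.cast_mul, mul_comm (a.lcm b), this]
    have ha0 : (0:ℝ) < a := by exact_mod_cast ha.1
    have hb0 : (0:ℝ) < b := by exact_mod_cast hb.1
    calc ((Y / a.lcm b : ℕ) : ℝ) ≤ (Y:ℝ) / (a.lcm b : ℕ) := Nat.cast_div_le
      _ = Y * ((a:ℝ)⁻¹ * (b:ℝ)⁻¹ * (a.gcd b : ℝ)) := by rw [hl]; field_simp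
      _ ≤ _ := by gcongr
  refine (sum_le_sum h2).trans ?_
  have h3 : ∑ a ∈ Icc 1 Y, ∑ b ∈ Icc 1 Y, (Y:ℝ) * ((a:ℝ)⁻¹ * (b:ℝ)⁻¹ * ∑ g ∈ Icc 1 Y, if g ∣ a ∧ g ∣ b then (g:ℝ) else 0)
      = Y * ∑ g ∈ Icc 1 Y, (g:ℝ) * (∑ a ∈ (Icc 1 Y).filter (g ∣ ·), ((a:ℝ))⁻¹) ^ 2 := by
    simp_rw [← mul_sum]
    congr 1
    simp_rw [mul_sum]
    rw [sum_congr rfl fun a _ => sum_comm, sum_comm]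
    refine sum_congr rfl fun g _ => ?_
    rw [sq, sum_mul_sum, mul_sum, sum_filter]
    refine sum_congr rfl fun a _ => ?_
    split_ifs with hga
    · rw [mul_sum, sum_filter]
      refine sum_congr rfl fun b _ => ?_
      by_cases hb : g ∣ b <;> simp [hga, hb]; ring
    · simp [hga]
  rw [h3]
  gcongr
  calc ∑ g ∈ Icc 1 Y, (g:ℝ) * (∑ a ∈ (Icc 1 Y).filter (g ∣ ·), ((a:ℝ))⁻¹) ^ 2
      ≤ ∑ g ∈ Icc 1 Y, (g:ℝ) * ((g:ℝ)⁻¹ * H) ^ 2 := by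
        apply sum_le_sum
        intro g hg
        have := sum_inv_dvd_le g Y (mem_Icc.mp hg).1
        gcongr
    _ = ∑ g ∈ Icc 1 Y, (g:ℝ)⁻¹ * H ^ 2 := by
        refine sum_congr rfl fun g hg => ?_
        have : (0:ℝ) < g := by exact_mod_cast (mem_Icc.mp hg).1
        field_simp
    _ = H ^ 3 := by rw [← sum_mul, ← hH]; ring
    _ ≤ _ := by gcongr

/-- unfolding a Dirichlet convolution over an interval -/
lemma sum_antidiag (N M : ℕ) (g : ℕ → ℕ → ℂ) :
    ∑ n ∈ Ioc N M, ∑ p ∈ n.divisorsAntidiagonal, g p.1 p.2 =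
      ∑ a ∈ Icc 1 M, ∑ b ∈ Ioc (N / a) (M / a), g a b := by
  have h1 : ∀ n ∈ Ioc N M, ∑ p ∈ n.divisorsAntidiagonal, g p.1 p.2 =
      ∑ a ∈ Icc 1 M, ∑ b ∈ Icc 1 M, if a * b = n then g a b else 0 := by
    intro n hn
    rw [mem_Ioc] at hn
    rw [← sum_product', ← sum_filter]
    refine sum_congr ?_ fun _ _ => rfl
    ext ⟨a, b⟩
    simp only [Nat.mem_divisorsAntidiagonal, mem_filter, mem_product, mem_Icc]
    constructor
    · rintro ⟨h, h'⟩
      have ha : 1 ≤ a := by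
        rcases Nat.eq_zero_or_pos a with h'' | h''
        · subst h''; simp at h; omega
        · exact h''
      have hb : 1 ≤ b := by
        rcases Nat.eq_zero_or_pos b with h'' | h''
        · subst h''; simp at h; omega
        · exact h''
      refine ⟨⟨⟨ha, ?_⟩, ⟨hb, ?_⟩⟩, h⟩ <;> nlinarith
    · rintro ⟨_, h⟩
      exact ⟨h, by omega⟩
  rw [sum_congr rfl h1, sum_comm]
  refine sum_congr rfl fun a ha => ?_
  rw [mem_Icc] at ha
  rw [sum_comm]
  have h2 : ∀ b ∈ Icc 1 M, ∑ n ∈ Ioc N M, (if a * b = n then g a b else 0) =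
      if b ∈ Ioc (N / a) (M / a) then g a b else 0 := by
    intro b hb
    rw [sum_ite_eq]
    have : a * b ∈ Ioc N M ↔ b ∈ Ioc (N / a) (M / a) := by
      rw [mem_Ioc, mem_Ioc, Nat.div_lt_iff_lt_mul (by omega), Nat.le_div_iff_mul_le (by omega), mul_comm]
    simp only [this]
  rw [sum_congr rfl h2, ← sum_filter]
  refine sum_congr ?_ fun _ _ => rfl
  ext b
  simp only [mem_filter, mem_Icc, mem_Ioc]
  constructor
  · exact fun h => h.2
  · intro h
    exact ⟨⟨lt_of_le_of_lt (Nat.zero_le _) h.1, h.2.trans (Nat.div_le_self _ _)⟩, h⟩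

/-- Abel summation for monotone weights -/
lemma abel_bound (w : ℕ → ℝ) (z : ℕ → ℂ) (B : ℝ) (n : ℕ) (hw0 : ∀ i, 0 ≤ w i) (hw : Monotone w)
    (hB : ∀ m, m ≤ n → ‖∑ i ∈ range m, z i‖ ≤ B) :
    ‖∑ i ∈ range n, (w i : ℂ) * z i‖ ≤ 2 * w n * B := by
  have key : ∀ m, ∑ i ∈ range m, (w i : ℂ) * z i = w m * ∑ i ∈ range m, z i -
      ∑ i ∈ range m, ((w (i+1) - w i : ℝ) : ℂ) * ∑ j ∈ range (i+1), z j := by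
    intro m
    induction m with
    | zero => simp
    | succ m ih =>
      rw [sum_range_succ, ih, sum_range_succ (fun i => ((w (i+1) - w i : ℝ) : ℂ) * _)]
      rw [sum_range_succ z]
      push_cast; ring
  have hB0 : 0 ≤ B := by simpa using hB 0 (by omega)
  rw [key n]
  refine (norm_sub_le _ _).trans ?_
  have h1 : ‖(w n : ℂ) * ∑ i ∈ range n, z i‖ ≤ w n * B := by
    rw [norm_mul, Complex.norm_real, Real.norm_of_nonneg (hw0 n)]
    exact mul_le_mul_of_nonneg_left (hB n le_rfl) (hw0 n)
  have h2 : ‖∑ i ∈ range n, ((w (i+1) - w i : ℝ) : ℂ) * ∑ j ∈ range (i+1), z j‖ ≤ w n * B := by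
    refine (norm_sum_le _ _).trans ?_
    calc ∑ i ∈ range n, ‖((w (i+1) - w i : ℝ) : ℂ) * ∑ j ∈ range (i+1), z j‖
        ≤ ∑ i ∈ range n, (w (i+1) - w i) * B := by
          apply sum_le_sum
          intro i hi
          have h3 : 0 ≤ w (i+1) - w i := by have := hw (Nat.le_succ i); simp at this; linarith
          rw [norm_mul, Complex.norm_real, Real.norm_of_nonneg h3]
          exact mul_le_mul_of_nonneg_left (hB _ (by have := mem_range.mp hi; omega)) h3
      _ = (w n - w 0) * B := by rw [← sum_mul, sum_range_sub]
      _ ≤ w n * B := by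
          have := hw0 0
          nlinarith
  linarith

end PSRoth

namespace PSRoth
open Finset
open scoped ArithmeticFunction ArithmeticFunction.Moebius ArithmeticFunction.vonMangoldt ArithmeticFunction.zeta

/-- truncation of an arithmetic function -/
noncomputable def trunc (U : ℕ) (f : ArithmeticFunction ℝ) : ArithmeticFunction ℝ :=
  ⟨fun n => if n ≤ U then f n else 0, by simp⟩

lemma trunc_apply (U : ℕ) (f : ArithmeticFunction ℝ) (n : ℕ) :
    trunc U f n = if n ≤ U then f n else 0 := rfl

noncomputable def mu1 (U : ℕ) : ArithmeticFunction ℝ := trunc U (ArithmeticFunction.moebius : ArithmeticFunction ℝ)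
noncomputable def mu2 (U : ℕ) : ArithmeticFunction ℝ := (ArithmeticFunction.moebius : ArithmeticFunction ℝ) - mu1 U
noncomputable def la1 (V : ℕ) : ArithmeticFunction ℝ := trunc V ArithmeticFunction.vonMangoldt
noncomputable def la2 (V : ℕ) : ArithmeticFunction ℝ := ArithmeticFunction.vonMangoldt - la1 V
noncomputable def bb (U : ℕ) : ArithmeticFunction ℝ := mu2 U * (ArithmeticFunction.zeta : ArithmeticFunction ℝ)
noncomputable def cc (U V : ℕ) : ArithmeticFunction ℝ := mu1 U * la1 V

lemma vaughan (U V : ℕ) : ArithmeticFunction.vonMangoldt = mu1 U * ArithmeticFunction.log + la1 V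
    - cc U V * (ArithmeticFunction.zeta : ArithmeticFunction ℝ) + la2 V * bb U := by
  have h1 : (ArithmeticFunction.moebius : ArithmeticFunction ℝ) * (ArithmeticFunction.zeta : ArithmeticFunction ℝ) = 1 :=
    ArithmeticFunction.coe_moebius_mul_coe_zeta
  have h2 := ArithmeticFunction.vonMangoldt_mul_zeta
  unfold cc bb la2 mu2
  linear_combination (la1 V - ArithmeticFunction.vonMangoldt) * h1 + (mu1 U) * h2

lemma abs_moebius_real_le (n : ℕ) : |((ArithmeticFunction.moebius : ArithmeticFunction ℝ)) n| ≤ 1 := by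
  rw [ArithmeticFunction.intCoe_apply]
  have := ArithmeticFunction.abs_moebius_le_one (n := n)
  exact_mod_cast this

lemma abs_mu1_le (U n : ℕ) : |mu1 U n| ≤ 1 := by
  unfold mu1; rw [trunc_apply]
  split_ifs
  · exact abs_moebius_real_le n
  · simp

lemma mu1_zero (U n : ℕ) (h : U < n) : mu1 U n = 0 := by
  unfold mu1; rw [trunc_apply, if_neg (by omega)]

lemma af_sub_apply (f g : ArithmeticFunction ℝ) (n : ℕ) : (f - g) n = f n - g n := by
  have h : (f - g + g) n = f n := by rw [sub_add_cancel]
  rw [ArithmeticFunction.add_apply] at h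
  linarith

lemma mu2_apply (U n : ℕ) : mu2 U n = if n ≤ U then 0 else (ArithmeticFunction.moebius : ArithmeticFunction ℝ) n := by
  unfold mu2 mu1
  rw [af_sub_apply, trunc_apply]
  split_ifs <;> simp

lemma la2_apply (U n : ℕ) : la2 U n = if n ≤ U then 0 else ArithmeticFunction.vonMangoldt n := by
  unfold la2 la1
  rw [af_sub_apply, trunc_apply]
  split_ifs <;> simp

lemma la1_nonneg (V n : ℕ) : 0 ≤ la1 V n := by
  unfold la1; rw [trunc_apply]
  split_ifs
  · exact ArithmeticFunction.vonMangoldt_nonneg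
  · exact le_rfl

lemma la1_le (V n : ℕ) : la1 V n ≤ ArithmeticFunction.vonMangoldt n := by
  unfold la1; rw [trunc_apply]
  split_ifs
  · exact le_rfl
  · exact ArithmeticFunction.vonMangoldt_nonneg

lemma abs_la2_le (V n : ℕ) : |la2 V n| ≤ Real.log n := by
  rw [la2_apply]
  split_ifs
  · simp; exact Real.log_natCast_nonneg n
  · rw [abs_of_nonneg ArithmeticFunction.vonMangoldt_nonneg]
    exact ArithmeticFunction.vonMangoldt_le_log

lemma abs_bb_le (U n : ℕ) : |bb U n| ≤ n.divisors.card := by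
  unfold bb
  rw [ArithmeticFunction.mul_apply]
  refine (abs_sum_le_sum_abs _ _).trans ?_
  rw [Nat.sum_divisorsAntidiagonal (fun d e => |mu2 U d * (ArithmeticFunction.zeta : ArithmeticFunction ℝ) e|),
    card_eq_sum_ones]
  push_cast
  apply sum_le_sum
  intro d hd
  rw [abs_mul]
  have h1 : |mu2 U d| ≤ 1 := by
    rw [mu2_apply]; split_ifs
    · simp
    · exact abs_moebius_real_le d
  have h2 : |(ArithmeticFunction.zeta : ArithmeticFunction ℝ) (n / d)| ≤ 1 := by
    rw [ArithmeticFunction.natCoe_apply, ArithmeticFunction.zeta_apply]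
    split_ifs <;> simp
  nlinarith [abs_nonneg (mu2 U d), abs_nonneg ((ArithmeticFunction.zeta : ArithmeticFunction ℝ) (n / d))]

lemma bb_zero (U n : ℕ) (h : n ≤ U) : bb U n = 0 := by
  unfold bb
  rw [ArithmeticFunction.mul_apply]
  apply sum_eq_zero
  intro p hp
  have hp1 := Nat.mem_divisorsAntidiagonal.mp hp
  have : p.1 ≤ n := Nat.divisor_le (Nat.fst_mem_divisors_of_mem_antidiagonal hp)
  rw [mu2_apply, if_pos (this.trans h), zero_mul]

lemma abs_cc_le (U V n : ℕ) : |cc U V n| ≤ Real.log n := by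
  rw [← ArithmeticFunction.log_apply, ← ArithmeticFunction.zeta_mul_vonMangoldt]
  unfold cc
  rw [ArithmeticFunction.mul_apply, ArithmeticFunction.mul_apply]
  refine (abs_sum_le_sum_abs _ _).trans ?_
  apply sum_le_sum
  intro p hp
  have hp1 := Nat.mem_divisorsAntidiagonal.mp hp
  rw [abs_mul, abs_of_nonneg (la1_nonneg V _)]
  have : p.1 ≠ 0 := by intro h; rw [h] at hp1; simp at hp1; omega
  rw [ArithmeticFunction.natCoe_apply, ArithmeticFunction.zeta_apply, if_neg this]
  have := abs_mu1_le U p.1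
  have := la1_le V p.2
  have := la1_nonneg V p.2
  have := abs_nonneg (mu1 U p.1)
  push_cast
  nlinarith

lemma cc_zero (U V n : ℕ) (h : U * V < n) : cc U V n = 0 := by
  unfold cc
  rw [ArithmeticFunction.mul_apply]
  apply sum_eq_zero
  intro p hp
  have hp1 := Nat.mem_divisorsAntidiagonal.mp hp
  by_cases h1 : U < p.1
  · rw [mu1_zero U _ h1, zero_mul]
  · by_cases h2 : V < p.2
    · unfold la1; rw [trunc_apply, if_neg (by omega), mul_zero]
    · exfalso
      push Not at h1 h2
      have := Nat.mul_le_mul h1 h2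
      omega

/-- inner type I sum -/
lemma typeI_inner {γ : ℝ} (h0 : 71/72 < γ) (h1 : γ < 1) : ∃ C : ℝ, 0 < C ∧
    ∀ (N d m : ℕ) (h : ℝ), 1 ≤ d → d ≤ N → m ≤ 4 * N / d - N / d → 
      1 ≤ |h| → |h| ≤ (N:ℝ) ^ (1/72 : ℝ) →
      ‖∑ i ∈ range m, ee (h * ((d * (N / d + 1 + i) : ℕ) : ℝ) ^ γ)‖ ≤ C * (N:ℝ) ^ (0.51 : ℝ) := by
  obtain ⟨C, hC, hb⟩ := expsum_bound h0 h1
  refine ⟨C, hC, ?_⟩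
  intro N d m h hd hdN hm hh1 hh2
  have := hb N 0 h (d * (N / d + 1)) d m (by exact_mod_cast hd.trans hdN) hd ?_ ?_ hh1 hh2
  · convert this using 4 with i hi
    rw [zero_mul, zero_add]
    congr 3
    ring
  · have := Nat.lt_mul_div_succ N (show 0 < d by omega)
    exact_mod_cast this.le
  · have h3 : d * (N / d + 1) + d * m ≤ 5 * N := by
      have h4 := Nat.mul_le_mul_left d hm
      have h5 := Nat.mul_div_le (4 * N) d
      have h6 := Nat.mul_div_le N d
      rw [Nat.mul_sub] at h4
      have h7 : d * (N / d + 1) = d * (N / d) + d := by ring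
      omega
    exact_mod_cast h3

lemma sum_Ioc_eq_range (a b : ℕ) (g : ℕ → ℂ) : ∑ m ∈ Ioc a b, g m = ∑ i ∈ range (b - a), g (a + 1 + i) := by
  rw [← Ico_add_one_add_one_eq_Ioc, sum_Ico_eq_sum_range]
  congr 2
  omega

lemma typeI_a {γ : ℝ} (h0 : 71/72 < γ) (h1 : γ < 1) : ∃ C : ℝ, 0 < C ∧
    ∀ (N U : ℕ) (h : ℝ), 1 ≤ N → U ≤ N → 1 ≤ |h| → |h| ≤ (N:ℝ) ^ (1/72 : ℝ) →
      ‖∑ n ∈ Ioc N (4 * N), ((mu1 U * ArithmeticFunction.log) n : ℂ) * ee (h * (n:ℝ) ^ γ)‖ ≤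
        C * U * Real.log (5 * N) * (N:ℝ) ^ (0.51 : ℝ) := by
  obtain ⟨C, hC, hb⟩ := typeI_inner h0 h1
  refine ⟨2 * C, by positivity, ?_⟩
  intro N U h hN hU hh1 hh2
  have e : ∑ n ∈ Ioc N (4 * N), ((mu1 U * ArithmeticFunction.log) n : ℂ) * ee (h * (n:ℝ) ^ γ) =
      ∑ d ∈ Icc 1 (4 * N), (mu1 U d : ℂ) * ∑ m ∈ Ioc (N / d) (4 * N / d), (Real.log m : ℂ) * ee (h * ((d * m : ℕ):ℝ) ^ γ) := by
    simp_rw [mul_sum]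
    rw [← sum_antidiag N (4 * N) (fun d m => (mu1 U d : ℂ) * ((Real.log m : ℂ) * ee (h * ((d * m : ℕ):ℝ) ^ γ)))]
    refine sum_congr rfl fun n hn => ?_
    rw [ArithmeticFunction.mul_apply]
    push_cast
    rw [sum_mul]
    refine sum_congr rfl fun p hp => ?_
    rw [← (Nat.mem_divisorsAntidiagonal.mp hp).1, ArithmeticFunction.log_apply]
    push_cast
    ring
  rw [e]
  have hsub : Icc 1 U ⊆ Icc 1 (4 * N) := Icc_subset_Icc le_rfl (by omega)
  rw [← sum_subset hsub]
  swap
  · intro d _ hd2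
    by_cases hd : d ≤ U
    · have := mem_Icc.mp (by assumption : d ∈ Icc 1 (4*N))
      exact absurd (mem_Icc.mpr ⟨this.1, hd⟩) hd2
    · rw [mu1_zero U d (by omega)]; simp
  refine (norm_sum_le _ _).trans ?_
  have hlog : 0 ≤ Real.log (5 * N) := by
    have : (1:ℝ) ≤ N := by exact_mod_cast hN
    exact Real.log_nonneg (by linarith)
  have hterm : ∀ d ∈ Icc 1 U, ‖(mu1 U d : ℂ) * ∑ m ∈ Ioc (N / d) (4 * N / d), (Real.log m : ℂ) * ee (h * ((d * m : ℕ):ℝ) ^ γ)‖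
      ≤ 2 * Real.log (5 * N) * (C * (N:ℝ) ^ (0.51 : ℝ)) := by
    intro d hd
    rw [mem_Icc] at hd
    rw [norm_mul, Complex.norm_real, Real.norm_eq_abs, sum_Ioc_eq_range]
    have h2 := abel_bound (fun i => Real.log ((N / d + 1 + i : ℕ):ℝ)) (fun i => ee (h * ((d * (N / d + 1 + i) : ℕ):ℝ) ^ γ))
      (C * (N:ℝ) ^ (0.51 : ℝ)) (4 * N / d - N / d) (fun i => Real.log_natCast_nonneg _) ?_
      (fun m hm => hb N d m h hd.1 (hd.2.trans hU) hm hh1 hh2)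
    · have h3 : Real.log ((N / d + 1 + (4 * N / d - N / d) : ℕ):ℝ) ≤ Real.log (5 * N) := by
        apply Real.log_le_log
        · positivity
        · have h4 : N / d + 1 + (4 * N / d - N / d) ≤ 5 * N := by
            have h5 : N / d ≤ 4 * N / d := Nat.div_le_div_right (by omega)
            have h6 := Nat.div_le_self (4 * N) d
            omega
          exact_mod_cast h4
      have h5 := abs_mu1_le U d
      calc |mu1 U d| * _ ≤ 1 * (2 * Real.log ((N / d + 1 + (4 * N / d - N / d) : ℕ):ℝ) * (C * (N:ℝ) ^ (0.51 : ℝ))) :=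
            mul_le_mul h5 h2 (norm_nonneg _) zero_le_one
        _ ≤ _ := by rw [one_mul]; gcongr
    · intro i j hij
      apply Real.log_le_log
      · positivity
      · exact_mod_cast (by omega)
  refine (sum_le_sum hterm).trans ?_
  rw [sum_const, Nat.card_Icc, nsmul_eq_mul, Nat.add_sub_cancel]
  apply le_of_eq; ring

lemma typeI_b {γ : ℝ} (h0 : 71/72 < γ) (h1 : γ < 1) : ∃ C : ℝ, 0 < C ∧
    ∀ (N U V : ℕ) (h : ℝ), 1 ≤ N → U * V ≤ N → 1 ≤ |h| → |h| ≤ (N:ℝ) ^ (1/72 : ℝ) →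
      ‖∑ n ∈ Ioc N (4 * N), ((cc U V * (ArithmeticFunction.zeta : ArithmeticFunction ℝ)) n : ℂ) * ee (h * (n:ℝ) ^ γ)‖ ≤
        C * (U * V) * Real.log (5 * N) * (N:ℝ) ^ (0.51 : ℝ) := by
  obtain ⟨C, hC, hb⟩ := typeI_inner h0 h1
  refine ⟨C, by positivity, ?_⟩
  intro N U V h hN hU hh1 hh2
  have e : ∑ n ∈ Ioc N (4 * N), ((cc U V * (ArithmeticFunction.zeta : ArithmeticFunction ℝ)) n : ℂ) * ee (h * (n:ℝ) ^ γ) =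
      ∑ d ∈ Icc 1 (4 * N), (cc U V d : ℂ) * ∑ m ∈ Ioc (N / d) (4 * N / d), ee (h * ((d * m : ℕ):ℝ) ^ γ) := by
    simp_rw [mul_sum]
    rw [← sum_antidiag N (4 * N) (fun d m => (cc U V d : ℂ) * (ee (h * ((d * m : ℕ):ℝ) ^ γ)))]
    refine sum_congr rfl fun n hn => ?_
    rw [ArithmeticFunction.mul_apply]
    push_cast
    rw [sum_mul]
    refine sum_congr rfl fun p hp => ?_
    have hp' := Nat.mem_divisorsAntidiagonal.mp hp
    rw [← hp'.1, ArithmeticFunction.natCoe_apply, ArithmeticFunction.zeta_apply, if_neg]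
    · push_cast
      ring
    · intro h; rw [h] at hp'; simp at hp'; omega
  rw [e]
  have hsub : Icc 1 (U * V) ⊆ Icc 1 (4 * N) := Icc_subset_Icc le_rfl (by omega)
  rw [← sum_subset hsub]
  swap
  · intro d hd1 hd2
    by_cases hd : d ≤ U * V
    · have := mem_Icc.mp hd1
      exact absurd (mem_Icc.mpr ⟨this.1, hd⟩) hd2
    · rw [cc_zero U V d (by omega)]; simp
  refine (norm_sum_le _ _).trans ?_
  have hlog : 0 ≤ Real.log (5 * N) := by
    have : (1:ℝ) ≤ N := by exact_mod_cast hN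
    exact Real.log_nonneg (by linarith)
  have hterm : ∀ d ∈ Icc 1 (U * V), ‖(cc U V d : ℂ) * ∑ m ∈ Ioc (N / d) (4 * N / d), ee (h * ((d * m : ℕ):ℝ) ^ γ)‖
      ≤ Real.log (5 * N) * (C * (N:ℝ) ^ (0.51 : ℝ)) := by
    intro d hd
    rw [mem_Icc] at hd
    rw [norm_mul, Complex.norm_real, Real.norm_eq_abs, sum_Ioc_eq_range]
    have h2 := hb N d (4 * N / d - N / d) h hd.1 (hd.2.trans hU) le_rfl hh1 hh2
    refine mul_le_mul ((abs_cc_le U V d).trans ?_) h2 (norm_nonneg _) hlog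
    apply Real.log_le_log
    · exact_mod_cast hd.1
    · exact_mod_cast (by omega)
  refine (sum_le_sum hterm).trans ?_
  rw [sum_const, Nat.card_Icc, nsmul_eq_mul, Nat.add_sub_cancel]
  apply le_of_eq; push_cast; ring

end PSRoth

namespace PSRoth
open Finset

lemma typeII_pair {γ : ℝ} (h0 : 71/72 < γ) (h1 : γ < 1) : ∃ C : ℝ, 0 < C ∧
    ∀ (N Q K k1 k2 : ℕ) (h : ℝ), 1 ≤ K → 2 * K ≤ N → Q ≤ K → k1 ∈ Ioc K (K + Q) → k2 ∈ Ioc K (K + Q) → k1 ≠ k2 →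
      1 ≤ |h| → |h| ≤ (N:ℝ) ^ (1/72 : ℝ) →
      ‖∑ m ∈ Icc 1 (4 * N / K), (if m ∈ Ioc (N / k1) (4 * N / k1) then ee (h * ((k1 * m : ℕ) : ℝ) ^ γ) else 0) *
        (starRingEnd ℂ) (if m ∈ Ioc (N / k2) (4 * N / k2) then ee (h * ((k2 * m : ℕ) : ℝ) ^ γ) else 0)‖ ≤
        C * ((N:ℝ) ^ (1/72:ℝ) * (Q:ℝ) ^ (1/2:ℝ) * ((N:ℝ) / (2 * K)) ^ (1/2:ℝ)) := by
  obtain ⟨C, hC, hb⟩ := typeII_inner h0 h1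
  refine ⟨C, hC, ?_⟩
  have key : ∀ (N Q K k1 k2 : ℕ) (h : ℝ), 1 ≤ K → 2 * K ≤ N → Q ≤ K → k1 ∈ Ioc K (K + Q) → k2 ∈ Ioc K (K + Q) → k2 < k1 →
      1 ≤ |h| → |h| ≤ (N:ℝ) ^ (1/72 : ℝ) →
      ‖∑ m ∈ Icc 1 (4 * N / K), (if m ∈ Ioc (N / k1) (4 * N / k1) then ee (h * ((k1 * m : ℕ) : ℝ) ^ γ) else 0) *
        (starRingEnd ℂ) (if m ∈ Ioc (N / k2) (4 * N / k2) then ee (h * ((k2 * m : ℕ) : ℝ) ^ γ) else 0)‖ ≤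
        C * ((N:ℝ) ^ (1/72:ℝ) * (Q:ℝ) ^ (1/2:ℝ) * ((N:ℝ) / (2 * K)) ^ (1/2:ℝ)) := by
    intro N Q K k1 k2 h hK hKN hQK hk1 hk2 hlt hh1 hh2
    rw [mem_Ioc] at hk1 hk2
    have d1 : N / k1 ≤ N / k2 := Nat.div_le_div_left hlt.le (by omega)
    have d2 : 4 * N / k1 ≤ 4 * N / k2 := Nat.div_le_div_left hlt.le (by omega)
    have d3 : 4 * N / k1 ≤ 4 * N / K := Nat.div_le_div_left hk1.1.le (by omega)
    have e : ∑ m ∈ Icc 1 (4 * N / K), (if m ∈ Ioc (N / k1) (4 * N / k1) then ee (h * ((k1 * m : ℕ) : ℝ) ^ γ) else 0) *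
        (starRingEnd ℂ) (if m ∈ Ioc (N / k2) (4 * N / k2) then ee (h * ((k2 * m : ℕ) : ℝ) ^ γ) else 0) =
        ∑ m ∈ Ioc (N / k2) (4 * N / k1), ee (h * ((k1:ℝ) ^ γ - (k2:ℝ) ^ γ) * (m : ℝ) ^ γ) := by
      have hsub : Ioc (N / k2) (4 * N / k1) ⊆ Icc 1 (4 * N / K) := by
        intro m hm
        rw [mem_Ioc] at hm
        rw [mem_Icc]
        exact ⟨lt_of_le_of_lt (Nat.zero_le _) hm.1, hm.2.trans d3⟩
      rw [← sum_subset hsub]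
      · refine sum_congr rfl fun m hm => ?_
        rw [mem_Ioc] at hm
        rw [if_pos (mem_Ioc.mpr ⟨by omega, hm.2⟩), if_pos (mem_Ioc.mpr ⟨hm.1, by omega⟩), ← ee_sub]
        congr 1
        push_cast
        rw [Real.mul_rpow (by positivity) (by positivity), Real.mul_rpow (by positivity) (by positivity)]
        ring
      · intro m _ hm2
        by_cases c1 : m ∈ Ioc (N / k1) (4 * N / k1)
        · by_cases c2 : m ∈ Ioc (N / k2) (4 * N / k2)
          · exfalso
            rw [mem_Ioc] at c1 c2 hm2
            omega
          · rw [if_neg c2]; simp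
        · rw [if_neg c1]; simp
    rw [e, sum_Ioc_eq_range]
    have hK' : (1:ℝ) ≤ K := by exact_mod_cast hK
    have hNK : 2 * (K:ℝ) ≤ N := by exact_mod_cast hKN
    have hX : 1 ≤ (N:ℝ) / (2 * K) := by rw [le_div_iff₀ (by positivity)]; linarith
    have hk2' : (K:ℝ) ≤ k2 := by exact_mod_cast hk2.1.le
    have hk1' : (K:ℝ) ≤ k1 := by exact_mod_cast hk1.1.le
    refine hb N K ((N:ℝ) / (2 * K)) Q h k1 k2 (N / k2 + 1) (4 * N / k1 - N / k2) hK' hX ?_ hk2' hlt ?_ ?_ ?_ ?_ hh1 hh2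
    · have : (K:ℝ) * ((N:ℝ) / (2 * K)) = N / 2 := by field_simp
      rw [this]; linarith
    · exact_mod_cast (by omega : k1 ≤ 2 * K)
    · have : (k1:ℝ) ≤ Q + k2 := by exact_mod_cast (by omega : k1 ≤ Q + k2)
      linarith
    · have h2 := Nat.lt_mul_div_succ N (show 0 < k2 by omega)
      have h3 : (N:ℝ) ≤ k2 * ((N / k2 + 1 : ℕ) : ℝ) := by exact_mod_cast h2.le
      rw [div_le_iff₀ (by positivity)]
      have h4 : (k2:ℝ) ≤ 2 * K := by exact_mod_cast (by omega : k2 ≤ 2 * K)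
      nlinarith [Nat.cast_nonneg (α := ℝ) (N / k2 + 1)]
    · have h2 : N / k2 + 1 + (4 * N / k1 - N / k2) ≤ 4 * N / K + 1 := by
        have : N / k2 ≤ 4 * N / K := (Nat.div_le_div_left hk2.1.le (by omega)).trans (Nat.div_le_div_right (by omega))
        omega
      have h3 : ((N / k2 + 1 : ℕ) : ℝ) + ((4 * N / k1 - N / k2 : ℕ) : ℝ) ≤ ((4 * N / K : ℕ) : ℝ) + 1 := by exact_mod_cast h2
      have h4 : ((4 * N / K : ℕ) : ℝ) ≤ 8 * ((N:ℝ) / (2 * K)) := by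
        refine Nat.cast_div_le.trans (le_of_eq ?_)
        push_cast; field_simp; ring
      linarith
  intro N Q K k1 k2 h hK hKN hQK hk1 hk2 hne hh1 hh2
  rcases lt_or_gt_of_ne hne with hlt | hlt
  · have := key N Q K k2 k1 h hK hKN hQK hk2 hk1 hlt hh1 hh2
    rw [← Complex.norm_conj, map_sum]
    refine le_trans (le_of_eq ?_) this
    congr 1
    refine sum_congr rfl fun m _ => ?_
    rw [map_mul, Complex.conj_conj, mul_comm]
  · exact key N Q K k1 k2 h hK hKN hQK hk1 hk2 hlt hh1 hh2

lemma typeII_block {γ : ℝ} (h0 : 71/72 < γ) (h1 : γ < 1) : ∃ C : ℝ, 0 < C ∧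
    ∀ (N Q K U : ℕ) (h L : ℝ) (u : ℕ → ℝ), 1 ≤ Q → Q ≤ K → 8 ≤ U → 0 ≤ L → (∀ k ∈ Ioc K (K + Q), |u k| ≤ L) →
      3 * ((Q:ℝ) ^ (3/2:ℝ) * (N:ℝ) ^ (1/72:ℝ)) ≤ (U:ℝ) ^ (1/2:ℝ) →
      1 ≤ |h| → |h| ≤ (N:ℝ) ^ (1/72 : ℝ) →
      ‖∑ k ∈ Ioc K (K + Q), ∑ m ∈ Ioc (N / k) (4 * N / k), (u k : ℂ) * ((bb U m : ℂ) * ee (h * ((k * m : ℕ) : ℝ) ^ γ))‖ ≤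
        C * L * (1 + Real.log (4 * N)) ^ 2 * (Q:ℝ) ^ (1/2:ℝ) * ((N:ℝ) / K) := by
  obtain ⟨C, hC, hb⟩ := typeII_pair h0 h1
  refine ⟨8 + C, by positivity, ?_⟩
  intro N Q K U h L u hQ hQK hU hL hu hcond hh1 hh2
  have hlogN : 0 ≤ Real.log (4 * N) := by
    have := Real.log_natCast_nonneg (4 * N); push_cast at this; exact this
  by_cases hbig : 4 * N / K ≤ U
  · have : ∑ k ∈ Ioc K (K + Q), ∑ m ∈ Ioc (N / k) (4 * N / k), (u k : ℂ) * ((bb U m : ℂ) * ee (h * ((k * m : ℕ) : ℝ) ^ γ)) = 0 := by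
      apply sum_eq_zero
      intro k hk
      apply sum_eq_zero
      intro m hm
      rw [mem_Ioc] at hk hm
      have : 4 * N / k ≤ 4 * N / K := Nat.div_le_div_left hk.1.le (by omega)
      rw [bb_zero U m (by omega)]; simp
    rw [this]; simp only [norm_zero]; positivity
  push Not at hbig
  set X : ℝ := (N:ℝ) / (2 * K) with hXdef
  have hK0 : (0:ℝ) < K := by exact_mod_cast (by omega : 0 < K)
  have hcardle : ((4 * N / K : ℕ) : ℝ) ≤ 8 * X := by
    refine Nat.cast_div_le.trans (le_of_eq ?_)
    rw [hXdef]; push_cast; field_simp; ring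
  have hUX : (U:ℝ) ≤ 8 * X := by
    have : (U:ℝ) ≤ ((4 * N / K : ℕ) : ℝ) := by exact_mod_cast hbig.le
    linarith
  have hU8 : (8:ℝ) ≤ U := by exact_mod_cast hU
  have hX1 : 1 ≤ X := by linarith
  have hX0 : 0 < X := by linarith
  have hKN : 2 * K ≤ N := by
    rw [hXdef, le_div_iff₀ (by positivity)] at hX1
    have : ((2 * K : ℕ):ℝ) ≤ N := by push_cast; linarith
    exact_mod_cast this
  have hXQ : (Q:ℝ) ^ (3/2:ℝ) * (N:ℝ) ^ (1/72:ℝ) ≤ X ^ (1/2:ℝ) := by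
    have h2 : (U:ℝ) ^ (1/2:ℝ) ≤ 3 * X ^ (1/2:ℝ) := by
      calc (U:ℝ) ^ (1/2:ℝ) ≤ (9 * X) ^ (1/2:ℝ) := Real.rpow_le_rpow (by positivity) (by linarith) (by norm_num)
        _ = 3 * X ^ (1/2:ℝ) := by
          rw [Real.mul_rpow (by norm_num) hX0.le]
          congr 1
          rw [← Real.sqrt_eq_rpow, show (9:ℝ) = 3 ^ 2 by norm_num, Real.sqrt_sq (by norm_num)]
    linarith
  set I := Icc 1 (4 * N / K) with hI
  set P : ℕ → ℕ → ℂ := fun k m => if m ∈ Ioc (N / k) (4 * N / k) then ee (h * ((k * m : ℕ) : ℝ) ^ γ) else 0 with hP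
  set G : ℕ → ℂ := fun m => ∑ k ∈ Ioc K (K + Q), (u k : ℂ) * P k m with hG
  have e1 : ∑ k ∈ Ioc K (K + Q), ∑ m ∈ Ioc (N / k) (4 * N / k), (u k : ℂ) * ((bb U m : ℂ) * ee (h * ((k * m : ℕ) : ℝ) ^ γ))
      = ∑ m ∈ I, (bb U m : ℂ) * G m := by
    simp only [hG, mul_sum]
    rw [sum_comm (s := I)]
    refine sum_congr rfl fun k hk => ?_
    rw [mem_Ioc] at hk
    have hsub : Ioc (N / k) (4 * N / k) ⊆ I := by
      intro m hm
      rw [mem_Ioc] at hm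
      rw [hI, mem_Icc]
      exact ⟨lt_of_le_of_lt (Nat.zero_le _) hm.1, hm.2.trans (Nat.div_le_div_left hk.1.le (by omega))⟩
    rw [← sum_subset hsub]
    · refine sum_congr rfl fun m hm => ?_
      simp only [hP]
      rw [if_pos hm]; ring
    · intro m _ hm
      simp only [hP]
      rw [if_neg hm]; simp
  rw [e1]
  have hcs : ‖∑ m ∈ I, (bb U m : ℂ) * G m‖ ^ 2 ≤ (∑ m ∈ I, |bb U m| ^ 2) * ∑ m ∈ I, ‖G m‖ ^ 2 := by
    refine le_trans ?_ (sum_mul_sq_le_sq_mul_sq I (fun m => |bb U m|) (fun m => ‖G m‖))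
    gcongr
    refine (norm_sum_le _ _).trans (le_of_eq ?_)
    refine sum_congr rfl fun m _ => ?_
    rw [norm_mul, Complex.norm_real, Real.norm_eq_abs]
  have hbb : ∑ m ∈ I, |bb U m| ^ 2 ≤ 8 * X * (1 + Real.log (4 * N)) ^ 4 := by
    calc ∑ m ∈ I, |bb U m| ^ 2 ≤ ∑ m ∈ I, ((m.divisors.card : ℝ)) ^ 2 := by
          apply sum_le_sum; intro m _
          have := abs_bb_le U m
          gcongr
      _ ≤ ((4 * N / K : ℕ) : ℝ) * (1 + Real.log ((4 * N / K : ℕ) : ℝ)) ^ 3 := sum_tau_sq_le _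
      _ ≤ (8 * X) * (1 + Real.log (4 * N)) ^ 3 := by
          have hl : Real.log ((4 * N / K : ℕ) : ℝ) ≤ Real.log (4 * N) := by
            apply Real.log_le_log
            · exact_mod_cast (by omega : 0 < 4 * N / K)
            · exact_mod_cast Nat.div_le_self _ _
          have := Real.log_natCast_nonneg (4 * N / K)
          gcongr
      _ ≤ _ := by
          gcongr ?_ * ?_
          exact pow_le_pow_right₀ (by linarith) (by norm_num)
  have hGG : ∑ m ∈ I, ‖G m‖ ^ 2 ≤ L ^ 2 * ((8 + C) * (Q * X)) := by
    have e2 : ((∑ m ∈ I, ‖G m‖ ^ 2 : ℝ) : ℂ) = ∑ k1 ∈ Ioc K (K + Q), ∑ k2 ∈ Ioc K (K + Q),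
        ((u k1 : ℂ) * (u k2 : ℂ)) * ∑ m ∈ I, P k1 m * (starRingEnd ℂ) (P k2 m) := by
      push_cast
      have : ∀ m ∈ I, ((‖G m‖ : ℂ)) ^ 2 = ∑ k1 ∈ Ioc K (K + Q), ∑ k2 ∈ Ioc K (K + Q),
          ((u k1 : ℂ) * (u k2 : ℂ)) * (P k1 m * (starRingEnd ℂ) (P k2 m)) := by
        intro m _
        rw [← Complex.mul_conj']
        simp only [hG, map_sum, map_mul, Complex.conj_ofReal]
        rw [sum_mul_sum]
        refine sum_congr rfl fun k1 _ => sum_congr rfl fun k2 _ => ?_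
        ring
      rw [sum_congr rfl this, sum_comm]
      refine sum_congr rfl fun k1 _ => ?_
      rw [sum_comm]
      refine sum_congr rfl fun k2 _ => ?_
      rw [mul_sum]
    have e3 : ∑ m ∈ I, ‖G m‖ ^ 2 = ‖((∑ m ∈ I, ‖G m‖ ^ 2 : ℝ) : ℂ)‖ := by
      rw [Complex.norm_real, Real.norm_of_nonneg (by positivity)]
    rw [e3, e2]
    have hbd : ∀ k1 ∈ Ioc K (K + Q), ∀ k2 ∈ Ioc K (K + Q),
        ‖((u k1 : ℂ) * (u k2 : ℂ)) * ∑ m ∈ I, P k1 m * (starRingEnd ℂ) (P k2 m)‖ ≤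
        L ^ 2 * ((if k1 = k2 then 8 * X else 0) + C * ((N:ℝ) ^ (1/72:ℝ) * (Q:ℝ) ^ (1/2:ℝ) * X ^ (1/2:ℝ))) := by
      intro k1 hk1 k2 hk2
      rw [norm_mul, norm_mul, Complex.norm_real, Complex.norm_real, Real.norm_eq_abs, Real.norm_eq_abs]
      have hpos : 0 ≤ C * ((N:ℝ) ^ (1/72:ℝ) * (Q:ℝ) ^ (1/2:ℝ) * X ^ (1/2:ℝ)) := by positivity
      have hL2 : |u k1| * |u k2| ≤ L ^ 2 := by
        rw [sq]; exact mul_le_mul (hu k1 hk1) (hu k2 hk2) (abs_nonneg _) hL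
      refine mul_le_mul hL2 ?_ (norm_nonneg _) (by positivity)
      split_ifs with heq
      · have : ‖∑ m ∈ I, P k1 m * (starRingEnd ℂ) (P k2 m)‖ ≤ ∑ m ∈ I, (1:ℝ) := by
          refine (norm_sum_le _ _).trans (sum_le_sum fun m _ => ?_)
          have hP1 : ∀ k, ‖P k m‖ ≤ 1 := by
            intro k; simp only [hP]; split_ifs
            · rw [norm_ee]
            · simp
          rw [norm_mul, Complex.norm_conj]
          exact mul_le_one₀ (hP1 _) (norm_nonneg _) (hP1 _)
        rw [sum_const, nsmul_eq_mul, mul_one, hI, Nat.card_Icc, Nat.add_sub_cancel] at this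
        linarith
      · rw [zero_add]
        exact hb N Q K k1 k2 h (by omega) hKN hQK hk1 hk2 heq hh1 hh2
    refine (norm_sum_le _ _).trans ((sum_le_sum fun k1 hk1 => (norm_sum_le _ _).trans (sum_le_sum fun k2 hk2 => hbd k1 hk1 k2 hk2)).trans ?_)
    simp_rw [← mul_sum]
    gcongr
    have hdiag : ∑ k1 ∈ Ioc K (K + Q), ∑ k2 ∈ Ioc K (K + Q), ((if k1 = k2 then 8 * X else 0) + C * ((N:ℝ) ^ (1/72:ℝ) * (Q:ℝ) ^ (1/2:ℝ) * X ^ (1/2:ℝ)))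
        = Q * (8 * X) + Q * Q * (C * ((N:ℝ) ^ (1/72:ℝ) * (Q:ℝ) ^ (1/2:ℝ) * X ^ (1/2:ℝ))) := by
      simp_rw [sum_add_distrib, sum_ite_eq]
      rw [sum_ite_mem, inter_self]
      simp [mul_assoc]
    rw [hdiag]
    have h5 : (Q:ℝ) * (Q:ℝ) ^ (1/2:ℝ) = (Q:ℝ) ^ (3/2:ℝ) := by
      have hQ0 : (0:ℝ) < Q := by exact_mod_cast hQ
      rw [← Real.rpow_one_add' hQ0.le (by norm_num)]
      norm_num
    have h6 : X ^ (1/2:ℝ) * X ^ (1/2:ℝ) = X := by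
      rw [← Real.rpow_add hX0]; norm_num
    calc Q * (8 * X) + Q * Q * (C * ((N:ℝ) ^ (1/72:ℝ) * (Q:ℝ) ^ (1/2:ℝ) * X ^ (1/2:ℝ)))
        = Q * (8 * X) + Q * C * (((Q * (Q:ℝ) ^ (1/2:ℝ)) * (N:ℝ) ^ (1/72:ℝ)) * X ^ (1/2:ℝ)) := by ring
      _ ≤ Q * (8 * X) + Q * C * (X ^ (1/2:ℝ) * X ^ (1/2:ℝ)) := by rw [h5]; gcongr
      _ = _ := by rw [h6]; ring
  have hfin : ‖∑ m ∈ I, (bb U m : ℂ) * G m‖ ^ 2 ≤ ((8 + C) * L * (1 + Real.log (4 * N)) ^ 2 * (Q:ℝ) ^ (1/2:ℝ) * ((N:ℝ) / K)) ^ 2 := by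
    refine hcs.trans ((mul_le_mul hbb hGG (by positivity) (by positivity)).trans ?_)
    have h7 : ((Q:ℝ) ^ (1/2:ℝ)) ^ 2 = Q := by
      rw [← Real.rpow_natCast, ← Real.rpow_mul (by positivity)]; norm_num
    have h8 : (N:ℝ) / K = 2 * X := by rw [hXdef]; field_simp
    rw [h8]
    have : ((8 + C) * L * (1 + Real.log (4 * N)) ^ 2 * (Q:ℝ) ^ (1/2:ℝ) * (2 * X)) ^ 2 =
      (8 + C) ^ 2 * L ^ 2 * (1 + Real.log (4 * N)) ^ 4 * ((Q:ℝ) ^ (1/2:ℝ)) ^ 2 * 4 * X ^ 2 := by ring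
    rw [this, h7]
    have : 8 * X * (1 + Real.log (4 * N)) ^ 4 * (L ^ 2 * ((8 + C) * (Q * X))) =
      8 * (8 + C) * (L ^ 2 * (1 + Real.log (4 * N)) ^ 4 * Q * X ^ 2) := by ring
    rw [this]
    have : (8 + C) ^ 2 * L ^ 2 * (1 + Real.log (4 * N)) ^ 4 * (Q:ℝ) * 4 * X ^ 2 =
      (4 * (8 + C) ^ 2) * (L ^ 2 * (1 + Real.log (4 * N)) ^ 4 * Q * X ^ 2) := by ring
    rw [this]
    exact mul_le_mul_of_nonneg_right (by nlinarith) (by positivity)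
  exact (sq_le_sq₀ (norm_nonneg _) (by positivity)).mp hfin

end PSRoth

namespace PSRoth
open Finset Filter

lemma eventually_log_pow (A c δ : ℝ) (k : ℕ) (hA : 0 < A) (hc : 0 < c) (hδ : 0 < δ) :
    ∀ᶠ x : ℝ in atTop, A * (1 + Real.log (c * x)) ^ k ≤ x ^ δ := by
  have h := isLittleO_log_rpow_rpow_atTop (k:ℝ) hδ
  have h2 := h.bound (c := (A * 2 ^ k)⁻¹) (by positivity)
  have h3 : ∀ᶠ x : ℝ in atTop, 1 + Real.log c ≤ Real.log x := Real.tendsto_log_atTop.eventually_ge_atTop _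
  have h4 : ∀ᶠ x : ℝ in atTop, c⁻¹ ≤ x := eventually_ge_atTop _
  filter_upwards [h2, h3, h4, eventually_ge_atTop 1] with x h2 h3 h4 h5
  have hx : 0 < x := by linarith
  have hl : 0 ≤ Real.log x := Real.log_nonneg h5
  rw [Real.rpow_natCast, Real.norm_of_nonneg (by positivity), Real.norm_of_nonneg (by positivity)] at h2
  have h6 : 0 ≤ Real.log (c * x) := Real.log_nonneg (by
    have := mul_le_mul_of_nonneg_left h4 hc.le
    rwa [mul_inv_cancel₀ hc.ne'] at this)
  have h7 : 1 + Real.log (c * x) ≤ 2 * Real.log x := by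
    rw [Real.log_mul hc.ne' hx.ne']; linarith
  calc A * (1 + Real.log (c * x)) ^ k ≤ A * (2 * Real.log x) ^ k := by gcongr
    _ = (A * 2 ^ k) * Real.log x ^ k := by rw [mul_pow]; ring
    _ ≤ (A * 2 ^ k) * ((A * 2 ^ k)⁻¹ * x ^ δ) := by gcongr
    _ = x ^ δ := by field_simp

lemma sum_blocks (Q J : ℕ) (g : ℕ → ℂ) :
    ∑ k ∈ Ioc Q (Q * (J + 1)), g k = ∑ j ∈ Icc 1 J, ∑ k ∈ Ioc (Q * j) (Q * j + Q), g k := by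
  induction J with
  | zero => simp
  | succ J ih =>
    rw [sum_Icc_succ_top (by omega), ← ih]
    rw [show Q * (J + 1) + Q = Q * (J + 1 + 1) by ring]
    rw [sum_Ioc_consecutive]
    · nlinarith
    · nlinarith

lemma typeII {γ : ℝ} (h0 : 71/72 < γ) (h1 : γ < 1) : ∃ C : ℝ, 0 < C ∧
    ∀ (N Q U : ℕ) (h : ℝ), 1 ≤ N → 1 ≤ Q → Q ≤ N → 8 ≤ U →
      3 * ((Q:ℝ) ^ (3/2:ℝ) * (N:ℝ) ^ (1/72:ℝ)) ≤ (U:ℝ) ^ (1/2:ℝ) →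
      1 ≤ |h| → |h| ≤ (N:ℝ) ^ (1/72 : ℝ) →
      ‖∑ n ∈ Ioc N (4 * N), ((la2 Q * bb U) n : ℂ) * ee (h * (n:ℝ) ^ γ)‖ ≤
        C * (1 + Real.log (5 * N)) ^ 4 * ((N:ℝ) * (Q:ℝ) ^ (-(1/2):ℝ)) := by
  obtain ⟨C, hC, hb⟩ := typeII_block h0 h1
  refine ⟨2 * C, by positivity, ?_⟩
  intro N Q U h hN hQ hQN hU hcond hh1 hh2
  have hN' : (1:ℝ) ≤ N := by exact_mod_cast hN
  have hQ0 : (0:ℝ) < Q := by exact_mod_cast hQ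
  have hlog0 : 0 ≤ Real.log (5 * N) := Real.log_nonneg (by linarith)
  set L := 2 * Real.log (5 * N) with hL
  have e : ∑ n ∈ Ioc N (4 * N), ((la2 Q * bb U) n : ℂ) * ee (h * (n:ℝ) ^ γ) =
      ∑ k ∈ Icc 1 (4 * N), ∑ m ∈ Ioc (N / k) (4 * N / k), (la2 Q k : ℂ) * ((bb U m : ℂ) * ee (h * ((k * m : ℕ):ℝ) ^ γ)) := by
    rw [← sum_antidiag N (4 * N) (fun k m => (la2 Q k : ℂ) * ((bb U m : ℂ) * ee (h * ((k * m : ℕ):ℝ) ^ γ)))]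
    refine sum_congr rfl fun n hn => ?_
    rw [ArithmeticFunction.mul_apply]
    push_cast
    rw [sum_mul]
    refine sum_congr rfl fun p hp => ?_
    rw [← (Nat.mem_divisorsAntidiagonal.mp hp).1]
    push_cast
    ring
  set g : ℕ → ℂ := fun k => ∑ m ∈ Ioc (N / k) (4 * N / k), (la2 Q k : ℂ) * ((bb U m : ℂ) * ee (h * ((k * m : ℕ):ℝ) ^ γ)) with hg
  have e2 : ∑ k ∈ Icc 1 (4 * N), g k = ∑ k ∈ Ioc Q (Q * (4 * N + 1)), g k := by
    have hz1 : ∀ k, k ≤ Q → g k = 0 := by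
      intro k hk
      simp only [hg]
      apply sum_eq_zero; intro m _
      rw [la2_apply, if_pos hk]; simp
    have hz2 : ∀ k, 4 * N < k → g k = 0 := by
      intro k hk
      simp only [hg]
      rw [Nat.div_eq_of_lt hk, Nat.div_eq_of_lt (by omega)]; simp
    have h3 : ∑ k ∈ Icc 1 (4 * N), g k = ∑ k ∈ Ioc Q (4 * N), g k := by
      symm
      apply sum_subset
      · intro k hk; rw [mem_Ioc] at hk; rw [mem_Icc]; omega
      · intro k hk hk2; rw [mem_Icc] at hk; rw [mem_Ioc] at hk2
        exact hz1 k (by omega)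
    rw [h3]
    apply sum_subset
    · intro k hk; rw [mem_Ioc] at hk ⊢
      refine ⟨hk.1, ?_⟩
      nlinarith
    · intro k hk hk2; rw [mem_Ioc] at hk hk2
      exact hz2 k (by omega)
  rw [e, e2, sum_blocks]
  have hblock : ∀ j ∈ Icc 1 (4 * N), ‖∑ k ∈ Ioc (Q * j) (Q * j + Q), g k‖ ≤
      C * L * (1 + Real.log (4 * N)) ^ 2 * (Q:ℝ) ^ (1/2:ℝ) * ((N:ℝ) / (Q * j : ℕ)) := by
    intro j hj
    rw [mem_Icc] at hj
    refine hb N Q (Q * j) U h L (fun k => la2 Q k) hQ (by nlinarith) hU (by positivity) ?_ hcond hh1 hh2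
    intro k hk
    rw [mem_Ioc] at hk
    refine (abs_la2_le Q k).trans ?_
    have hk0 : 0 < k := by omega
    have : (k:ℝ) ≤ (5 * N) ^ 2 := by
      have : k ≤ (5 * N) ^ 2 := by
        have h4 : Q * j ≤ N * (4 * N) := Nat.mul_le_mul hQN hj.2
        nlinarith
      exact_mod_cast this
    calc Real.log k ≤ Real.log ((5 * N) ^ 2) := Real.log_le_log (by exact_mod_cast hk0) this
      _ = L := by rw [Real.log_pow, hL]; norm_num
  refine (norm_sum_le _ _).trans ((sum_le_sum hblock).trans ?_)
  have e3 : ∀ j ∈ Icc 1 (4 * N), C * L * (1 + Real.log (4 * N)) ^ 2 * (Q:ℝ) ^ (1/2:ℝ) * ((N:ℝ) / (Q * j : ℕ)) =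
      C * L * (1 + Real.log (4 * N)) ^ 2 * ((N:ℝ) * (Q:ℝ) ^ (-(1/2):ℝ)) * (j:ℝ)⁻¹ := by
    intro j hj
    have : (Q:ℝ) ^ (-(1/2):ℝ) = (Q:ℝ) ^ (1/2:ℝ) / Q := by
      rw [eq_div_iff hQ0.ne', ← Real.rpow_add_one hQ0.ne']; norm_num
    rw [this]; push_cast
    have : (0:ℝ) < j := by exact_mod_cast (mem_Icc.mp hj).1
    field_simp
  rw [sum_congr rfl e3, ← mul_sum]
  have h5 := sum_inv_Icc_le (4 * N)
  push_cast at h5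
  have h6 : Real.log (4 * N) ≤ Real.log (5 * N) := Real.log_le_log (by positivity) (by linarith)
  have h7 : 0 ≤ Real.log (4 * N) := Real.log_nonneg (by linarith)
  calc C * L * (1 + Real.log (4 * N)) ^ 2 * ((N:ℝ) * (Q:ℝ) ^ (-(1/2):ℝ)) * ∑ j ∈ Icc 1 (4 * N), (j:ℝ)⁻¹
      ≤ C * (2 * (1 + Real.log (5 * N))) * (1 + Real.log (5 * N)) ^ 2 * ((N:ℝ) * (Q:ℝ) ^ (-(1/2):ℝ)) * (1 + Real.log (5 * N)) := by
        gcongr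
        · rw [hL]; linarith
        · linarith
    _ = _ := by ring

lemma eventually_nat {p : ℝ → Prop} (h : ∀ᶠ x : ℝ in atTop, p x) : ∀ᶠ n : ℕ in atTop, p n :=
  tendsto_natCast_atTop_atTop.eventually h

lemma floor_half {x : ℝ} (hx : 2 ≤ x) : x / 2 ≤ (⌊x⌋₊ : ℝ) := by
  have := Nat.lt_floor_add_one x
  linarith

lemma Lambda_sum {γ : ℝ} (h0 : 71/72 < γ) (h1 : γ < 1) :
    ∀ᶠ N : ℕ in atTop, ∀ h : ℝ, 1 ≤ |h| → |h| ≤ (N:ℝ) ^ (1/72 : ℝ) →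
      ‖∑ n ∈ Ioc N (4 * N), (ArithmeticFunction.vonMangoldt n : ℂ) * ee (h * (n:ℝ) ^ γ)‖ ≤ (N:ℝ) ^ (23/24:ℝ) / 2 := by
  obtain ⟨C1, hC1, b1⟩ := typeI_a h0 h1
  obtain ⟨C2, hC2, b2⟩ := typeI_b h0 h1
  obtain ⟨C3, hC3, b3⟩ := typeII h0 h1
  have ev1 := eventually_nat (eventually_log_pow (6 * (C1 + C2)) 5 (1/50) 1 (by positivity) (by norm_num) (by norm_num))
  have ev2 := eventually_nat (eventually_log_pow (12 * C3) 5 (1/22 - 1/24) 4 (by positivity) (by norm_num) (by norm_num))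
  have ev3 : ∀ᶠ N : ℕ in atTop, (16:ℝ) ≤ (N:ℝ) ^ (1/3:ℝ) :=
    eventually_nat ((tendsto_rpow_atTop (by norm_num)).eventually_ge_atTop 16)
  have ev4 : ∀ᶠ N : ℕ in atTop, (2:ℝ) ≤ (N:ℝ) ^ (1/11:ℝ) :=
    eventually_nat ((tendsto_rpow_atTop (by norm_num)).eventually_ge_atTop 2)
  have ev5 : ∀ᶠ N : ℕ in atTop, (6:ℝ) ≤ (N:ℝ) ^ (1/72:ℝ) :=
    eventually_nat ((tendsto_rpow_atTop (by norm_num)).eventually_ge_atTop 6)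
  filter_upwards [ev1, ev2, ev3, ev4, ev5, eventually_ge_atTop 1] with N ev1 ev2 ev3 ev4 ev5 hN h hh1 hh2
  have hN' : (1:ℝ) ≤ N := by exact_mod_cast hN
  have hN0 : (0:ℝ) < N := by linarith
  set x : ℝ := (N:ℝ) with hx
  set U := ⌊x ^ (1/3:ℝ)⌋₊ with hU
  set Q := ⌊x ^ (1/11:ℝ)⌋₊ with hQ
  have hUle : (U:ℝ) ≤ x ^ (1/3:ℝ) := Nat.floor_le (by positivity)
  have hQle : (Q:ℝ) ≤ x ^ (1/11:ℝ) := Nat.floor_le (by positivity)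
  have hUge : x ^ (1/3:ℝ) / 2 ≤ (U:ℝ) := floor_half (by linarith)
  have hQge : x ^ (1/11:ℝ) / 2 ≤ (Q:ℝ) := floor_half (by linarith)
  have hU8 : 8 ≤ U := by
    have : (8:ℝ) ≤ U := by linarith
    exact_mod_cast this
  have hQ1 : 1 ≤ Q := by
    have : (1:ℝ) ≤ Q := by linarith
    exact_mod_cast this
  have hUN : U ≤ N := by
    have : (U:ℝ) ≤ N := hUle.trans (by
      calc x ^ (1/3:ℝ) ≤ x ^ (1:ℝ) := Real.rpow_le_rpow_of_exponent_le hN' (by norm_num)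
        _ = N := by simp [hx])
    exact_mod_cast this
  have hQN : Q ≤ N := by
    have : (Q:ℝ) ≤ N := hQle.trans (by
      calc x ^ (1/11:ℝ) ≤ x ^ (1:ℝ) := Real.rpow_le_rpow_of_exponent_le hN' (by norm_num)
        _ = N := by simp [hx])
    exact_mod_cast this
  have hUQ : (U:ℝ) * Q ≤ x ^ (14/33:ℝ) := by
    calc (U:ℝ) * Q ≤ x ^ (1/3:ℝ) * x ^ (1/11:ℝ) := by gcongr
      _ = x ^ (14/33:ℝ) := by rw [← Real.rpow_add hN0]; norm_num
  have hUQN : U * Q ≤ N := by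
    have : ((U * Q : ℕ):ℝ) ≤ N := by
      push_cast
      exact hUQ.trans (by
      calc x ^ (14/33:ℝ) ≤ x ^ (1:ℝ) := Real.rpow_le_rpow_of_exponent_le hN' (by norm_num)
        _ = N := by simp [hx])
    exact_mod_cast this
  have hcond : 3 * ((Q:ℝ) ^ (3/2:ℝ) * x ^ (1/72:ℝ)) ≤ (U:ℝ) ^ (1/2:ℝ) := by
    have a1 : (Q:ℝ) ^ (3/2:ℝ) ≤ x ^ (3/22:ℝ) := by
      calc (Q:ℝ) ^ (3/2:ℝ) ≤ (x ^ (1/11:ℝ)) ^ (3/2:ℝ) := Real.rpow_le_rpow (by positivity) hQle (by norm_num)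
        _ = _ := by rw [← Real.rpow_mul hN0.le]; norm_num
    have a2 : x ^ (1/6:ℝ) / 2 ≤ (U:ℝ) ^ (1/2:ℝ) := by
      calc x ^ (1/6:ℝ) / 2 = (x ^ (1/3:ℝ)) ^ (1/2:ℝ) * (1/2) := by
            rw [← Real.rpow_mul hN0.le]; norm_num; ring
        _ ≤ (x ^ (1/3:ℝ)) ^ (1/2:ℝ) * (1/2:ℝ) ^ (1/2:ℝ) := by
            gcongr
            calc (1/2:ℝ) = (1/2:ℝ) ^ (1:ℝ) := by simp
              _ ≤ _ := Real.rpow_le_rpow_of_exponent_ge (by norm_num) (by norm_num) (by norm_num)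
        _ = (x ^ (1/3:ℝ) / 2) ^ (1/2:ℝ) := by
            rw [← Real.mul_rpow (by positivity) (by norm_num)]; congr 1; ring
        _ ≤ _ := Real.rpow_le_rpow (by positivity) hUge (by norm_num)
    have a3 : 6 * (x ^ (3/22:ℝ) * x ^ (1/72:ℝ)) ≤ x ^ (1/6:ℝ) := by
      calc 6 * (x ^ (3/22:ℝ) * x ^ (1/72:ℝ)) ≤ x ^ (1/72:ℝ) * (x ^ (3/22:ℝ) * x ^ (1/72:ℝ)) := by gcongr
        _ = x ^ (1/72 + (3/22 + 1/72):ℝ) := by rw [← Real.rpow_add hN0, ← Real.rpow_add hN0]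
        _ ≤ _ := Real.rpow_le_rpow_of_exponent_le hN' (by norm_num)
    calc 3 * ((Q:ℝ) ^ (3/2:ℝ) * x ^ (1/72:ℝ)) ≤ 3 * (x ^ (3/22:ℝ) * x ^ (1/72:ℝ)) := by gcongr
      _ ≤ x ^ (1/6:ℝ) / 2 := by linarith
      _ ≤ _ := a2
  have c1 := b1 N U h hN hUN hh1 hh2
  have c2 := b2 N U Q h hN hUQN hh1 hh2
  have c3 := b3 N Q U h hN hQ1 hQN hU8 hcond hh1 hh2
  have hl0 : 0 ≤ Real.log (5 * x) := Real.log_nonneg (by linarith)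
  have d12 : C1 * U * Real.log (5 * x) * x ^ (0.51:ℝ) + C2 * (U * Q) * Real.log (5 * x) * x ^ (0.51:ℝ) ≤ x ^ (23/24:ℝ) / 6 := by
    have hUU : (U:ℝ) ≤ U * Q := by
      have : (1:ℝ) ≤ Q := by exact_mod_cast hQ1
      nlinarith [Nat.cast_nonneg (α := ℝ) U]
    calc C1 * U * Real.log (5 * x) * x ^ (0.51:ℝ) + C2 * (U * Q) * Real.log (5 * x) * x ^ (0.51:ℝ)
        ≤ C1 * (U * Q) * (1 + Real.log (5 * x)) * x ^ (0.51:ℝ) + C2 * (U * Q) * (1 + Real.log (5 * x)) * x ^ (0.51:ℝ) := by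
          gcongr <;> linarith
      _ = (6 * (C1 + C2) * (1 + Real.log (5 * x)) ^ 1) * (U * Q) * x ^ (0.51:ℝ) / 6 := by ring
      _ ≤ x ^ (1/50:ℝ) * x ^ (14/33:ℝ) * x ^ (0.51:ℝ) / 6 := by gcongr
      _ = x ^ (1/50 + 14/33 + 0.51 : ℝ) / 6 := by rw [← Real.rpow_add hN0, ← Real.rpow_add hN0]
      _ ≤ _ := by
          gcongr
          · norm_num
  have d3 : C3 * (1 + Real.log (5 * x)) ^ 4 * (x * (Q:ℝ) ^ (-(1/2):ℝ)) ≤ x ^ (23/24:ℝ) / 6 := by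
    have a1 : (Q:ℝ) ^ (-(1/2):ℝ) ≤ 2 * x ^ (-(1/22):ℝ) := by
      calc (Q:ℝ) ^ (-(1/2):ℝ) ≤ (x ^ (1/11:ℝ) / 2) ^ (-(1/2):ℝ) := Real.rpow_le_rpow_of_nonpos (by positivity) hQge (by norm_num)
        _ = (x ^ (1/11:ℝ)) ^ (-(1/2):ℝ) * (1/2:ℝ) ^ (-(1/2):ℝ) := by
            rw [← Real.mul_rpow (by positivity) (by norm_num)]; congr 1; ring
        _ ≤ (x ^ (1/11:ℝ)) ^ (-(1/2):ℝ) * 2 := by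
            gcongr
            calc (1/2:ℝ) ^ (-(1/2):ℝ) ≤ (1/2:ℝ) ^ (-1:ℝ) := Real.rpow_le_rpow_of_exponent_ge (by norm_num) (by norm_num) (by norm_num)
              _ = 2 := by rw [Real.rpow_neg_one]; norm_num
        _ = _ := by rw [← Real.rpow_mul hN0.le]; norm_num; ring
    calc C3 * (1 + Real.log (5 * x)) ^ 4 * (x * (Q:ℝ) ^ (-(1/2):ℝ)) ≤ C3 * (1 + Real.log (5 * x)) ^ 4 * (x * (2 * x ^ (-(1/22):ℝ))) := by gcongr
      _ = (12 * C3 * (1 + Real.log (5 * x)) ^ 4) * (x * x ^ (-(1/22):ℝ)) / 6 := by ring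
      _ ≤ x ^ (1/22 - 1/24 : ℝ) * (x * x ^ (-(1/22):ℝ)) / 6 := by gcongr
      _ = x ^ (23/24:ℝ) / 6 := by
          rw [← Real.rpow_one_add' hN0.le (by norm_num), ← Real.rpow_add hN0]; norm_num
  have hv : ∀ n ∈ Ioc N (4 * N), (ArithmeticFunction.vonMangoldt n : ℂ) * ee (h * (n:ℝ) ^ γ) =
      ((mu1 U * ArithmeticFunction.log) n : ℂ) * ee (h * (n:ℝ) ^ γ) - ((cc U Q * (ArithmeticFunction.zeta : ArithmeticFunction ℝ)) n : ℂ) * ee (h * (n:ℝ) ^ γ)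
        + ((la2 Q * bb U) n : ℂ) * ee (h * (n:ℝ) ^ γ) := by
    intro n hn
    rw [mem_Ioc] at hn
    have h3 : ArithmeticFunction.vonMangoldt n = (mu1 U * ArithmeticFunction.log) n - (cc U Q * (ArithmeticFunction.zeta : ArithmeticFunction ℝ)) n + (la2 Q * bb U) n := by
      conv_lhs => rw [vaughan U Q]
      rw [ArithmeticFunction.add_apply, af_sub_apply, ArithmeticFunction.add_apply]
      have : la1 Q n = 0 := by unfold la1; rw [trunc_apply, if_neg (by omega)]
      rw [this]; ring
    rw [h3]; push_cast; ring
  rw [sum_congr rfl hv, sum_add_distrib, sum_sub_distrib]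
  refine (norm_add_le _ _).trans ?_
  have := norm_sub_le (∑ n ∈ Ioc N (4 * N), ((mu1 U * ArithmeticFunction.log) n : ℂ) * ee (h * (n:ℝ) ^ γ)) (∑ n ∈ Ioc N (4 * N), ((cc U Q * (ArithmeticFunction.zeta : ArithmeticFunction ℝ)) n : ℂ) * ee (h * (n:ℝ) ^ γ))
  have hpos : 0 ≤ x ^ (23/24:ℝ) := by positivity
  linarith

lemma prime_sum {γ : ℝ} (h0 : 71/72 < γ) (h1 : γ < 1) :
    ∀ᶠ N : ℕ in atTop, ∀ h : ℝ, 1 ≤ |h| → |h| ≤ (N:ℝ) ^ (1/72 : ℝ) →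
      ‖∑ p ∈ (Ioc N (4 * N)).filter Nat.Prime, (Real.log p : ℂ) * ee (h * (p:ℝ) ^ γ)‖ ≤ (N:ℝ) ^ (23/24:ℝ) := by
  have ev2 := eventually_nat (eventually_log_pow 8 5 (1/4) 1 (by positivity) (by norm_num) (by norm_num))
  filter_upwards [Lambda_sum h0 h1, ev2, eventually_ge_atTop 1] with N hL ev2 hN h hh1 hh2
  have hN' : (1:ℝ) ≤ N := by exact_mod_cast hN
  have hN0 : (0:ℝ) < N := by linarith
  have key := hL h hh1 hh2
  have e : ∑ n ∈ Ioc N (4 * N), (ArithmeticFunction.vonMangoldt n : ℂ) * ee (h * (n:ℝ) ^ γ) =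
      ∑ p ∈ (Ioc N (4 * N)).filter Nat.Prime, (Real.log p : ℂ) * ee (h * (p:ℝ) ^ γ) +
      ∑ p ∈ (Ioc N (4 * N)).filter (fun n => ¬ Nat.Prime n), (ArithmeticFunction.vonMangoldt p : ℂ) * ee (h * (p:ℝ) ^ γ) := by
    rw [← sum_filter_add_sum_filter_not _ Nat.Prime]
    congr 1
    refine sum_congr rfl fun p hp => ?_
    rw [ArithmeticFunction.vonMangoldt_apply_prime (mem_filter.mp hp).2]
  have hnp : ‖∑ p ∈ (Ioc N (4 * N)).filter (fun n => ¬ Nat.Prime n), (ArithmeticFunction.vonMangoldt p : ℂ) * ee (h * (p:ℝ) ^ γ)‖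
      ≤ Chebyshev.psi ((4 * N : ℕ):ℝ) - Chebyshev.theta ((4 * N : ℕ):ℝ) := by
    have hψ : Chebyshev.psi ((4 * N : ℕ):ℝ) - Chebyshev.theta ((4 * N : ℕ):ℝ) =
        ∑ p ∈ (Ioc 0 (4 * N)).filter (fun n => ¬ Nat.Prime n), ArithmeticFunction.vonMangoldt p := by
      unfold Chebyshev.psi Chebyshev.theta
      rw [Nat.floor_natCast, ← sum_filter_add_sum_filter_not (Ioc 0 (4 * N)) Nat.Prime]
      have : ∑ p ∈ (Ioc 0 (4 * N)).filter Nat.Prime, ArithmeticFunction.vonMangoldt p = ∑ p ∈ (Ioc 0 (4 * N)).filter Nat.Prime, Real.log p :=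
        sum_congr rfl fun p hp => by rw [ArithmeticFunction.vonMangoldt_apply_prime (mem_filter.mp hp).2]
      rw [this]; ring
    rw [hψ]
    refine (norm_sum_le _ _).trans ?_
    calc _ = ∑ p ∈ (Ioc N (4 * N)).filter (fun n => ¬ Nat.Prime n), ArithmeticFunction.vonMangoldt p := by
          refine sum_congr rfl fun p _ => ?_
          rw [norm_mul, norm_ee, mul_one, Complex.norm_real, Real.norm_of_nonneg ArithmeticFunction.vonMangoldt_nonneg]
      _ ≤ _ := by
          apply sum_le_sum_of_subset_of_nonneg
          · apply filter_subset_filter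
            exact Ioc_subset_Ioc (by omega) le_rfl
          · intro _ _ _; exact ArithmeticFunction.vonMangoldt_nonneg
  have hcheb := Chebyshev.psi_sub_theta_le (x := ((4 * N : ℕ):ℝ)) (by exact_mod_cast (by omega))
  have hsmall : 2 * √((4 * N : ℕ):ℝ) * Real.log ((4 * N : ℕ):ℝ) ≤ (N:ℝ) ^ (23/24:ℝ) / 2 := by
    have h3 : √((4 * N : ℕ):ℝ) = 2 * (N:ℝ) ^ (1/2:ℝ) := by
      push_cast
      rw [Real.sqrt_mul (by norm_num), Real.sqrt_eq_rpow (N:ℝ)]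
      congr 1
      rw [show (4:ℝ) = 2 ^ 2 by norm_num, Real.sqrt_sq (by norm_num)]
    have h4 : Real.log ((4 * N : ℕ):ℝ) ≤ 1 + Real.log (5 * N) := by
      have := Real.log_le_log (by positivity) (by push_cast; linarith : ((4 * N : ℕ):ℝ) ≤ 5 * N)
      linarith
    rw [h3]
    calc 2 * (2 * (N:ℝ) ^ (1/2:ℝ)) * Real.log ((4 * N : ℕ):ℝ) ≤ 2 * (2 * (N:ℝ) ^ (1/2:ℝ)) * (1 + Real.log (5 * N)) := by gcongr
      _ = (N:ℝ) ^ (1/2:ℝ) * (8 * (1 + Real.log (5 * N)) ^ 1) / 2 := by ring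
      _ ≤ (N:ℝ) ^ (1/2:ℝ) * (N:ℝ) ^ (1/4:ℝ) / 2 := by gcongr
      _ = (N:ℝ) ^ (1/2 + 1/4:ℝ) / 2 := by rw [← Real.rpow_add hN0]
      _ ≤ _ := by
        gcongr <;> first | exact hN' | norm_num
  have e2 := eq_sub_of_add_eq e.symm
  rw [e2]
  refine (norm_sub_le _ _).trans ?_
  linarith

end PSRoth

namespace PSRoth
open Finset Filter

lemma cos_sum_zero (K : ℕ) (hK : 2 ≤ K) (α : ℝ) :
    ∑ j ∈ range K, Real.cos (α + 2 * Real.pi * (j / K)) = 0 := by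
  have h1 : ∑ j ∈ range K, ee ((j:ℝ) / K) = 0 := by
    have hp := Complex.isPrimitiveRoot_exp K (by omega)
    have h := hp.geom_sum_eq_zero (by omega)
    rw [← h]
    refine sum_congr rfl fun j _ => ?_
    rw [show (j:ℝ)/K = (j:ℝ) * (1 / K) by ring, ee_nat_mul]
    congr 1
    unfold ee
    congr 1
    push_cast; ring
  have h2 : ∑ j ∈ range K, ee (α / (2 * Real.pi) + (j:ℝ) / K) = 0 := by
    simp_rw [ee_add]
    rw [← mul_sum, h1, mul_zero]
  have h3 := congrArg Complex.re h2
  rw [Complex.re_sum] at h3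
  simp only [ee_re, Complex.zero_re] at h3
  rw [← h3]
  refine sum_congr rfl fun j _ => ?_
  congr 1
  have := Real.pi_pos
  field_simp

lemma sin_sums (K : ℕ) (hK : 2 ≤ K) :
    ∑ j ∈ range K, Real.sin (Real.pi * (j / K)) ^ 2 = K / 2 ∧
    ∑ j ∈ range K, Real.sin (Real.pi * (j / K)) * Real.sin (Real.pi * ((j + 1 : ℕ) / K)) =
      K / 2 * Real.cos (Real.pi / K) := by
  constructor
  · have h : ∀ j : ℕ, Real.sin (Real.pi * (j / K)) ^ 2 = 1/2 - Real.cos (0 + 2 * Real.pi * (j / K)) / 2 := by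
      intro j
      rw [Real.sin_sq_eq_half_sub]
      ring_nf
    simp_rw [h]
    rw [sum_sub_distrib, ← sum_div _ _ (2:ℝ), ← sum_div _ _ (2:ℝ), cos_sum_zero K hK]
    simp
  · have h : ∀ j : ℕ, Real.sin (Real.pi * (j / K)) * Real.sin (Real.pi * ((j + 1 : ℕ) / K)) =
        Real.cos (Real.pi / K) / 2 - Real.cos (Real.pi / K + 2 * Real.pi * (j / K)) / 2 := by
      intro j
      have e1 : Real.pi / K = Real.pi * ((j + 1 : ℕ) / K) - Real.pi * (j / K) := by push_cast; ring
      have e2 : Real.pi / K + 2 * Real.pi * (j / K) = Real.pi * ((j + 1 : ℕ) / K) + Real.pi * (j / K) := by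
        push_cast; ring
      rw [e2, e1, Real.cos_sub, Real.cos_add]
      ring
    simp_rw [h]
    rw [sum_sub_distrib, ← sum_div _ _ (2:ℝ), ← sum_div _ _ (2:ℝ), cos_sum_zero K hK]
    simp; ring

set_option maxHeartbeats 1000000 in
lemma minorant_count {ι : Type*} (P : Finset ι) (l x : ι → ℝ) (w E : ℝ) (K : ℕ)
    (hl : ∀ p ∈ P, 0 ≤ l p) (hw0 : 0 < w) (hw1 : w ≤ 1) (hK2 : 2 ≤ K) (hKw : 2 / w ≤ K)
    (hKw2 : K ≤ 3 / w)
    (hE : ∀ h : ℤ, h ≠ 0 → |h| ≤ K → |∑ p ∈ P, l p * Real.cos (2 * Real.pi * (h * x p))| ≤ E) :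
    3/4 * w * ∑ p ∈ P, l p - 2 * K ^ 2 * E ≤
      45 * ∑ p ∈ P.filter (fun p => Real.cos (Real.pi * w) < Real.cos (2 * Real.pi * x p)), l p := by
  have hπ := Real.pi_pos
  have hKpos : (0:ℝ) < K := by positivity
  have hE0 : 0 ≤ E := by
    have := hE 1 (by norm_num) (by simp; omega)
    exact (abs_nonneg _).trans this
  set s : ℕ → ℝ := fun j => Real.sin (Real.pi * (j / K)) with hs
  have hs1 : ∀ j, |s j| ≤ 1 := fun j => Real.abs_sin_le_one _
  have hsK : s K = 0 := by simp [hs, hKpos.ne']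
  have hs0 : s 0 = 0 := by simp [hs]
  obtain ⟨sq1, sq2⟩ : (∑ j ∈ range K, s j ^ 2 = K / 2) ∧
    ∑ j ∈ range K, s j * s (j+1) = K / 2 * Real.cos (Real.pi / K) := sin_sums K hK2
  clear_value s
  set cw := Real.cos (Real.pi * w) with hcw
  set Θ := ∑ p ∈ P, l p with hΘ
  have hΘ0 : 0 ≤ Θ := sum_nonneg hl
  set S : ℤ → ℝ := fun h => ∑ p ∈ P, l p * Real.cos (2 * Real.pi * (h * x p)) with hS
  have hS0 : S 0 = Θ := by simp [hS, hΘ]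
  -- the square
  set Q : ℝ → ℝ := fun y => ∑ j ∈ range K, ∑ k ∈ range K, s j * s k * Real.cos (2 * Real.pi * (((j:ℤ) - k : ℤ) * y)) with hQ
  have hQ0 : ∀ y, 0 ≤ Q y := by
    intro y
    have : Q y = (∑ j ∈ range K, s j * Real.cos (2 * Real.pi * (j * y))) ^ 2 +
        (∑ j ∈ range K, s j * Real.sin (2 * Real.pi * (j * y))) ^ 2 := by
      rw [sq, sq, sum_mul_sum, sum_mul_sum, ← sum_add_distrib]
      refine sum_congr rfl fun j _ => ?_
      rw [← sum_add_distrib]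
      refine sum_congr rfl fun k _ => ?_
      push_cast
      rw [show 2 * Real.pi * (((j:ℝ) - k) * y) = 2 * Real.pi * (j * y) - 2 * Real.pi * (k * y) by ring, Real.cos_sub]
      ring
    rw [this]; positivity
  have hQ1 : ∀ y, Q y ≤ K ^ 2 := by
    intro y
    calc Q y = ∑ j ∈ range K, ∑ k ∈ range K, s j * s k * Real.cos (2 * Real.pi * (((j:ℤ) - k : ℤ) * y)) := rfl
      _ ≤ ∑ j ∈ range K, ∑ k ∈ range K, (1:ℝ) := by
          refine sum_le_sum fun j _ => sum_le_sum fun k _ => ?_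
          refine (le_abs_self _).trans ?_
          rw [abs_mul, abs_mul]
          have h1 := hs1 j
          have h2 := hs1 k
          have h3 := Real.abs_cos_le_one (2 * Real.pi * (((j:ℤ) - k : ℤ) * y))
          calc |s j| * |s k| * _ ≤ 1 * 1 * 1 := by gcongr
            _ = 1 := by norm_num
      _ = K ^ 2 := by simp [sq]
  -- expansion
  have hexp : ∑ p ∈ P, l p * ((Real.cos (2 * Real.pi * x p) - cw) * Q (x p)) =
      ∑ j ∈ range K, ∑ k ∈ range K, s j * s k * ((S ((j:ℤ) - k + 1) + S ((j:ℤ) - k - 1)) / 2 - cw * S ((j:ℤ) - k)) := by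
    have : ∀ p ∈ P, l p * ((Real.cos (2 * Real.pi * x p) - cw) * Q (x p)) =
        ∑ j ∈ range K, ∑ k ∈ range K, s j * s k * ((l p * Real.cos (2 * Real.pi * (((j:ℤ) - k + 1 : ℤ) * x p)) +
          l p * Real.cos (2 * Real.pi * (((j:ℤ) - k - 1 : ℤ) * x p))) / 2
          - cw * (l p * Real.cos (2 * Real.pi * (((j:ℤ) - k : ℤ) * x p)))) := by
      intro p _
      rw [hQ, mul_sum, mul_sum]
      refine sum_congr rfl fun j _ => ?_
      rw [mul_sum, mul_sum]
      refine sum_congr rfl fun k _ => ?_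
      push_cast
      rw [show 2 * Real.pi * (((j:ℝ) - k + 1) * x p) = 2 * Real.pi * (((j:ℝ) - k) * x p) + 2 * Real.pi * x p by ring,
        show 2 * Real.pi * (((j:ℝ) - k - 1) * x p) = 2 * Real.pi * (((j:ℝ) - k) * x p) - 2 * Real.pi * x p by ring,
        Real.cos_add, Real.cos_sub]
      ring
    rw [sum_congr rfl this, sum_comm]
    refine sum_congr rfl fun j _ => ?_
    rw [sum_comm]
    refine sum_congr rfl fun k _ => ?_
    rw [← mul_sum, sum_sub_distrib, ← sum_div, sum_add_distrib, ← mul_sum]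
  -- main term
  set δ : ℤ → ℝ := fun h => if h = 0 then 1 else 0 with hδ
  have hSδ : ∀ h : ℤ, |h| ≤ K → |S h - Θ * δ h| ≤ E := by
    intro h hh
    by_cases h0 : h = 0
    · subst h0; simp [hS0, hδ, hE0]
    · simp only [hδ, h0, if_false, mul_zero, sub_zero]
      exact hE h h0 hh
  have hmain : ∑ j ∈ range K, ∑ k ∈ range K, s j * s k * ((δ ((j:ℤ) - k + 1) + δ ((j:ℤ) - k - 1)) / 2 - cw * δ ((j:ℤ) - k))
      = K / 2 * (Real.cos (Real.pi / K) - cw) := by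
    have a1 : ∀ j ∈ range K, ∑ k ∈ range K, s j * s k * δ ((j:ℤ) - k) = s j ^ 2 := by
      intro j hj
      rw [sum_eq_single_of_mem j hj]
      · simp [hδ]; ring
      · intro k _ hk
        have : ((j:ℤ) - k) ≠ 0 := by omega
        simp [hδ, this]
    have a2 : ∀ j ∈ range K, ∑ k ∈ range K, s j * s k * δ ((j:ℤ) - k + 1) = s j * s (j+1) := by
      intro j hj
      by_cases hjK : j + 1 < K
      · rw [sum_eq_single_of_mem (j+1) (mem_range.2 hjK)]
        · simp [hδ]
        · intro k _ hk
          have : ((j:ℤ) - k + 1) ≠ 0 := by omega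
          simp [hδ, this]
      · have : j + 1 = K := by have := mem_range.1 hj; omega
        rw [this, hsK, mul_zero]
        refine sum_eq_zero fun k hk => ?_
        have := mem_range.1 hk
        have : ((j:ℤ) - k + 1) ≠ 0 := by omega
        simp [hδ, this]
    have a3 : ∑ j ∈ range K, ∑ k ∈ range K, s j * s k * δ ((j:ℤ) - k - 1) = ∑ k ∈ range K, s k * s (k+1) := by
      rw [sum_comm]
      refine sum_congr rfl fun k hk => ?_
      rw [← a2 k hk]
      refine sum_congr rfl fun j hj => ?_
      have : δ ((j:ℤ) - k - 1) = δ ((k:ℤ) - j + 1) := by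
        simp only [hδ]
        have : ((j:ℤ) - k - 1 = 0) ↔ ((k:ℤ) - j + 1 = 0) := by omega
        simp [this]
      rw [this]; ring
    have e : ∀ j k : ℕ, s j * s k * ((δ ((j:ℤ) - k + 1) + δ ((j:ℤ) - k - 1)) / 2 - cw * δ ((j:ℤ) - k)) =
      1/2 * (s j * s k * δ ((j:ℤ) - k + 1)) + 1/2 * (s j * s k * δ ((j:ℤ) - k - 1)) - cw * (s j * s k * δ ((j:ℤ) - k)) := by
      intro j k; ring
    simp_rw [e, sum_sub_distrib, sum_add_distrib, ← mul_sum]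
    rw [a3, sum_congr rfl a1, sum_congr rfl a2, sq1, sq2]
    ring
  have herr : |∑ p ∈ P, l p * ((Real.cos (2 * Real.pi * x p) - cw) * Q (x p)) - Θ * (K / 2 * (Real.cos (Real.pi / K) - cw))|
      ≤ 2 * K ^ 2 * E := by
    rw [hexp, ← hmain, mul_sum, ← sum_sub_distrib]
    calc _ ≤ ∑ j ∈ range K, ∑ k ∈ range K, 2 * E := by
          refine (abs_sum_le_sum_abs _ _).trans (sum_le_sum fun j hj => ?_)
          rw [mul_sum, ← sum_sub_distrib]
          refine (abs_sum_le_sum_abs _ _).trans (sum_le_sum fun k hk => ?_)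
          have hj' := mem_range.1 hj
          have hk' := mem_range.1 hk
          have b1 := hSδ ((j:ℤ) - k + 1) (by rw [abs_le]; constructor <;> omega)
          have b2 := hSδ ((j:ℤ) - k - 1) (by rw [abs_le]; constructor <;> omega)
          have b3 := hSδ ((j:ℤ) - k) (by rw [abs_le]; constructor <;> omega)
          have e : s j * s k * ((S ((j:ℤ) - k + 1) + S ((j:ℤ) - k - 1)) / 2 - cw * S ((j:ℤ) - k)) -
              Θ * (s j * s k * ((δ ((j:ℤ) - k + 1) + δ ((j:ℤ) - k - 1)) / 2 - cw * δ ((j:ℤ) - k))) =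
              s j * s k * (((S ((j:ℤ) - k + 1) - Θ * δ ((j:ℤ) - k + 1)) + (S ((j:ℤ) - k - 1) - Θ * δ ((j:ℤ) - k - 1))) / 2
                - cw * (S ((j:ℤ) - k) - Θ * δ ((j:ℤ) - k))) := by ring
          rw [e, abs_mul, abs_mul]
          have b4 : |cw * (S ((j:ℤ) - k) - Θ * δ ((j:ℤ) - k))| ≤ E := by
            rw [abs_mul]
            calc _ ≤ 1 * E := by gcongr; exact Real.abs_cos_le_one _
              _ = E := one_mul _
          have b5 : |((S ((j:ℤ) - k + 1) - Θ * δ ((j:ℤ) - k + 1)) + (S ((j:ℤ) - k - 1) - Θ * δ ((j:ℤ) - k - 1))) / 2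
                - cw * (S ((j:ℤ) - k) - Θ * δ ((j:ℤ) - k))| ≤ 2 * E := by
            rw [abs_le] at b1 b2 b4 ⊢
            constructor <;> linarith [b1.1, b1.2, b2.1, b2.2, b4.1, b4.2]
          calc _ ≤ 1 * 1 * (2 * E) := by gcongr <;> apply hs1
            _ = 2 * E := by ring
      _ = 2 * K ^ 2 * E := by simp; ring
  have hcwub : cw ≤ 1 - 2 * w ^ 2 := by
    have := Real.cos_le_one_sub_mul_cos_sq (x := Real.pi * w) (by rw [abs_of_pos (by positivity)]; nlinarith)
    have e : 2 / Real.pi ^ 2 * (Real.pi * w) ^ 2 = 2 * w ^ 2 := by field_simp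
    rw [e] at this; exact this
  have hπ2 : Real.pi ^ 2 < 10 := by
    have := Real.pi_lt_d2; nlinarith
  have hcK : 1 - 5/4 * w ^ 2 ≤ Real.cos (Real.pi / K) := by
    have := Real.one_sub_sq_div_two_le_cos (x := Real.pi / K)
    have h2 : 1 / (K:ℝ) ≤ w / 2 := by
      rw [div_le_iff₀ hw0] at hKw
      rw [div_le_iff₀ hKpos]; linarith
    have h3 : (Real.pi / K) ^ 2 ≤ 10 * (w/2) ^ 2 := by
      calc (Real.pi / K) ^ 2 = Real.pi ^ 2 * (1 / (K:ℝ)) ^ 2 := by ring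
        _ ≤ _ := by gcongr
    nlinarith
  have hcwlb : 1 - cw ≤ 5 * w ^ 2 := by
    have := Real.one_sub_sq_div_two_le_cos (x := Real.pi * w)
    rw [← hcw] at this
    nlinarith [sq_nonneg w]
  have hlow : 3/4 * w * Θ ≤ Θ * (K / 2 * (Real.cos (Real.pi / K) - cw)) := by
    rw [mul_comm]
    refine mul_le_mul_of_nonneg_left ?_ hΘ0
    have hKw' : 2 ≤ K * w := by rwa [div_le_iff₀ hw0] at hKw
    calc 3/4 * w ≤ 3/8 * w * (K * w) := by nlinarith
      _ = K / 2 * (3/4 * w^2) := by ring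
      _ ≤ _ := by gcongr; linarith
  have hup : ∑ p ∈ P, l p * ((Real.cos (2 * Real.pi * x p) - cw) * Q (x p)) ≤
      45 * ∑ p ∈ P.filter (fun p => cw < Real.cos (2 * Real.pi * x p)), l p := by
    rw [mul_sum, sum_filter]
    refine sum_le_sum fun p hp => ?_
    have hlp := hl p hp
    split_ifs with hc
    · have h1 : (Real.cos (2 * Real.pi * x p) - cw) * Q (x p) ≤ 45 := by
        calc _ ≤ (5 * w ^ 2) * (3 / w) ^ 2 := by
              have h3 : Q (x p) ≤ (3 / w) ^ 2 := (hQ1 _).trans (by gcongr)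
              have h4 : Real.cos (2 * Real.pi * x p) - cw ≤ 5 * w ^ 2 := by
                linarith [Real.cos_le_one (2 * Real.pi * x p)]
              exact mul_le_mul h4 h3 (hQ0 _) (by positivity)
          _ = 45 := by field_simp; norm_num
      nlinarith
    · push Not at hc
      have : (Real.cos (2 * Real.pi * x p) - cw) * Q (x p) ≤ 0 :=
        mul_nonpos_of_nonpos_of_nonneg (by linarith) (hQ0 _)
      exact mul_nonpos_of_nonneg_of_nonpos hlp this
  have := (abs_le.1 herr).1
  linarith

end PSRoth

namespace PSRoth
open Finset Filter

/-- the PS condition in terms of `p^γ` -/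
def IsPS (γ : ℝ) (p : ℕ) : Prop := ∃ n : ℕ, (p:ℝ) ^ γ ≤ n ∧ (n:ℝ) < ((p:ℝ) + 1) ^ γ

lemma isPS_iff {γ : ℝ} (h0 : 0 < γ) (p : ℕ) :
    IsPS γ p ↔ ∃ n : ℕ, (p : ℤ) = ⌊(n : ℝ) ^ (1 / γ)⌋ := by
  unfold IsPS
  refine exists_congr fun n => ?_
  rw [eq_comm, Int.floor_eq_iff]
  have hn : (0:ℝ) ≤ n := Nat.cast_nonneg n
  have hp : (0:ℝ) ≤ p := Nat.cast_nonneg p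
  refine and_congr ?_ ?_
  · push_cast
    rw [one_div, Real.le_rpow_inv_iff_of_pos hp hn h0]
  · push_cast
    rw [one_div, Real.rpow_inv_lt_iff_of_pos hn (by linarith) h0]

lemma theta_diff : ∀ᶠ N : ℕ in atTop, (N:ℝ) ≤ ∑ p ∈ (Ioc N (4 * N)).filter Nat.Prime, Real.log p := by
  have ev := eventually_nat (eventually_log_pow 20 5 (1/4) 1 (by positivity) (by norm_num) (by norm_num))
  have ev2 : ∀ᶠ N : ℕ in atTop, (8:ℝ) ≤ (N:ℝ) ^ (1/4:ℝ) :=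
    eventually_nat ((tendsto_rpow_atTop (by norm_num)).eventually_ge_atTop 8)
  filter_upwards [ev, ev2, eventually_ge_atTop 1] with N ev ev2 hN
  have hN' : (1:ℝ) ≤ N := by exact_mod_cast hN
  have hN0 : (0:ℝ) < N := by linarith
  have e : ∑ p ∈ (Ioc N (4 * N)).filter Nat.Prime, Real.log p =
      Chebyshev.theta ((4 * N : ℕ):ℝ) - Chebyshev.theta (N:ℝ) := by
    unfold Chebyshev.theta
    rw [Nat.floor_natCast, Nat.floor_natCast, eq_sub_iff_add_eq, add_comm, ← sum_union]
    · congr 1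
      rw [← filter_union]
      congr 1
      ext k; simp only [mem_union, mem_Ioc]; omega
    · rw [disjoint_left]
      intro k h1 h2
      simp only [mem_filter, mem_Ioc] at h1 h2
      omega
  rw [e]
  have h1 := Chebyshev.theta_le_log4_mul_x (x := (N:ℝ)) hN0.le
  have h2 := Chebyshev.theta_ge (4 * N)
  have hlog4 : Real.log 4 = 2 * Real.log 2 := by
    rw [show (4:ℝ) = 2 ^ 2 by norm_num, Real.log_pow]; norm_num
  have hl2 := Real.log_two_gt_d9
  have h3 : √((4 * N : ℕ):ℝ) = 2 * (N:ℝ) ^ (1/2:ℝ) := by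
    push_cast
    rw [Real.sqrt_mul (by norm_num), Real.sqrt_eq_rpow (N:ℝ)]
    congr 1
    rw [show (4:ℝ) = 2 ^ 2 by norm_num, Real.sqrt_sq (by norm_num)]
  rw [pow_one] at ev
  have h4 : Real.log ((4 * N : ℕ) + 1:ℝ) ≤ Real.log (5 * N) :=
    Real.log_le_log (by positivity) (by push_cast; linarith)
  have h5 : Real.log ((4 * N : ℕ):ℝ) ≤ Real.log (5 * N) :=
    Real.log_le_log (by positivity) (by push_cast; linarith)
  set Y := (N:ℝ) ^ (1/4:ℝ) with hY
  have hYY : (N:ℝ) ^ (1/2:ℝ) = Y ^ 2 := by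
    rw [hY, ← Real.rpow_natCast, ← Real.rpow_mul hN0.le]; norm_num
  have hYN : (N:ℝ) = Y ^ 4 := by
    rw [hY, ← Real.rpow_natCast, ← Real.rpow_mul hN0.le]; norm_num
  rw [h3, hYY] at h2
  have h6 : 2 * (2 * Y ^ 2) * Real.log ((4 * N : ℕ):ℝ) ≤ 4 * Y ^ 2 * (Y / 20) := by
    rw [show 2 * (2 * Y ^ 2) = 4 * Y ^ 2 by ring]
    gcongr
    linarith
  have h7 : 4 * Y ^ 2 * (Y / 20) ≤ Y ^ 4 / 40 := by
    have : Y ^ 3 * 8 ≤ Y ^ 3 * Y := by gcongr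
    nlinarith
  have h8 : Y ≤ Y ^ 4 / 40 := by
    have : Y * 512 ≤ Y * Y ^ 3 := by
      gcongr
      calc (512:ℝ) = 8 ^ 3 := by norm_num
        _ ≤ _ := by gcongr
    nlinarith
  have h9 : ((4 * N : ℕ):ℝ) = 4 * N := by push_cast; ring
  have h9' : ((4 * N : ℕ):ℝ) * Real.log 2 = 4 * Y ^ 4 * Real.log 2 := by rw [h9, hYN]
  have h10 : Y ^ 4 * 0.69 ≤ Y ^ 4 * Real.log 2 := by gcongr; linarith
  rw [hlog4] at h1
  have h1' : Chebyshev.theta (N:ℝ) ≤ 2 * (Y ^ 4 * Real.log 2) := by rw [← hYN]; linarith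
  have hYpos : 0 < Y ^ 4 := by positivity
  rw [h9'] at h2
  have : Y ^ 4 ≤ Chebyshev.theta ((4 * N : ℕ):ℝ) - Chebyshev.theta (N:ℝ) := by linarith
  linarith

lemma close_of_cos {x w : ℝ} (hw0 : 0 < w) (hw1 : w ≤ 1)
    (h : Real.cos (Real.pi * w) < Real.cos (2 * Real.pi * x)) : |x - round x| < w / 2 := by
  by_contra hc
  push Not at hc
  have hπ := Real.pi_pos
  have e : Real.cos (2 * Real.pi * x) = Real.cos (2 * Real.pi * |x - round x|) := by
    have : Real.cos (2 * Real.pi * |x - round x|) = Real.cos (2 * Real.pi * (x - round x)) := by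
      rcases abs_choice (x - round x) with h | h
      · rw [h]
      · rw [h, mul_neg, Real.cos_neg]
    rw [this, show 2 * Real.pi * (x - round x) = 2 * Real.pi * x - round x * (2 * Real.pi) by ring,
      Real.cos_sub_int_mul_two_pi]
  rw [e] at h
  have h2 := abs_sub_round x
  have : Real.cos (2 * Real.pi * |x - round x|) ≤ Real.cos (Real.pi * w) := by
    apply Real.cos_le_cos_of_nonneg_of_le_pi <;> nlinarith
  linarith

open Classical in
lemma ps_count_lower {γ : ℝ} (h0 : 71/72 < γ) (h1 : γ < 1) :
    ∀ᶠ N : ℕ in atTop, (N:ℝ) ^ γ / (1000 * Real.log N) ≤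
      #((Ioc N (4 * N)).filter fun p => p.Prime ∧ IsPS γ p) := by
  have ev1 : ∀ᶠ N : ℕ in atTop, (10:ℝ) ≤ (N:ℝ) ^ (1/72 - (1-γ):ℝ) :=
    eventually_nat ((tendsto_rpow_atTop (by linarith)).eventually_ge_atTop 10)
  have ev2 : ∀ᶠ N : ℕ in atTop, (600:ℝ) ≤ (N:ℝ) ^ (1/24 - 3 * (1-γ):ℝ) :=
    eventually_nat ((tendsto_rpow_atTop (by linarith)).eventually_ge_atTop 600)
  filter_upwards [prime_sum h0 h1, theta_diff, ev1, ev2, eventually_ge_atTop 4] with N hS hθ ev1 ev2 hN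
  have hN' : (4:ℝ) ≤ N := by exact_mod_cast hN
  have hN0 : (0:ℝ) < N := by linarith
  have hγ0 : 0 < γ := by linarith
  set w := γ * (5 * (N:ℝ)) ^ (γ - 1) with hw
  have hwpos : 0 < w := by positivity
  have h51 : (1/2:ℝ) ≤ γ * 5 ^ (γ - 1) := by
    have a : (5:ℝ) ^ (-(1/2):ℝ) ≤ 5 ^ (γ - 1) := Real.rpow_le_rpow_of_exponent_le (by norm_num) (by linarith)
    have a2 : (4/9:ℝ) ≤ (5:ℝ) ^ (-(1/2):ℝ) := by
      rw [Real.rpow_neg (by norm_num), ← Real.sqrt_eq_rpow]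
      rw [show (4/9:ℝ) = (9/4)⁻¹ by norm_num]
      apply inv_anti₀ (by positivity)
      rw [Real.sqrt_le_left (by norm_num)]; norm_num
    have a3 : (5:ℝ) ^ (-(1/8):ℝ) ≤ 5 ^ (γ - 1) := Real.rpow_le_rpow_of_exponent_le (by norm_num) (by linarith)
    have a4 : (4/9:ℝ) ^ (1/4:ℝ) ≤ (5:ℝ) ^ (-(1/8):ℝ) := by
      calc (4/9:ℝ) ^ (1/4:ℝ) ≤ ((5:ℝ) ^ (-(1/2):ℝ)) ^ (1/4:ℝ) := by gcongr
        _ = _ := by rw [← Real.rpow_mul (by norm_num)]; norm_num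
    have a5 : (3/5:ℝ) ≤ (4/9:ℝ) ^ (1/4:ℝ) := by
      rw [show (1/4:ℝ) = (4:ℝ)⁻¹ by norm_num]
      rw [Real.le_rpow_inv_iff_of_pos (by norm_num) (by norm_num) (by norm_num)]
      norm_num
    nlinarith
  have hwlb : 1/2 * (N:ℝ) ^ (γ - 1) ≤ w := by
    rw [hw, Real.mul_rpow (by norm_num) hN0.le, ← mul_assoc]
    gcongr
  have hNg : (N:ℝ) ^ (γ - 1) = ((N:ℝ) ^ (1 - γ))⁻¹ := by
    rw [← Real.rpow_neg hN0.le]; congr 1; ring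
  have hw1 : w ≤ 1 := by
    have : (5 * (N:ℝ)) ^ (γ - 1) ≤ 1 := Real.rpow_le_one_of_one_le_of_nonpos (by linarith) (by linarith)
    calc w ≤ 1 * 1 := by rw [hw]; gcongr
      _ = 1 := one_mul 1
  set K := ⌈2 / w⌉₊ with hK
  have hKlb : 2 / w ≤ K := Nat.le_ceil _
  have h2w : 2 ≤ 2 / w := by rw [le_div_iff₀ hwpos]; linarith
  have hKub : (K:ℝ) ≤ 3 / w := by
    have a1 := Nat.ceil_lt_add_one (a := 2 / w) (by positivity)
    have a2 : 3 / w = 2 / w + 1 / w := by ring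
    have a3 : 1 ≤ 1 / w := by rw [le_div_iff₀ hwpos]; linarith
    linarith
  have hK2 : 2 ≤ K := by
    have : (2:ℝ) ≤ K := by linarith
    exact_mod_cast this
  have hw3 : 3 / w ≤ 6 * (N:ℝ) ^ (1 - γ) := by
    rw [div_le_iff₀ hwpos]
    calc (3:ℝ) = 6 * (N:ℝ) ^ (1 - γ) * (1/2 * (N:ℝ) ^ (γ - 1)) := by
          rw [hNg]; field_simp; norm_num
      _ ≤ _ := by gcongr
  have hKN : (K:ℝ) ≤ (N:ℝ) ^ (1/72:ℝ) := by
    calc (K:ℝ) ≤ 6 * (N:ℝ) ^ (1 - γ) := hKub.trans hw3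
      _ ≤ (N:ℝ) ^ (1/72 - (1-γ):ℝ) * (N:ℝ) ^ (1 - γ) := by gcongr; linarith
      _ = _ := by rw [← Real.rpow_add hN0]; congr 1; ring
  set P := (Ioc N (4 * N)).filter Nat.Prime with hP
  have key := minorant_count P (fun p => Real.log p) (fun p => (p:ℝ) ^ γ + w / 2) w ((N:ℝ) ^ (23/24:ℝ)) K
    (fun p _ => Real.log_natCast_nonneg p) hwpos hw1 hK2 hKlb hKub (by
      intro h hh0 hhK
      have hh1 : (1:ℝ) ≤ |(h:ℝ)| := by
        have := Int.one_le_abs hh0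
        exact_mod_cast this
      have hh2 : |(h:ℝ)| ≤ (N:ℝ) ^ (1/72:ℝ) := by
        refine le_trans ?_ hKN
        exact_mod_cast hhK
      have b := hS h hh1 hh2
      have e : ∑ p ∈ P, Real.log p * Real.cos (2 * Real.pi * (h * ((p:ℝ) ^ γ + w / 2))) =
          (ee (h * (w / 2)) * ∑ p ∈ P, (Real.log p : ℂ) * ee (h * (p:ℝ) ^ γ)).re := by
        rw [mul_sum, Complex.re_sum]
        refine sum_congr rfl fun p _ => ?_
        rw [← ee_re, ← Complex.re_ofReal_mul, mul_left_comm, ← ee_add]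
        congr 3; ring
      rw [e]
      refine (Complex.abs_re_le_norm _).trans ?_
      rw [norm_mul, norm_ee, one_mul]
      exact b)
  have hsub : ∑ p ∈ P.filter (fun p : ℕ => Real.cos (Real.pi * w) < Real.cos (2 * Real.pi * ((p:ℝ) ^ γ + w / 2))), Real.log p ≤
      #((Ioc N (4 * N)).filter fun p => p.Prime ∧ IsPS γ p) * (2 * Real.log N) := by
    have hs : P.filter (fun p : ℕ => Real.cos (Real.pi * w) < Real.cos (2 * Real.pi * ((p:ℝ) ^ γ + w / 2))) ⊆
        (Ioc N (4 * N)).filter fun p => p.Prime ∧ IsPS γ p := by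
      intro p hp
      simp only [hP, mem_filter, mem_Ioc] at hp ⊢
      refine ⟨hp.1.1, hp.1.2, ?_⟩
      have hpN : (N:ℝ) < p := by exact_mod_cast hp.1.1.1
      have hp4 : (p:ℝ) ≤ 4 * N := by exact_mod_cast hp.1.1.2
      have hppos : (0:ℝ) < p := by linarith
      have c := abs_lt.1 (close_of_cos hwpos hw1 hp.2)
      set m := round ((p:ℝ) ^ γ + w / 2) with hm
      have c1 : (p:ℝ) ^ γ < m := by linarith [c.2]
      have c2 : (m:ℝ) < (p:ℝ) ^ γ + w := by linarith [c.1]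
      have hmpos : 0 ≤ m := by
        have : (0:ℝ) < m := lt_of_le_of_lt (by positivity) c1
        exact_mod_cast this.le
      have hmm : ((m.toNat : ℕ) : ℝ) = (m:ℝ) := by
        have : ((m.toNat : ℕ) : ℤ) = m := Int.toNat_of_nonneg hmpos
        exact_mod_cast congrArg (Int.cast (R := ℝ)) this
      refine ⟨m.toNat, by rw [hmm]; exact c1.le, ?_⟩
      rw [hmm]
      have := (rpow_first_diff hγ0 h1 hppos (by linarith : (p:ℝ) < p + 1)).1
      have hmon : (5 * (N:ℝ)) ^ (γ - 1) ≤ ((p:ℝ) + 1) ^ (γ - 1) :=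
        Real.rpow_le_rpow_of_nonpos (by positivity) (by linarith) (by linarith)
      have : w ≤ γ * ((p:ℝ) + 1) ^ (γ - 1) * ((p:ℝ) + 1 - p) := by
        rw [add_sub_cancel_left, mul_one, hw]; gcongr
      linarith
    calc _ ≤ ∑ p ∈ (Ioc N (4 * N)).filter (fun p => p.Prime ∧ IsPS γ p), Real.log p :=
          sum_le_sum_of_subset_of_nonneg hs fun p _ _ => Real.log_natCast_nonneg p
      _ ≤ ∑ p ∈ (Ioc N (4 * N)).filter (fun p => p.Prime ∧ IsPS γ p), 2 * Real.log N := by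
          refine sum_le_sum fun p hp => ?_
          simp only [mem_filter, mem_Ioc] at hp
          have hpN : (N:ℝ) < p := by exact_mod_cast hp.1.1
          have hp4 : (p:ℝ) ≤ 4 * N := by exact_mod_cast hp.1.2
          have : Real.log p ≤ Real.log ((N:ℝ) ^ 2) := Real.log_le_log (by linarith) (by nlinarith)
          rw [Real.log_pow] at this
          simpa using this
      _ = _ := by rw [sum_const, nsmul_eq_mul]
  have hlogN : 0 < Real.log N := Real.log_pos (by linarith)
  rw [div_le_iff₀ (by positivity)]
  have hKE : 2 * (K:ℝ) ^ 2 * (N:ℝ) ^ (23/24:ℝ) ≤ 1/4 * w * N := by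
    have b1 : 2 * (K:ℝ) ^ 2 * (N:ℝ) ^ (23/24:ℝ) ≤ 2 * (6 * (N:ℝ) ^ (1 - γ)) ^ 2 * (N:ℝ) ^ (23/24:ℝ) := by
      gcongr; exact hKub.trans hw3
    have b2 : 600 * ((N:ℝ) ^ (1 - γ)) ^ 2 * (N:ℝ) ^ (23/24:ℝ) ≤ (N:ℝ) ^ (γ - 1) * N := by
      calc 600 * ((N:ℝ) ^ (1 - γ)) ^ 2 * (N:ℝ) ^ (23/24:ℝ) ≤
          (N:ℝ) ^ (1/24 - 3 * (1-γ):ℝ) * ((N:ℝ) ^ (1 - γ)) ^ 2 * (N:ℝ) ^ (23/24:ℝ) := by gcongr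
        _ = (N:ℝ) ^ (γ - 1) * (N:ℝ) ^ (1:ℝ) := by
          rw [← Real.rpow_natCast, ← Real.rpow_mul hN0.le, ← Real.rpow_add hN0, ← Real.rpow_add hN0, ← Real.rpow_add hN0]
          congr 1; push_cast; ring
        _ = _ := by rw [Real.rpow_one]
    have b3 : 1/2 * (N:ℝ) ^ (γ - 1) * N ≤ w * N := by gcongr
    nlinarith
  have hwN : 1/2 * (N:ℝ) ^ γ ≤ w * N := by
    calc 1/2 * (N:ℝ) ^ γ = 1/2 * (N:ℝ) ^ (γ - 1) * N := by
          rw [mul_assoc, ← Real.rpow_add_one hN0.ne']; congr 2; ring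
      _ ≤ _ := by gcongr
  have hΘ : 3/4 * w * N ≤ 3/4 * w * ∑ p ∈ P, Real.log p := by gcongr
  nlinarith

end PSRoth

namespace PSRoth
open Finset Filter

lemma roth_step (L : ℕ) (ε : ℝ) (hε : 0 < ε) (hL : cornersTheoremBound (ε / 3) ≤ L)
    (A : Finset ℕ) (hA : A ⊆ range L) (hd : ε * L ≤ #A) :
    ∃ i < L, ∃ e < L, e ≠ 0 ∧ i ∈ A ∧ i + e ∈ A ∧ i + 2 * e ∈ A := by
  have h := roth_3ap_theorem_nat ε hε hL A hA hd
  unfold ThreeAPFree at h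
  push Not at h
  obtain ⟨a, ha, b, hb, c, hc, habc, hne⟩ := h
  have ha' := mem_range.1 (hA ha)
  have hb' := mem_range.1 (hA hb)
  have hc' := mem_range.1 (hA hc)
  rcases lt_or_gt_of_ne hne with h1 | h1
  · refine ⟨a, ha', b - a, by omega, by omega, ha, ?_, ?_⟩
    · rwa [show a + (b - a) = b by omega]
    · rwa [show a + 2 * (b - a) = c by omega]
  · refine ⟨c, hc', b - c, by omega, by omega, hc, ?_, ?_⟩
    · rwa [show c + (b - c) = b by omega]
    · rwa [show c + 2 * (b - c) = a by omega]

lemma varnavides (α : ℝ) (hα : 0 < α) : ∃ c > 0, ∃ n0 : ℕ, ∀ (n : ℕ) [Fact n.Prime], n0 ≤ n →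
    ∀ D : Finset (ZMod n), α * n ≤ #D →
      c * (n:ℝ) ^ 2 ≤ #((univ : Finset (ZMod n × ZMod n)).filter
        fun q => q.1 ∈ D ∧ q.1 + q.2 ∈ D ∧ q.1 + 2 * q.2 ∈ D) := by
  set L := cornersTheoremBound (α / 2 / 3) + 1 with hL
  have hLpos : (0:ℝ) < L := by positivity
  refine ⟨α / 2 / L ^ 2, by positivity, L + 1, fun n _ hn D hD => ?_⟩
  have hn0 : (0:ℝ) < n := by
    have : 0 < n := by omega
    exact_mod_cast this
  set T := (univ : Finset (ZMod n × ZMod n)).filter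
        fun q => q.1 ∈ D ∧ q.1 + q.2 ∈ D ∧ q.1 + 2 * q.2 ∈ D with hT
  set cnt : ZMod n × ZMod n → ℕ := fun q => #((range L).filter fun i : ℕ => q.1 + q.2 * (i : ZMod n) ∈ D) with hcnt
  set Gd := (univ : Finset (ZMod n × ZMod n)).filter fun q => α / 2 * L ≤ cnt q with hGd
  have hsum : ∑ q : ZMod n × ZMod n, (cnt q : ℝ) = L * n * #D := by
    have : ∀ q, (cnt q : ℝ) = ∑ i ∈ range L, if q.1 + q.2 * (i : ZMod n) ∈ D then (1:ℝ) else 0 := by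
      intro q; rw [hcnt]; simp
    simp_rw [this]
    rw [sum_comm]
    have h2 : ∀ i ∈ range L, ∑ q : ZMod n × ZMod n, (if q.1 + q.2 * (i : ZMod n) ∈ D then (1:ℝ) else 0) = n * #D := by
      intro i _
      rw [Fintype.sum_prod_type_right]
      have : ∀ d : ZMod n, ∑ x : ZMod n, (if x + d * (i : ZMod n) ∈ D then (1:ℝ) else 0) = #D := by
        intro d
        rw [Fintype.sum_equiv (Equiv.addRight (d * (i : ZMod n))) (fun x => if x + d * (i : ZMod n) ∈ D then (1:ℝ) else 0) (fun x => if x ∈ D then (1:ℝ) else 0) (fun x => rfl)]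
        simp
      simp only [this]
      simp [ZMod.card]
    rw [sum_congr rfl h2]
    simp; ring
  have hGdcard : α / 2 * (n:ℝ) ^ 2 ≤ #Gd := by
    have h1 : ∑ q : ZMod n × ZMod n, (cnt q : ℝ) ≤ ∑ q : ZMod n × ZMod n, (α / 2 * L + if q ∈ Gd then (L:ℝ) else 0) := by
      refine sum_le_sum fun q _ => ?_
      split_ifs with h
      · have : cnt q ≤ L := by
          calc cnt q ≤ #(range L) := card_filter_le _ _
            _ = L := card_range L
        have : (cnt q : ℝ) ≤ L := by exact_mod_cast this
        have : 0 ≤ α / 2 * L := by positivity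
        linarith
      · simp only [hGd, mem_filter, mem_univ, true_and, not_le] at h
        linarith
    rw [hsum, sum_add_distrib] at h1
    simp only [sum_const, card_univ, Fintype.card_prod, ZMod.card, nsmul_eq_mul, sum_ite_mem, univ_inter] at h1
    push_cast at h1
    have h2 : (L:ℝ) * n * (α * n) ≤ L * n * #D := by gcongr
    have h3 : (L:ℝ) * (α / 2 * (n:ℝ) ^ 2) ≤ L * #Gd := by nlinarith
    exact le_of_mul_le_mul_left h3 hLpos
  have hcov : Gd ⊆ ((range L) ×ˢ ((range L).filter (· ≠ 0))).biUnion fun ie =>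
      (univ : Finset (ZMod n × ZMod n)).filter fun q => (q.1 + q.2 * (ie.1 : ZMod n), q.2 * (ie.2 : ZMod n)) ∈ T := by
    intro q hq
    simp only [hGd, mem_filter, mem_univ, true_and] at hq
    obtain ⟨i, hi, e, he, he0, h1, h2, h3⟩ := roth_step L (α / 2) (by positivity) (by omega)
      ((range L).filter fun i : ℕ => q.1 + q.2 * (i : ZMod n) ∈ D) (filter_subset _ _) hq
    simp only [mem_filter, mem_range] at h1 h2 h3
    simp only [mem_biUnion, mem_product, mem_filter, mem_range, mem_univ, true_and, hT]
    refine ⟨(i, e), ⟨hi, he, he0⟩, h1.2, ?_, ?_⟩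
    · have := h2.2
      push_cast at this
      convert this using 1; ring
    · have := h3.2
      push_cast at this
      convert this using 1; ring
  have hfib : ∀ ie ∈ (range L) ×ˢ ((range L).filter (· ≠ 0)),
      #((univ : Finset (ZMod n × ZMod n)).filter fun q => (q.1 + q.2 * (ie.1 : ZMod n), q.2 * (ie.2 : ZMod n)) ∈ T) ≤ #T := by
    intro ie hie
    simp only [mem_product, mem_filter, mem_range] at hie
    have he : (ie.2 : ZMod n) ≠ 0 := by
      rw [Ne, ZMod.natCast_eq_zero_iff]
      intro hdvd
      have := Nat.le_of_dvd (Nat.pos_of_ne_zero hie.2.2) hdvd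
      omega
    refine card_le_card_of_injOn (fun q => (q.1 + q.2 * (ie.1 : ZMod n), q.2 * (ie.2 : ZMod n))) ?_ ?_
    · intro q hq
      simpa using hq
    · intro q _ q' _ h
      simp only [Prod.mk.injEq] at h
      have h2 := mul_right_cancel₀ he h.2
      have h1 := h.1
      rw [h2] at h1
      exact Prod.ext (add_right_cancel h1) h2
  have hfin : #Gd ≤ L ^ 2 * #T := by
    calc #Gd ≤ _ := card_le_card hcov
      _ ≤ ∑ ie ∈ (range L) ×ˢ ((range L).filter (· ≠ 0)), _ := card_biUnion_le
      _ ≤ ∑ ie ∈ (range L) ×ˢ ((range L).filter (· ≠ 0)), #T := sum_le_sum hfib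
      _ = #((range L) ×ˢ ((range L).filter (· ≠ 0))) * #T := by simp
      _ ≤ L ^ 2 * #T := by
        gcongr
        rw [card_product, card_range, sq]
        gcongr
        calc _ ≤ #(range L) := card_filter_le _ _
          _ = L := card_range L
  have hfin' : (#Gd : ℝ) ≤ L ^ 2 * #T := by exact_mod_cast hfin
  rw [div_mul_eq_mul_div, div_le_iff₀ (by positivity)]
  linarith

/-- Dyadic decomposition. -/
lemma dyadic {ι : Type*} [DecidableEq ι] (I : Finset ι) (F : ι → ℝ) (hF : ∀ r ∈ I, 0 ≤ F r) (K a : ℝ) (ha : 0 < a) (hK : 0 ≤ K)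
    (j : ℕ) : ∀ b : ℝ, a ≤ b → b ≤ 2 ^ j * a →
    (∀ δ, a ≤ δ → δ ≤ b → (#(I.filter fun r => δ ≤ F r) : ℝ) ≤ K / δ ^ 2) →
    ∑ r ∈ I.filter (fun r => a ≤ F r ∧ F r < b), F r ^ 3 ≤ 8 * K * b := by
  have block : ∀ δ b : ℝ, a ≤ δ → δ ≤ b → b ≤ 2 * δ → (#(I.filter fun r => δ ≤ F r) : ℝ) ≤ K / δ ^ 2 →
      ∑ r ∈ I.filter (fun r => δ ≤ F r ∧ F r < b), F r ^ 3 ≤ 4 * K * b := by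
    intro δ b h1 h2 h3 h4
    have hδ : 0 < δ := by linarith
    calc ∑ r ∈ I.filter (fun r => δ ≤ F r ∧ F r < b), F r ^ 3
        ≤ ∑ r ∈ I.filter (fun r => δ ≤ F r ∧ F r < b), b ^ 3 := by
          refine sum_le_sum fun r hr => ?_
          simp only [mem_filter] at hr
          have := hF r hr.1
          have := hr.2.2.le
          gcongr
      _ = #(I.filter (fun r => δ ≤ F r ∧ F r < b)) * b ^ 3 := by simp
      _ ≤ #(I.filter fun r => δ ≤ F r) * b ^ 3 := by
          have : 0 ≤ b := by linarith
          gcongr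
          exact fun h => h.1
      _ ≤ K / δ ^ 2 * b ^ 3 := by
          have : 0 ≤ b := by linarith
          gcongr
      _ = K * b * (b / δ) ^ 2 := by field_simp
      _ ≤ K * b * 2 ^ 2 := by
          have : 0 ≤ b := by linarith
          gcongr
          rwa [div_le_iff₀ hδ]
      _ = _ := by ring
  induction j with
  | zero =>
    intro b h1 h2 h3
    have := block a b le_rfl h1 (by simp at h2; linarith) (h3 a le_rfl h1)
    have : 0 ≤ K * b := mul_nonneg hK (by linarith)
    linarith
  | succ j ih =>
    intro b h1 h2 h3
    rcases le_total a (b/2) with h | h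
    · have i1 := ih (b/2) h (by rw [pow_succ] at h2; linarith) (fun δ d1 d2 => h3 δ d1 (by linarith))
      have i2 := block (b/2) b h (by linarith) (by linarith) (h3 _ h (by linarith))
      have e : ∑ r ∈ I.filter (fun r => a ≤ F r ∧ F r < b), F r ^ 3 =
          ∑ r ∈ I.filter (fun r => a ≤ F r ∧ F r < b/2), F r ^ 3 + ∑ r ∈ I.filter (fun r => b/2 ≤ F r ∧ F r < b), F r ^ 3 := by
        rw [← sum_union]
        · congr 1
          ext r; simp only [mem_filter, mem_union]
          constructor
          · rintro ⟨x1, x2, x3⟩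
            rcases lt_or_ge (F r) (b/2) with h' | h'
            · left; exact ⟨x1, x2, h'⟩
            · right; exact ⟨x1, h', x3⟩
          · rintro (⟨x1, x2, x3⟩ | ⟨x1, x2, x3⟩)
            · exact ⟨x1, x2, by linarith⟩
            · exact ⟨x1, by linarith, x3⟩
        · rw [disjoint_left]
          intro r; simp only [mem_filter]
          rintro ⟨_, _, x3⟩ ⟨_, x2, _⟩
          linarith
      rw [e]; linarith
    · have := block a b le_rfl h1 (by linarith) (h3 a le_rfl h1)
      have : 0 ≤ K * b := mul_nonneg hK (by linarith)
      linarith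

end PSRoth

namespace PSRoth
open Finset Filter ComplexConjugate

section
variable {n : ℕ} [Fact n.Prime]

noncomputable def ch (x : ZMod n) : ℂ := ZMod.stdAddChar x

lemma ch_add (x y : ZMod n) : ch (x + y) = ch x * ch y := AddChar.map_add_eq_mul _ _ _
lemma ch_zero : ch (0 : ZMod n) = 1 := AddChar.map_zero_eq_one _
lemma ch_neg (x : ZMod n) : ch (-x) = conj (ch x) := AddChar.map_neg_eq_conj _ _
lemma ch_sub (x y : ZMod n) : ch (x - y) = ch x * conj (ch y) := by rw [sub_eq_add_neg, ch_add, ch_neg]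
lemma norm_ch (x : ZMod n) : ‖ch x‖ = 1 := AddChar.norm_apply _ _

lemma ch_val (x : ZMod n) : ch x = ee ((x.val : ℝ) / n) := by
  have h := ZMod.stdAddChar_coe (N := n) (x.val : ℤ)
  unfold ch ee
  have e : (((x.val : ℕ) : ℤ) : ZMod n) = x := by simp
  rw [e] at h
  rw [h]
  congr 1
  push_cast; ring

lemma ch_natCast (j : ℕ) : ch (j : ZMod n) = ee ((j : ℝ) / n) := by
  have h := ZMod.stdAddChar_coe (N := n) (j : ℤ)
  unfold ch ee
  push_cast at h
  rw [h]
  congr 1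
  push_cast; ring

lemma ch_ortho (x : ZMod n) : ∑ r : ZMod n, ch (r * x) = if x = 0 then (n:ℂ) else 0 := by
  have h := AddChar.sum_mulShift (R := ZMod n) x (ZMod.isPrimitive_stdAddChar n)
  rw [ZMod.card] at h
  unfold ch
  rw [h]
  split_ifs <;> simp

noncomputable def ft (f : ZMod n → ℝ) (r : ZMod n) : ℂ := ∑ x, (f x : ℂ) * ch (r * x)

lemma three_form (f g h : ZMod n → ℝ) :
    ∑ r : ZMod n, ft f r * ft g r * ft h (-2 * r) =
      n * ((∑ x : ZMod n, ∑ d : ZMod n, f x * h (x + d) * g (x + 2 * d) : ℝ) : ℂ) := by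
  have e1 : ∀ r : ZMod n, ft f r * ft g r * ft h (-2 * r) =
      ∑ x, ∑ y, ∑ z, (f x * h y * g z : ℂ) * ch (r * (x + z - 2 * y)) := by
    intro r
    unfold ft
    rw [mul_assoc, sum_mul]
    refine sum_congr rfl fun x _ => ?_
    rw [mul_comm (∑ z, (g z : ℂ) * ch (r * z)), sum_mul_sum, mul_sum]
    refine sum_congr rfl fun y _ => ?_
    rw [mul_sum]
    refine sum_congr rfl fun z _ => ?_
    rw [show r * (x + z - 2 * y) = r * x + (r * z + (-2 * r * y)) by ring, ch_add, ch_add]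
    ring
  simp_rw [e1]
  rw [sum_comm, Complex.ofReal_sum, mul_sum]
  refine sum_congr rfl fun x _ => ?_
  rw [sum_comm]
  rw [Fintype.sum_equiv (Equiv.subRight x) _ (fun d => ∑ r : ZMod n, ∑ z, (f x * h (x + d) * g z : ℂ) * ch (r * (x + z - 2 * (x + d)))) (fun y => by simp)]
  rw [Complex.ofReal_sum, mul_sum]
  refine sum_congr rfl fun d _ => ?_
  rw [sum_comm]
  simp_rw [← mul_sum, ch_ortho]
  rw [sum_eq_single (x + 2 * d)]
  · rw [if_pos (by ring)]; push_cast; ring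
  · intro z _ hz
    rw [if_neg, mul_zero]
    intro h0; apply hz; linear_combination h0
  · simp

lemma parseval (f : ZMod n → ℝ) : ∑ r : ZMod n, ‖ft f r‖ ^ 2 = n * ∑ x, f x ^ 2 := by
  have h : ∀ r : ZMod n, ((‖ft f r‖ ^ 2 : ℝ) : ℂ) = ∑ x, ∑ y, (f x * f y : ℂ) * ch (r * (x - y)) := by
    intro r
    rw [Complex.ofReal_pow, ← Complex.mul_conj']
    unfold ft
    rw [map_sum, sum_mul_sum]
    refine sum_congr rfl fun x _ => sum_congr rfl fun y _ => ?_
    rw [map_mul, Complex.conj_ofReal, mul_sub, ch_sub]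
    ring
  have h2 : ((∑ r : ZMod n, ‖ft f r‖ ^ 2 : ℝ) : ℂ) = ((n * ∑ x, f x ^ 2 : ℝ) : ℂ) := by
    rw [Complex.ofReal_sum]
    simp_rw [h]
    rw [sum_comm]
    push_cast
    rw [mul_sum]
    refine sum_congr rfl fun x _ => ?_
    rw [sum_comm]
    simp_rw [← mul_sum, ch_ortho]
    rw [sum_eq_single x]
    · simp; ring
    · intro z _ hz
      rw [if_neg, mul_zero]
      intro h0; apply hz; linear_combination -h0
    · simp
  exact_mod_cast h2

noncomputable def bt (B : Finset (ZMod n)) (r : ZMod n) : ℂ := ∑ y ∈ B, ch (r * y)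

lemma bt_eq (B : Finset (ZMod n)) (r : ZMod n) : bt B r = ft (fun x => if x ∈ B then 1 else 0) r := by
  unfold bt ft
  simp only [apply_ite (Complex.ofReal), Complex.ofReal_one, Complex.ofReal_zero, ite_mul, one_mul, zero_mul, sum_ite_mem, univ_inter]

lemma bt_parseval (B : Finset (ZMod n)) : ∑ r : ZMod n, ‖bt B r‖ ^ 2 = n * #B := by
  simp_rw [bt_eq, parseval]
  simp

lemma pair_eq (K : ZMod n → ℝ) (B : Finset (ZMod n)) (x : ZMod n) :
    ∑ r : ZMod n, ft K r * (ch (-(r * x)) * (bt B r * conj (bt B r))) =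
      n * ((∑ y ∈ B, ∑ z ∈ B, K (x + y - z) : ℝ) : ℂ) := by
  have e1 : ∀ r : ZMod n, ft K r * (ch (-(r * x)) * (bt B r * conj (bt B r))) =
      ∑ y ∈ B, ∑ z ∈ B, ∑ u, (K u : ℂ) * ch (r * (u - (x + y - z))) := by
    intro r
    unfold ft bt
    rw [mul_comm (∑ y ∈ B, ch (r * y)), map_sum, sum_mul_sum, mul_sum, mul_sum]
    refine sum_congr rfl fun y _ => ?_
    rw [mul_sum, mul_sum]
    refine sum_congr rfl fun z _ => ?_
    rw [sum_mul]
    refine sum_congr rfl fun u _ => ?_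
    rw [show r * (u - (x + y - z)) = r * u + (-(r * x) + (-(r * y) + r * z)) by ring, ch_add, ch_add, ch_add, ch_neg (r * y)]
    ring
  simp_rw [e1]
  rw [sum_comm]
  push_cast
  rw [mul_sum]
  refine sum_congr rfl fun y _ => ?_
  rw [sum_comm, mul_sum]
  refine sum_congr rfl fun z _ => ?_
  rw [sum_comm]
  simp_rw [← mul_sum, ch_ortho]
  rw [sum_eq_single (x + y - z)]
  · simp; ring
  · intro u _ hu
    rw [if_neg, mul_zero]
    intro h0; apply hu; linear_combination h0
  · simp

lemma pair_bound (K : ZMod n → ℝ) (B : Finset (ZMod n)) (x : ZMod n) (E : ℝ) (hE : ∀ r, ‖ft K r‖ ≤ E) :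
    |∑ y ∈ B, ∑ z ∈ B, K (x + y - z)| ≤ E * #B := by
  have hn : (0:ℝ) < n := by exact_mod_cast (Fact.out : n.Prime).pos
  have h := congrArg norm (pair_eq K B x)
  rw [norm_mul, Complex.norm_real, Complex.norm_natCast, Real.norm_eq_abs] at h
  have h2 : ‖∑ r : ZMod n, ft K r * (ch (-(r * x)) * (bt B r * conj (bt B r)))‖ ≤ E * (n * #B) := by
    rw [← bt_parseval, mul_sum]
    refine norm_sum_le_of_le _ fun r _ => ?_
    rw [norm_mul, norm_mul, norm_mul, norm_ch, RCLike.norm_conj, one_mul, ← sq]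
    gcongr
    exact hE r
  rw [h] at h2
  have : (n:ℝ) * |∑ y ∈ B, ∑ z ∈ B, K (x + y - z)| ≤ n * (E * #B) := by linarith
  exact le_of_mul_le_mul_left this hn

noncomputable def smooth (f : ZMod n → ℝ) (B : Finset (ZMod n)) (x : ZMod n) : ℝ :=
  (∑ y ∈ B, ∑ z ∈ B, f (x + y - z)) / (#B : ℝ) ^ 2

lemma ft_smooth (f : ZMod n → ℝ) (B : Finset (ZMod n)) (r : ZMod n) :
    ft (smooth f B) r = ft f r * ((‖bt B r‖ ^ 2 / (#B : ℝ) ^ 2 : ℝ) : ℂ) := by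
  have e : ∀ y z : ZMod n, ∑ x, (f (x + y - z) : ℂ) * ch (r * x) = ft f r * (conj (ch (r * y)) * ch (r * z)) := by
    intro y z
    rw [Fintype.sum_equiv (Equiv.addRight (y - z)) _ (fun u => (f u : ℂ) * ch (r * (u - (y - z))))
      (fun x => by simp [add_sub_assoc])]
    unfold ft
    rw [sum_mul]
    refine sum_congr rfl fun u _ => ?_
    rw [show r * (u - (y - z)) = r * u + (-(r * y) + r * z) by ring, ch_add, ch_add, ch_neg]
    ring
  have e2 : ft (smooth f B) r = (∑ y ∈ B, ∑ z ∈ B, ∑ x, (f (x + y - z) : ℂ) * ch (r * x)) / (#B : ℂ) ^ 2 := by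
    unfold ft smooth
    push_cast
    rw [sum_div]
    have : ∀ x : ZMod n, (∑ y ∈ B, ∑ z ∈ B, (f (x + y - z) : ℂ)) / (#B : ℂ) ^ 2 * ch (r * x) =
        (∑ y ∈ B, ∑ z ∈ B, (f (x + y - z) : ℂ) * ch (r * x)) / (#B : ℂ) ^ 2 := by
      intro x
      rw [div_mul_eq_mul_div, sum_mul]
      simp_rw [sum_mul]
    simp_rw [this]
    rw [← sum_div, sum_comm, ← sum_div]
    congr 1
    refine sum_congr rfl fun y _ => ?_
    rw [sum_comm]
  rw [e2]
  simp_rw [e, ← mul_sum]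
  push_cast
  rw [mul_div_assoc, ← Complex.mul_conj']
  congr 2
  unfold bt
  rw [map_sum, sum_mul_sum, sum_comm]
  refine sum_congr rfl fun y _ => ?_
  rw [mul_sum]
  refine sum_congr rfl fun z _ => ?_
  ring

lemma smooth_sum (f : ZMod n → ℝ) (B : Finset (ZMod n)) (hB : B.Nonempty) : ∑ x, smooth f B x = ∑ x, f x := by
  have h := ft_smooth f B 0
  have hc : (#B : ℝ) ≠ 0 := by
    have := hB.card_pos
    positivity
  have : bt B 0 = #B := by unfold bt; simp [ch_zero]
  rw [this, Complex.norm_natCast, div_self (by positivity)] at h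
  unfold ft at h
  simp only [zero_mul, ch_zero, mul_one, Complex.ofReal_one] at h
  exact_mod_cast h

lemma smooth_nonneg (f : ZMod n → ℝ) (B : Finset (ZMod n)) (hf : ∀ x, 0 ≤ f x) (x : ZMod n) : 0 ≤ smooth f B x := by
  unfold smooth
  exact div_nonneg (sum_nonneg fun y _ => sum_nonneg fun z _ => hf _) (by positivity)

lemma smooth_le (f ν : ZMod n → ℝ) (B : Finset (ZMod n)) (hB : B.Nonempty) (hf : ∀ x, f x ≤ ν x) (η : ℝ)
    (hν : ∀ r, ‖ft (fun x => ν x - 1) r‖ ≤ η * n) (hη : η * n ≤ #B) (x : ZMod n) : smooth f B x ≤ 2 := by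
  have hc : (0:ℝ) < #B := by
    have := hB.card_pos
    positivity
  unfold smooth
  rw [div_le_iff₀ (by positivity)]
  have h := (abs_le.1 (pair_bound (fun x => ν x - 1) B x (η * n) hν)).2
  simp only [sum_sub_distrib, sum_const, nsmul_eq_mul, mul_one] at h
  have h2 : ∑ y ∈ B, ∑ z ∈ B, f (x + y - z) ≤ ∑ y ∈ B, ∑ z ∈ B, ν (x + y - z) :=
    sum_le_sum fun y _ => sum_le_sum fun z _ => hf _
  have h3 : η * n * #B ≤ #B * #B := by gcongr
  nlinarith

end

end PSRoth

namespace PSRoth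
open Finset Filter ComplexConjugate

section
variable {n : ℕ} [Fact n.Prime]

noncomputable def bohr (R : Finset (ZMod n)) (k : ℕ) : Finset (ZMod n) :=
  univ.filter fun x => ∀ r ∈ R, ‖ch (r * x) - 1‖ ≤ 2 * Real.pi / k

lemma bohr_card (R : Finset (ZMod n)) (k : ℕ) (hk : 1 ≤ k) : n ≤ #(bohr R k) * k ^ #R := by
  have hn : 0 < n := (Fact.out : n.Prime).pos
  have hn' : (0:ℝ) < n := by exact_mod_cast hn
  have hk' : (0:ℝ) < k := by positivity
  set φ : ZMod n → (R → Fin k) := fun x r => ⟨k * (r.1 * x).val / n, by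
    rw [Nat.div_lt_iff_lt_mul hn]
    exact Nat.mul_lt_mul_of_pos_left (ZMod.val_lt _) (by omega)⟩ with hφ
  have h := card_le_mul_card_image_of_maps_to (s := (univ : Finset (ZMod n))) (t := (univ : Finset (R → Fin k)))
    (f := φ) (fun _ _ => mem_univ _) #(bohr R k) (by
      intro b _
      rcases ((univ : Finset (ZMod n)).filter fun x => φ x = b).eq_empty_or_nonempty with he | ⟨x0, hx0⟩
      · rw [he]; simp
      · refine card_le_card_of_injOn (fun x => x - x0) ?_ (fun x _ y _ h => sub_left_injective h)
        intro x hx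
        simp only [coe_filter, mem_univ, true_and, Set.mem_ofPred_eq, mem_filter] at hx hx0
        simp only [bohr, coe_filter, mem_univ, true_and, Set.mem_ofPred_eq]
        intro r hr
        have h1 : k * (r * x).val / n = k * (r * x0).val / n := by
          have := congrFun (hx.trans hx0.symm) ⟨r, hr⟩
          simpa [hφ] using this
        set A := (r * x).val
        set A0 := (r * x0).val
        have e1 : ch (r * (x - x0)) - 1 = ch (r * x0) * 0 + (ee ((A:ℝ) / n - (A0:ℝ) / n) - 1) := by
          rw [mul_sub, ch_sub, ch_val, ch_val, ee_sub]; ring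
        rw [e1, mul_zero, zero_add]
        refine (norm_ee_sub_one_le _).trans ?_
        rw [show 2 * Real.pi / (k:ℝ) = 2 * Real.pi * (1 / k) by ring]
        refine mul_le_mul_of_nonneg_left (?_ : _ ≤ (1:ℝ) / k) Real.two_pi_pos.le
        have a1 : ((k * A : ℕ):ℝ) < n * ((k * A / n : ℕ):ℝ) + n := by
          have := Nat.lt_mul_div_succ (k * A) hn
          have : k * A < n * (k * A / n) + n := by linarith
          exact_mod_cast this
        have a2 : (n * (k * A / n : ℕ):ℝ) ≤ (k * A : ℕ) := by
          exact_mod_cast Nat.mul_div_le _ _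
        have a3 : ((k * A0 : ℕ):ℝ) < n * ((k * A0 / n : ℕ):ℝ) + n := by
          have := Nat.lt_mul_div_succ (k * A0) hn
          have : k * A0 < n * (k * A0 / n) + n := by linarith
          exact_mod_cast this
        have a4 : (n * (k * A0 / n : ℕ):ℝ) ≤ (k * A0 : ℕ) := by
          exact_mod_cast Nat.mul_div_le _ _
        rw [h1] at a1 a2
        push_cast at a1 a2 a3 a4
        rw [← sub_div, abs_div, abs_of_pos hn', div_le_div_iff₀ hn' hk', one_mul]
        rcases abs_cases ((A:ℝ) - A0) with ⟨h, _⟩ | ⟨h, _⟩ <;> rw [h] <;> nlinarith)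
  simpa [ZMod.card] using h

lemma ft_one (r : ZMod n) : ft (fun _ => 1) r = if r = 0 then (n:ℂ) else 0 := by
  unfold ft
  rw [← ch_ortho]
  refine sum_congr rfl fun x _ => ?_
  rw [mul_comm r x]; simp

lemma restriction (f ν : ZMod n → ℝ) (L η δ : ℝ) (hf : ∀ x, 0 ≤ f x) (hfν : ∀ x, f x ≤ L * ν x)
    (hL : 0 ≤ L) (hν : ∀ r, ‖ft (fun x => ν x - 1) r‖ ≤ η * n) (hfs : ∑ x, f x ≤ 2 * n) (hδ : 0 < δ)
    (hδη : 4 * L * η ≤ δ ^ 2) :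
    (#((univ : Finset (ZMod n)).filter fun r => δ ≤ ‖ft f r‖ / n) : ℝ) ≤ 4 * L / δ ^ 2 := by
  have hn' : (0:ℝ) < n := by exact_mod_cast (Fact.out : n.Prime).pos
  set R := (univ : Finset (ZMod n)).filter fun r => δ ≤ ‖ft f r‖ / n with hR
  set m : ℝ := ((#R : ℕ) : ℝ) with hm
  have hm0 : 0 ≤ m := by positivity
  have hRm : ∀ r ∈ R, δ * n ≤ ‖ft f r‖ := by
    intro r hr
    simp only [hR, mem_filter, mem_univ, true_and] at hr
    rwa [le_div_iff₀ hn'] at hr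
  set c : ZMod n → ℂ := fun r => conj (ft f r) / ‖ft f r‖ with hc
  have hc1 : ∀ r ∈ R, ‖c r‖ = 1 := by
    intro r hr
    have : 0 < ‖ft f r‖ := lt_of_lt_of_le (by positivity) (hRm r hr)
    simp [hc, this.ne']
  have hc2 : ∀ r ∈ R, c r * ft f r = (‖ft f r‖ : ℂ) := by
    intro r hr
    have : 0 < ‖ft f r‖ := lt_of_lt_of_le (by positivity) (hRm r hr)
    have h2 : (‖ft f r‖ : ℂ) ≠ 0 := by exact_mod_cast this.ne'
    simp only [hc]
    rw [div_mul_eq_mul_div, mul_comm, Complex.mul_conj', sq, mul_div_assoc, div_self h2, mul_one]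
  set g : ZMod n → ℂ := fun x => ∑ r ∈ R, c r * ch (r * x) with hg
  have h1 : ∑ x, (f x : ℂ) * g x = ((∑ r ∈ R, ‖ft f r‖ : ℝ) : ℂ) := by
    push_cast
    simp_rw [hg, mul_sum]
    rw [sum_comm]
    refine sum_congr rfl fun r hr => ?_
    rw [← hc2 r hr]
    unfold ft
    rw [mul_sum]
    refine sum_congr rfl fun x _ => ?_
    ring
  have h2 : δ * n * m ≤ ∑ x, f x * ‖g x‖ := by
    calc δ * n * m = ∑ r ∈ R, δ * n := by rw [sum_const, nsmul_eq_mul]; ring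
      _ ≤ ∑ r ∈ R, ‖ft f r‖ := sum_le_sum hRm
      _ = ‖∑ x, (f x : ℂ) * g x‖ := by
        rw [h1, Complex.norm_real, Real.norm_eq_abs, abs_of_nonneg (sum_nonneg fun r _ => norm_nonneg _)]
      _ ≤ _ := by
        refine norm_sum_le_of_le _ fun x _ => ?_
        rw [norm_mul, Complex.norm_real, Real.norm_eq_abs, abs_of_nonneg (hf x)]
  have h3 : (∑ x, f x * ‖g x‖) ^ 2 ≤ (∑ x, f x) * ∑ x, f x * ‖g x‖ ^ 2 :=
    sum_sq_le_sum_mul_sum_of_sq_eq_mul _ (fun x _ => hf x) (fun x _ => mul_nonneg (hf x) (by positivity))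
      (fun x _ => by ring)
  have h4 : ∑ x, ν x * ‖g x‖ ^ 2 ≤ n * m + η * n * m ^ 2 := by
    have e : ((∑ x, ν x * ‖g x‖ ^ 2 : ℝ) : ℂ) = ∑ r ∈ R, ∑ s ∈ R, c r * conj (c s) * ft ν (r - s) := by
      push_cast
      have : ∀ x, (ν x : ℂ) * (‖g x‖ : ℂ) ^ 2 = ∑ r ∈ R, ∑ s ∈ R, c r * conj (c s) * (ν x * ch ((r - s) * x)) := by
        intro x
        rw [← Complex.mul_conj', hg, map_sum, sum_mul_sum, mul_sum]
        refine sum_congr rfl fun r _ => ?_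
        rw [mul_sum]
        refine sum_congr rfl fun s _ => ?_
        rw [sub_mul, ch_sub, map_mul]; ring
      simp_rw [this]
      rw [sum_comm]
      refine sum_congr rfl fun r _ => ?_
      rw [sum_comm]
      refine sum_congr rfl fun s _ => ?_
      unfold ft
      rw [mul_sum]
    have hb : ∀ t, ‖ft ν t‖ ≤ (if t = 0 then (n:ℝ) else 0) + η * n := by
      intro t
      have : ft ν t = ft (fun _ => 1) t + ft (fun x => ν x - 1) t := by
        unfold ft; rw [← sum_add_distrib]
        refine sum_congr rfl fun x _ => ?_
        push_cast; ring
      rw [this]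
      refine (norm_add_le _ _).trans (add_le_add ?_ (hν t))
      rw [ft_one]
      split_ifs <;> simp
    calc ∑ x, ν x * ‖g x‖ ^ 2 ≤ ‖((∑ x, ν x * ‖g x‖ ^ 2 : ℝ) : ℂ)‖ := by
          rw [Complex.norm_real]; exact Real.le_norm_self _
      _ ≤ ∑ r ∈ R, ∑ s ∈ R, ((if r = s then (n:ℝ) else 0) + η * n) := by
          rw [e]
          refine norm_sum_le_of_le _ fun r hr => norm_sum_le_of_le _ fun s hs => ?_
          rw [norm_mul, norm_mul, RCLike.norm_conj, hc1 r hr, hc1 s hs, one_mul, one_mul]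
          simpa [sub_eq_zero] using hb (r - s)
      _ = ∑ r ∈ R, ((n:ℝ) + m * (η * n)) := by
          refine sum_congr rfl fun r hr => ?_
          rw [sum_add_distrib, sum_ite_eq, if_pos hr, sum_const, nsmul_eq_mul]
      _ = _ := by rw [sum_const, nsmul_eq_mul]; ring
  have h5 : ∑ x, f x * ‖g x‖ ^ 2 ≤ L * (n * m + η * n * m ^ 2) := by
    calc ∑ x, f x * ‖g x‖ ^ 2 ≤ ∑ x, L * (ν x * ‖g x‖ ^ 2) := by
          refine sum_le_sum fun x _ => ?_
          rw [← mul_assoc]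
          gcongr
          exact hfν x
      _ = L * ∑ x, ν x * ‖g x‖ ^ 2 := by rw [mul_sum]
      _ ≤ _ := by gcongr
  have h6 : (δ * n * m) ^ 2 ≤ 2 * n * (L * (n * m + η * n * m ^ 2)) := by
    calc (δ * n * m) ^ 2 ≤ (∑ x, f x * ‖g x‖) ^ 2 := by gcongr
      _ ≤ _ := h3
      _ ≤ _ := by
        have : 0 ≤ ∑ x, f x * ‖g x‖ ^ 2 := sum_nonneg fun x _ => mul_nonneg (hf x) (by positivity)
        exact mul_le_mul hfs h5 this (by positivity)
  rw [le_div_iff₀ (by positivity)]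
  rcases hm0.eq_or_lt with h | h
  · rw [← h]; simp; positivity
  · have h7 : n ^ 2 * m * (δ ^ 2 * m) ≤ n ^ 2 * m * (2 * L + 2 * L * η * m) := by nlinarith
    have h8 : δ ^ 2 * m ≤ 2 * L + 2 * L * η * m := le_of_mul_le_mul_left h7 (by positivity)
    have h9 : 4 * L * η * m ≤ δ ^ 2 * m := by gcongr
    nlinarith

end

end PSRoth

namespace PSRoth
open Finset Filter ComplexConjugate

section
variable {n : ℕ} [Fact n.Prime]

lemma bt_ge (R : Finset (ZMod n)) (k : ℕ) (r : ZMod n) (τ : ℝ) (B : Finset (ZMod n))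
    (h : ∀ x ∈ B, ‖ch (r * x) - 1‖ ≤ τ) : (1 - τ) * #B ≤ ‖bt B r‖ := by
  have e : bt B r = (#B : ℂ) + ∑ x ∈ B, (ch (r * x) - 1) := by
    unfold bt; simp
  have h1 : ‖∑ x ∈ B, (ch (r * x) - 1)‖ ≤ τ * #B := by
    calc _ ≤ ∑ x ∈ B, τ := norm_sum_le_of_le _ h
      _ = _ := by rw [sum_const, nsmul_eq_mul, mul_comm]
  have h2 := norm_sub_le_norm_add (#B : ℂ) (∑ x ∈ B, (ch (r * x) - 1))
  rw [Complex.norm_natCast] at h2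
  rw [e]
  linarith

lemma bt_le (r : ZMod n) (B : Finset (ZMod n)) : ‖bt B r‖ ≤ #B := by
  unfold bt
  calc _ ≤ ∑ x ∈ B, (1:ℝ) := norm_sum_le_of_le _ fun x _ => (norm_ch _).le
    _ = _ := by simp

noncomputable def tf (f : ZMod n → ℝ) : ℝ := ∑ x : ZMod n, ∑ d : ZMod n, f x * f (x + d) * f (x + 2 * d)

noncomputable def FF (f : ZMod n → ℝ) (r : ZMod n) : ℝ := ‖ft f r‖ / n

lemma tf_diff (f : ZMod n → ℝ) (B : Finset (ZMod n)) (b : ZMod n → ℝ)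
    (hb : ∀ r, b r = ‖bt B r‖ ^ 2 / (#B : ℝ) ^ 2) :
    |tf f - tf (smooth f B)| ≤ (n:ℝ) ^ 2 * ∑ r, FF f r ^ 2 * FF f (-2 * r) * |1 - b r ^ 2 * b (-2 * r)| := by
  have hn' : (0:ℝ) < n := by exact_mod_cast (Fact.out : n.Prime).pos
  have h1 := three_form f f f
  have h2 := three_form (smooth f B) (smooth f B) (smooth f B)
  have e : (n:ℂ) * ((tf f - tf (smooth f B) : ℝ) : ℂ) =
      ∑ r, ft f r * ft f r * ft f (-2 * r) * ((1 - b r ^ 2 * b (-2 * r) : ℝ) : ℂ) := by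
    unfold tf
    rw [Complex.ofReal_sub, mul_sub, ← h1, ← h2, ← sum_sub_distrib]
    refine sum_congr rfl fun r _ => ?_
    rw [ft_smooth, ft_smooth, ← hb, ← hb]
    push_cast; ring
  have h3 := congrArg norm e
  rw [norm_mul, Complex.norm_natCast, Complex.norm_real, Real.norm_eq_abs] at h3
  have h4 : ‖∑ r, ft f r * ft f r * ft f (-2 * r) * ((1 - b r ^ 2 * b (-2 * r) : ℝ) : ℂ)‖ ≤
      (n:ℝ) ^ 3 * ∑ r, FF f r ^ 2 * FF f (-2 * r) * |1 - b r ^ 2 * b (-2 * r)| := by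
    rw [mul_sum]
    refine norm_sum_le_of_le _ fun r _ => ?_
    rw [norm_mul, norm_mul, norm_mul, Complex.norm_real, Real.norm_eq_abs]
    unfold FF
    refine le_of_eq ?_
    field_simp
  rw [← h3] at h4
  have : (n:ℝ) * |tf f - tf (smooth f B)| ≤ n * ((n:ℝ) ^ 2 * ∑ r, FF f r ^ 2 * FF f (-2 * r) * |1 - b r ^ 2 * b (-2 * r)|) := by
    calc _ ≤ _ := h4
      _ = _ := by ring
  exact le_of_mul_le_mul_left this hn'

lemma FF_nonneg (f : ZMod n → ℝ) (r : ZMod n) : 0 ≤ FF f r := by unfold FF; positivity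

lemma FF_le (f : ZMod n → ℝ) (hf : ∀ x, 0 ≤ f x) (hfs : ∑ x, f x ≤ 2 * n) (r : ZMod n) : FF f r ≤ 2 := by
  have hn' : (0:ℝ) < n := by exact_mod_cast (Fact.out : n.Prime).pos
  unfold FF
  rw [div_le_iff₀ hn']
  refine le_trans ?_ hfs
  unfold ft
  refine norm_sum_le_of_le _ fun x _ => ?_
  rw [norm_mul, norm_ch, mul_one, Complex.norm_real, Real.norm_eq_abs, abs_of_nonneg (hf x)]

/-- Splitting of the error sum. -/
lemma err_split (hn : 3 ≤ n) (F w : ZMod n → ℝ) (K e τ : ℝ) (hF : ∀ r, 0 ≤ F r) (hF2 : ∀ r, F r ≤ 2)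
    (hw0 : ∀ r, 0 ≤ w r) (hw1 : ∀ r, w r ≤ 1) (hwR : ∀ r, e ^ 2 ≤ F r → w r ≤ 8 * τ)
    (he : 0 < e) (he1 : e ≤ 1) (hK : 0 ≤ K) (hτ : 0 ≤ τ)
    (hc1 : (#(univ.filter fun r => e ≤ F r) : ℝ) ≤ K / e ^ 2)
    (hc2 : (#(univ.filter fun r => e ^ 2 ≤ F r) : ℝ) ≤ K / (e ^ 2) ^ 2)
    (hs1 : ∑ r ∈ univ.filter (fun r => F r < e), F r ^ 3 ≤ K * e)
    (hs2 : ∑ r ∈ univ.filter (fun r => F r < e ^ 2), F r ^ 3 ≤ K * e ^ 2) :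
    ∑ r, F r ^ 2 * F (-2 * r) * w r ≤ 64 * τ * (K / e ^ 4) + 4 * K * e := by
  have h2 : (-2 : ZMod n) ≠ 0 := by
    rw [neg_ne_zero]
    have : ((2:ℕ) : ZMod n) ≠ 0 := by
      rw [Ne, ZMod.natCast_eq_zero_iff]
      intro h
      have := Nat.le_of_dvd (by norm_num) h
      omega
    simpa using this
  have hinj : Function.Bijective (fun r : ZMod n => -2 * r) := mulLeft_bijective₀ _ h2
  set σ : ZMod n ≃ ZMod n := Equiv.ofBijective _ hinj with hσ
  have hpt : ∀ r, F r ^ 2 * F (-2 * r) * w r ≤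
      (if e ^ 2 ≤ F r then 64 * τ else 0) + (if e ≤ F (σ r) then 2 * e ^ 4 else 0) +
      (if F r < e ^ 2 then F r ^ 3 else 0) + (if F (σ r) < e then F (σ r) ^ 3 else 0) := by
    intro r
    have eσ : σ r = -2 * r := rfl
    rw [eσ]
    have a0 := hF r
    have a1 := hF (-2 * r)
    have a2 := hF2 r
    have a3 := hF2 (-2 * r)
    have a4 := hw0 r
    have a5 := hw1 r
    have p1 : 0 ≤ (if F r < e ^ 2 then F r ^ 3 else 0) := by split_ifs <;> positivity
    have p2 : 0 ≤ (if F (-2 * r) < e then F (-2 * r) ^ 3 else 0) := by split_ifs <;> positivity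
    have p3 : 0 ≤ (if e ≤ F (-2 * r) then 2 * e ^ 4 else 0) := by split_ifs <;> positivity
    by_cases c1 : e ^ 2 ≤ F r
    · rw [if_pos c1]
      have : F r ^ 2 * F (-2 * r) * w r ≤ 2 ^ 2 * 2 * (8 * τ) := by
        have := hwR r c1
        gcongr
      linarith
    · rw [if_neg c1]
      push Not at c1
      have q : F r ^ 2 * F (-2 * r) * w r ≤ F r ^ 2 * F (-2 * r) * 1 := by gcongr
      by_cases c2 : e ≤ F (-2 * r)
      · rw [if_pos c2]
        have : F r ^ 2 * F (-2 * r) ≤ (e ^ 2) ^ 2 * 2 := by gcongr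
        nlinarith
      · rw [if_neg c2]
        push Not at c2
        rw [if_pos c1, if_pos c2]
        have : F r ^ 2 * F (-2 * r) ≤ F r ^ 3 + F (-2 * r) ^ 3 := by
          rcases le_total (F r) (F (-2 * r)) with h | h
          · have : F r ^ 2 * F (-2 * r) ≤ F (-2 * r) ^ 2 * F (-2 * r) := by gcongr
            nlinarith [pow_nonneg a0 3]
          · have : F r ^ 2 * F (-2 * r) ≤ F r ^ 2 * F r := by gcongr
            nlinarith [pow_nonneg a1 3]
        linarith
  have t1 : ∑ r, (if e ^ 2 ≤ F r then 64 * τ else 0) ≤ 64 * τ * (K / e ^ 4) := by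
    rw [← sum_filter, sum_const, nsmul_eq_mul, mul_comm]
    have : (e ^ 2) ^ 2 = e ^ 4 := by ring
    rw [this] at hc2
    gcongr
  have t2 : ∑ r, (if e ≤ F (σ r) then 2 * e ^ 4 else 0) ≤ 2 * K * e := by
    rw [Equiv.sum_comp σ (fun r => if e ≤ F r then 2 * e ^ 4 else 0)]
    rw [← sum_filter, sum_const, nsmul_eq_mul]
    calc _ ≤ K / e ^ 2 * (2 * e ^ 4) := by gcongr
      _ = 2 * K * (e * e) := by field_simp
      _ ≤ 2 * K * (e * 1) := by gcongr
      _ = _ := by ring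
  have t3 : ∑ r, (if F r < e ^ 2 then F r ^ 3 else 0) ≤ K * e := by
    rw [← sum_filter]
    refine hs2.trans ?_
    gcongr
    nlinarith
  have t4 : ∑ r, (if F (σ r) < e then F (σ r) ^ 3 else 0) ≤ K * e := by
    rw [Equiv.sum_comp σ (fun r => if F r < e then F r ^ 3 else 0), ← sum_filter]
    exact hs1
  calc _ ≤ _ := sum_le_sum fun r _ => hpt r
    _ ≤ _ := by
      rw [sum_add_distrib, sum_add_distrib, sum_add_distrib]
      linarith

end

set_option maxHeartbeats 1000000 in
theorem transference (α K : ℝ) (hα : 0 < α) (hK : 0 < K) :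
    ∃ c > 0, ∃ δ0 > 0, ∃ η0 > 0, ∃ n0 : ℕ, ∀ (n : ℕ) [Fact n.Prime], n0 ≤ n → ∀ f ν : ZMod n → ℝ,
      (∀ x, 0 ≤ f x) → (∀ x, f x ≤ ν x) → α * n ≤ ∑ x, f x →
      (∀ r, ‖ft (fun x => ν x - 1) r‖ ≤ η0 * n) →
      (∀ δ, δ0 ≤ δ → δ ≤ 1 → (#(univ.filter fun r => δ ≤ FF f r) : ℝ) ≤ K / δ ^ 2 ∧
        ∑ r ∈ univ.filter (fun r => FF f r < δ), FF f r ^ 3 ≤ K * δ) →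
      c * (n:ℝ) ^ 2 ≤ tf f := by
  obtain ⟨c1, hc1, n1, hV⟩ := varnavides (α / 4) (by positivity)
  set t := (α / 2) ^ 3 * c1 / 4 with ht
  have htpos : 0 < t := by positivity
  set e := min 1 (t / (4 * K)) with he
  have hepos : 0 < e := by positivity
  have he1 : e ≤ 1 := min_le_left _ _
  have heK : 4 * K * e ≤ t := by
    calc 4 * K * e ≤ 4 * K * (t / (4 * K)) := by gcongr; exact min_le_right _ _
      _ = t := by field_simp
  set τ := min (1/2) (t * e ^ 4 / (64 * K)) with hτ
  have hτpos : 0 < τ := by positivity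
  have hτ1 : τ ≤ 1/2 := min_le_left _ _
  have hτK : 64 * τ * (K / e ^ 4) ≤ t := by
    calc 64 * τ * (K / e ^ 4) ≤ 64 * (t * e ^ 4 / (64 * K)) * (K / e ^ 4) := by gcongr; exact min_le_right _ _
      _ = t := by field_simp
  set k := ⌈2 * Real.pi / τ⌉₊ with hk
  have hk2 : 2 * Real.pi / τ ≤ k := Nat.le_ceil _
  have hkpos : (0:ℝ) < k := lt_of_lt_of_le (by positivity) hk2
  have hk1 : 1 ≤ k := by exact_mod_cast hkpos
  have hkτ : 2 * Real.pi / k ≤ τ := by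
    rw [div_le_iff₀ hτpos] at hk2
    rw [div_le_iff₀ hkpos]; linarith
  set m := ⌊K / e ^ 4⌋₊ with hm
  refine ⟨2 * t, by positivity, e ^ 2, by positivity, 1 / (k:ℝ) ^ m, by positivity, max n1 3,
    fun n _ hn f ν hf hfν hfα hν hFF => ?_⟩
  have hn1 : n1 ≤ n := le_of_max_le_left hn
  have hn3 : 3 ≤ n := le_of_max_le_right hn
  have hn' : (0:ℝ) < n := by exact_mod_cast (Fact.out : n.Prime).pos
  obtain ⟨f1, f2⟩ := hFF e (by nlinarith) he1
  obtain ⟨f3, f4⟩ := hFF (e ^ 2) le_rfl (by nlinarith)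
  set R := univ.filter fun r => e ^ 2 ≤ FF f r with hR
  have hRm : #R ≤ m := by
    rw [hm]; apply Nat.le_floor
    calc (#R : ℝ) ≤ _ := f3
      _ = _ := by ring
  set B := bohr R k with hB
  have hBc : (n:ℝ) ≤ #B * (k:ℝ) ^ m := by
    have h1 := bohr_card R k hk1
    have h2 : n ≤ #B * k ^ m := h1.trans (by gcongr)
    exact_mod_cast h2
  have hηB : 1 / (k:ℝ) ^ m * n ≤ #B := by
    rw [one_div, inv_mul_le_iff₀ (by positivity)]; linarith
  have hBpos : (0:ℝ) < #B := lt_of_lt_of_le (by positivity) hηB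
  have hBne : B.Nonempty := by
    rw [← card_pos]; exact_mod_cast hBpos
  have hkm : 1 / (k:ℝ) ^ m ≤ 1 := by
    rw [div_le_one (by positivity)]
    exact one_le_pow₀ (by exact_mod_cast hk1)
  have hfs : ∑ x, f x ≤ 2 * n := by
    have h1 := hν 0
    unfold ft at h1
    simp only [zero_mul, ch_zero, mul_one] at h1
    rw [← Complex.ofReal_sum, Complex.norm_real] at h1
    have h2 := (Real.le_norm_self _).trans h1
    simp only [sum_sub_distrib, sum_const, card_univ, ZMod.card, nsmul_eq_mul, mul_one] at h2
    have h3 : ∑ x, f x ≤ ∑ x, ν x := sum_le_sum fun x _ => hfν x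
    have h4 : 1 / (k:ℝ) ^ m * n ≤ 1 * n := by gcongr
    linarith
  set g := smooth f B with hg
  have hg2 : ∀ x, g x ≤ 2 := smooth_le f ν B hBne hfν _ hν hηB
  have hg0 : ∀ x, 0 ≤ g x := smooth_nonneg f B hf
  have hgs : α * n ≤ ∑ x, g x := by rw [hg, smooth_sum f B hBne]; exact hfα
  set D := univ.filter fun x => α / 2 ≤ g x with hD
  have hDc : α / 4 * n ≤ #D := by
    have h1 : ∑ x, g x ≤ ∑ x, (α / 2 + if x ∈ D then 2 else 0) := by
      refine sum_le_sum fun x _ => ?_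
      split_ifs with h
      · linarith [hg2 x]
      · simp only [hD, mem_filter, mem_univ, true_and, not_le] at h
        linarith
    rw [sum_add_distrib] at h1
    simp only [sum_const, card_univ, ZMod.card, nsmul_eq_mul, sum_ite_mem, univ_inter] at h1
    linarith
  have hT := hV n hn1 D hDc
  have htg : 4 * t * (n:ℝ) ^ 2 ≤ tf g := by
    have h1 : (α / 2) ^ 3 * (#((univ : Finset (ZMod n × ZMod n)).filter
        fun q => q.1 ∈ D ∧ q.1 + q.2 ∈ D ∧ q.1 + 2 * q.2 ∈ D) : ℝ) ≤ tf g := by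
      unfold tf
      rw [← Fintype.sum_prod_type' (f := fun x d => g x * g (x + d) * g (x + 2 * d)), mul_comm, ← nsmul_eq_mul, ← sum_const, sum_filter]
      refine sum_le_sum fun q _ => ?_
      have p1 := hg0 q.1
      have p2 := hg0 (q.1 + q.2)
      have p3 := hg0 (q.1 + 2 * q.2)
      split_ifs with h
      · simp only [hD, mem_filter, mem_univ, true_and] at h
        calc (α / 2) ^ 3 = α / 2 * (α / 2) * (α / 2) := by ring
          _ ≤ _ := by
            gcongr
            exacts [h.1, h.2.1, h.2.2]
      · positivity
    calc 4 * t * (n:ℝ) ^ 2 = (α / 2) ^ 3 * (c1 * (n:ℝ) ^ 2) := by rw [ht]; ring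
      _ ≤ _ := by gcongr
      _ ≤ _ := h1
  set b : ZMod n → ℝ := fun r => ‖bt B r‖ ^ 2 / (#B : ℝ) ^ 2 with hb
  have hb0 : ∀ r, 0 ≤ b r := fun r => by positivity
  have hb1 : ∀ r, b r ≤ 1 := by
    intro r
    rw [hb]
    simp only
    rw [div_le_one (by positivity)]
    gcongr
    exact bt_le r B
  have hblow : ∀ r s, 0 ≤ s → s ≤ 1 → (∀ x ∈ B, ‖ch (r * x) - 1‖ ≤ s) → 1 - 2 * s ≤ b r := by
    intro r s hs hs' h
    have h1 := bt_ge R k r s B h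
    rw [hb]
    simp only
    rw [le_div_iff₀ (by positivity)]
    calc (1 - 2 * s) * (#B : ℝ) ^ 2 ≤ ((1 - s) * #B) ^ 2 := by nlinarith [sq_nonneg (s * #B)]
      _ ≤ _ := by
        have : 0 ≤ (1 - s) * #B := mul_nonneg (by linarith) (by positivity)
        gcongr
  have hdiff := tf_diff f B b (fun r => rfl)
  have herr := err_split hn3 (FF f) (fun r => |1 - b r ^ 2 * b (-2 * r)|) K e τ (FF_nonneg f) (FF_le f hf hfs)
    (fun r => abs_nonneg _) (by
      intro r
      have q1 := hb0 r
      have q2 := hb1 r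
      have q3 := hb0 (-2 * r)
      have q4 := hb1 (-2 * r)
      have q5 : b r ^ 2 * b (-2 * r) ≤ 1 ^ 2 * 1 := by gcongr
      have q6 : 0 ≤ b r ^ 2 * b (-2 * r) := by positivity
      rw [abs_le]; constructor <;> linarith) (by
      intro r hr
      have hrR : r ∈ R := mem_filter.2 ⟨mem_univ _, hr⟩
      have q2 := hb1 r
      have q4 := hb1 (-2 * r)
      have hx : ∀ x ∈ B, ‖ch (r * x) - 1‖ ≤ τ := by
        intro x hx
        exact ((mem_filter.1 hx).2 r hrR).trans hkτ
      have hx2 : ∀ x ∈ B, ‖ch (-2 * r * x) - 1‖ ≤ 2 * τ := by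
        intro x hx'
        have h1 := hx x hx'
        have e1 : ch (-2 * r * x) - 1 = conj ((ch (r * x) - 1) * (ch (r * x) + 1)) := by
          rw [show -2 * r * x = -(r * x + r * x) by ring, ch_neg, ch_add]
          simp only [map_mul, map_sub, map_add, map_one]
          ring
        rw [e1, RCLike.norm_conj, norm_mul]
        have h2 : ‖ch (r * x) + 1‖ ≤ 2 := by
          refine (norm_add_le _ _).trans ?_
          rw [norm_ch, norm_one]; norm_num
        calc _ ≤ τ * 2 := by gcongr
          _ = _ := by ring
      have l1 := hblow r τ hτpos.le (by linarith) hx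
      have l2 := hblow (-2 * r) (2 * τ) (by linarith) (by linarith) hx2
      have l3 : (1 - 2 * τ) ^ 2 ≤ b r ^ 2 := by
        have : 0 ≤ 1 - 2 * τ := by linarith
        gcongr
      have q5 : b r ^ 2 * b (-2 * r) ≤ 1 ^ 2 * 1 := by
        have := hb0 r
        have := hb0 (-2 * r)
        gcongr
      have q6 : 1 - 8 * τ ≤ b r ^ 2 * b (-2 * r) := by
        have r1 : 1 - 4 * τ ≤ b r ^ 2 := by nlinarith
        have r2 : b r ^ 2 ≤ 1 := by nlinarith [hb0 r]
        nlinarith [hb0 (-2 * r)]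
      rw [abs_of_nonneg (by linarith)]
      linarith) hepos he1 hK.le hτpos.le f1 f3 f2 f4
  have h9 : |tf f - tf g| ≤ (n:ℝ) ^ 2 * (2 * t) := by
    refine hdiff.trans ?_
    gcongr
    linarith
  have := (abs_le.1 h9).1
  nlinarith

end PSRoth

namespace PSRoth
open Finset Filter

/-- Squarefree integers up to `R` all of whose prime factors exceed `z`. -/
def LL (R z : ℕ) : Finset ℕ :=
  (Icc 1 R).filter fun l => Squarefree l ∧ ∀ p ∈ l.primeFactors, z < p

lemma mem_LL {R z l : ℕ} : l ∈ LL R z ↔ (1 ≤ l ∧ l ≤ R) ∧ Squarefree l ∧ ∀ p ∈ l.primeFactors, z < p := by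
  simp [LL]

lemma LL_dvd {R z l d : ℕ} (hl : l ∈ LL R z) (hd : d ∣ l) : d ∈ LL R z := by
  rw [mem_LL] at *
  have hl0 : l ≠ 0 := by omega
  refine ⟨⟨Nat.pos_of_dvd_of_pos hd (by omega), (Nat.le_of_dvd (by omega) hd).trans hl.1.2⟩,
    hl.2.1.squarefree_of_dvd hd, fun p hp => hl.2.2 p (Nat.primeFactors_mono hd hl0 hp)⟩

lemma one_mem_LL {R z : ℕ} (hR : 1 ≤ R) : 1 ∈ LL R z := by
  rw [mem_LL]; simp [hR]

/-- normalising sum -/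
noncomputable def GG (R z : ℕ) : ℝ := ∑ l ∈ LL R z, (l:ℝ)⁻¹

noncomputable def lam (R z d : ℕ) : ℝ :=
  (ArithmeticFunction.moebius d : ℝ) * d * ∑ l ∈ (LL R z).filter (d ∣ ·), (l:ℝ)⁻¹ / GG R z

noncomputable def VV (R z : ℕ) : ℝ :=
  ∑ a ∈ LL R z, ∑ b ∈ LL R z, lam R z a * lam R z b * ((a.lcm b : ℕ) : ℝ)⁻¹

lemma GG_ge_one {R z : ℕ} (hR : 1 ≤ R) : 1 ≤ GG R z := by
  unfold GG
  calc (1:ℝ) = ((1:ℕ):ℝ)⁻¹ := by simp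
    _ ≤ _ := single_le_sum (f := fun l : ℕ => (l:ℝ)⁻¹) (fun i _ => by positivity) (one_mem_LL hR)

lemma GG_le (R z : ℕ) : GG R z ≤ 1 + Real.log R := by
  refine le_trans ?_ (sum_inv_Icc_le R)
  exact sum_le_sum_of_subset_of_nonneg (filter_subset _ _) (fun i _ _ => by positivity)

lemma lam_one {R z : ℕ} (hR : 1 ≤ R) : lam R z 1 = 1 := by
  have h := GG_ge_one (z := z) hR
  have h0 : GG R z ≠ 0 := by linarith
  simp only [lam, ArithmeticFunction.moebius_apply_one, one_dvd, filter_true, ← sum_div]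
  change ((1:ℤ):ℝ) * ((1:ℕ):ℝ) * (GG R z / GG R z) = 1
  rw [div_self h0]; simp

lemma abs_lam_le {R z d : ℕ} (hR : 1 ≤ R) (hd : d ∈ LL R z) : |lam R z d| ≤ 1 := by
  have h := GG_ge_one (z := z) hR
  have hd1 : 1 ≤ d := (mem_LL.1 hd).1.1
  have hd' : (0:ℝ) < d := by exact_mod_cast hd1
  have hs : ∑ l ∈ (LL R z).filter (d ∣ ·), (l:ℝ)⁻¹ ≤ (d:ℝ)⁻¹ * GG R z := by
    unfold GG
    rw [mul_sum]
    have : (LL R z).filter (d ∣ ·) ⊆ (LL R z).image (d * ·) := by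
      intro a ha
      rw [mem_filter] at ha
      obtain ⟨e, he⟩ := ha.2
      rw [mem_image]
      exact ⟨e, LL_dvd ha.1 ⟨d, by rw [he]; ring⟩, he.symm⟩
    refine (sum_le_sum_of_subset_of_nonneg this (fun i _ _ => by positivity)).trans ?_
    rw [sum_image (fun x _ y _ hxy => Nat.eq_of_mul_eq_mul_left hd1 hxy)]
    refine le_of_eq (sum_congr rfl fun i _ => ?_)
    push_cast; rw [mul_inv]
  have hs0 : 0 ≤ ∑ l ∈ (LL R z).filter (d ∣ ·), (l:ℝ)⁻¹ := sum_nonneg fun i _ => by positivity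
  unfold lam
  rw [← sum_div, abs_mul, abs_mul, abs_of_pos hd', abs_of_nonneg (div_nonneg hs0 (by linarith))]
  have hm : |(ArithmeticFunction.moebius d : ℝ)| ≤ 1 := by
    exact_mod_cast ArithmeticFunction.abs_moebius_le_one (n := d)
  calc _ ≤ 1 * (d:ℝ) * ((d:ℝ)⁻¹ * GG R z / GG R z) := by gcongr
    _ = 1 := by field_simp

lemma moebius_interval {l m : ℕ} (hm : Squarefree m) (hlm : l ∣ m) :
    ∑ d ∈ m.divisors.filter (l ∣ ·), (ArithmeticFunction.moebius d : ℝ) =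
      if m = l then (ArithmeticFunction.moebius l : ℝ) else 0 := by
  obtain ⟨e, rfl⟩ := hlm
  have h0 : l * e ≠ 0 := hm.ne_zero
  have hl0 : l ≠ 0 := left_ne_zero_of_mul h0
  have he0 : e ≠ 0 := right_ne_zero_of_mul h0
  have hset : (l * e).divisors.filter (l ∣ ·) = e.divisors.image (l * ·) := by
    ext d
    simp only [mem_filter, Nat.mem_divisors, mem_image]
    constructor
    · rintro ⟨⟨h1, _⟩, ⟨k, rfl⟩⟩
      exact ⟨k, ⟨Nat.dvd_of_mul_dvd_mul_left (by omega) h1, he0⟩, rfl⟩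
    · rintro ⟨k, ⟨h1, _⟩, rfl⟩
      exact ⟨⟨Nat.mul_dvd_mul_left _ h1, h0⟩, dvd_mul_right _ _⟩
  rw [hset, sum_image (fun x _ y _ hxy => Nat.eq_of_mul_eq_mul_left (by omega) hxy)]
  have hco : ∀ k ∈ e.divisors, (ArithmeticFunction.moebius (l * k) : ℝ) =
      (ArithmeticFunction.moebius l : ℝ) * (ArithmeticFunction.moebius k : ℝ) := by
    intro k hk
    have hk' := (Nat.mem_divisors.1 hk).1
    have hc : Nat.Coprime l k := (Nat.coprime_of_squarefree_mul hm).coprime_dvd_right hk'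
    rw [ArithmeticFunction.isMultiplicative_moebius.map_mul_of_coprime hc]
    push_cast; ring
  rw [sum_congr rfl hco, ← mul_sum]
  have h1 : ∑ k ∈ e.divisors, ArithmeticFunction.moebius k = if e = 1 then 1 else 0 := by
    rw [← ArithmeticFunction.coe_mul_zeta_apply, ArithmeticFunction.moebius_mul_coe_zeta,
      ArithmeticFunction.one_apply]
  have h2 : ∑ k ∈ e.divisors, (ArithmeticFunction.moebius k : ℝ) = if e = 1 then 1 else 0 := by
    rw [← Int.cast_sum, h1]; split_ifs <;> simp
  rw [h2]
  by_cases he : e = 1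
  · simp [he]
  · rw [if_neg he, if_neg, mul_zero]
    intro h
    exact he (Nat.eq_of_mul_eq_mul_left (Nat.pos_of_ne_zero hl0) (by rw [h, mul_one]))

lemma lam_inv {R z l : ℕ} (hl : l ∈ LL R z) :
    ∑ d ∈ (LL R z).filter (l ∣ ·), lam R z d * (d:ℝ)⁻¹ =
      (ArithmeticFunction.moebius l : ℝ) * ((l:ℝ)⁻¹ / GG R z) := by
  have h1 : ∀ d ∈ (LL R z).filter (l ∣ ·), lam R z d * (d:ℝ)⁻¹ =
      ∑ m ∈ LL R z, if d ∣ m then (ArithmeticFunction.moebius d : ℝ) * ((m:ℝ)⁻¹ / GG R z) else 0 := by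
    intro d hd
    have hd1 : 1 ≤ d := (mem_LL.1 (mem_filter.1 hd).1).1.1
    have hd' : (d:ℝ) ≠ 0 := by positivity
    rw [← sum_filter, ← mul_sum]
    unfold lam
    rw [mul_right_comm, mul_assoc _ (d:ℝ), mul_inv_cancel₀ hd', mul_one]
  rw [sum_congr rfl h1, sum_comm]
  have h2 : ∀ m ∈ LL R z, (∑ d ∈ (LL R z).filter (l ∣ ·),
      if d ∣ m then (ArithmeticFunction.moebius d : ℝ) * ((m:ℝ)⁻¹ / GG R z) else 0) =
      if m = l then (ArithmeticFunction.moebius l : ℝ) * ((m:ℝ)⁻¹ / GG R z) else 0 := by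
    intro m hm
    have hm0 : m ≠ 0 := by have := (mem_LL.1 hm).1.1; omega
    rw [← sum_filter, ← sum_mul]
    have hset : ((LL R z).filter (l ∣ ·)).filter (· ∣ m) = m.divisors.filter (l ∣ ·) := by
      ext d
      simp only [mem_filter, Nat.mem_divisors]
      constructor
      · rintro ⟨⟨_, h2⟩, h3⟩; exact ⟨⟨h3, hm0⟩, h2⟩
      · rintro ⟨⟨h3, _⟩, h2⟩; exact ⟨⟨LL_dvd hm h3, h2⟩, h3⟩
    rw [hset]
    by_cases hlm : l ∣ m
    · rw [moebius_interval (mem_LL.1 hm).2.1 hlm]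
      split_ifs <;> simp
    · have : m.divisors.filter (l ∣ ·) = ∅ := by
        apply filter_eq_empty_iff.2
        intro d hd hld
        exact hlm (hld.trans (Nat.mem_divisors.1 hd).1)
      rw [this, sum_empty, zero_mul, if_neg]
      rintro rfl; exact hlm dvd_rfl
  rw [sum_congr rfl h2, sum_ite_eq' (LL R z) l, if_pos hl]

lemma VV_eq {R z : ℕ} : VV R z = ∑ l ∈ LL R z, (l.totient : ℝ) *
    ((ArithmeticFunction.moebius l : ℝ) * ((l:ℝ)⁻¹ / GG R z)) ^ 2 := by
  have h1 : ∀ l ∈ LL R z, (l.totient : ℝ) *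
      ((ArithmeticFunction.moebius l : ℝ) * ((l:ℝ)⁻¹ / GG R z)) ^ 2 =
      ∑ a ∈ LL R z, ∑ b ∈ LL R z, if l ∣ a ∧ l ∣ b then
        (l.totient : ℝ) * (lam R z a * (a:ℝ)⁻¹ * (lam R z b * (b:ℝ)⁻¹)) else 0 := by
    intro l hl
    rw [← lam_inv hl, sq, sum_mul_sum, mul_sum, sum_filter]
    refine sum_congr rfl fun a _ => ?_
    by_cases ha : l ∣ a
    · rw [if_pos ha, mul_sum, sum_filter]
      refine sum_congr rfl fun b _ => ?_
      simp [ha]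
    · simp [ha]
  rw [sum_congr rfl h1, sum_comm]
  unfold VV
  refine sum_congr rfl fun a ha => ?_
  rw [sum_comm]
  refine sum_congr rfl fun b hb => ?_
  have ha1 : 1 ≤ a := (mem_LL.1 ha).1.1
  have hb1 : 1 ≤ b := (mem_LL.1 hb).1.1
  have hg : ∑ l ∈ (LL R z).filter (fun l => l ∣ a ∧ l ∣ b), (l.totient : ℝ) = (a.gcd b : ℕ) := by
    rw [← Nat.sum_totient (a.gcd b)]
    push_cast
    refine sum_congr ?_ fun _ _ => rfl
    ext l
    simp only [mem_filter, Nat.mem_divisors, Nat.dvd_gcd_iff]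
    constructor
    · rintro ⟨_, h⟩; exact ⟨h, Nat.gcd_ne_zero_left (by omega)⟩
    · rintro ⟨h, _⟩; exact ⟨LL_dvd ha h.1, h⟩
  rw [← sum_filter, ← sum_mul, hg]
  have hgl : (((a.gcd b : ℕ):ℝ)) * ((a.lcm b : ℕ) : ℝ) = a * b := by exact_mod_cast Nat.gcd_mul_lcm a b
  have h3 : ((a.lcm b : ℕ) : ℝ) ≠ 0 := by
    exact_mod_cast Nat.lcm_ne_zero (by omega) (by omega)
  have h4 : (a:ℝ) ≠ 0 := by positivity
  have h5 : (b:ℝ) ≠ 0 := by positivity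
  field_simp
  linear_combination (-(lam R z a * lam R z b)) * hgl

lemma VV_le {R z : ℕ} (hR : 1 ≤ R) : VV R z ≤ (GG R z)⁻¹ := by
  have hG := GG_ge_one (z := z) hR
  rw [VV_eq]
  have h1 : ∀ l ∈ LL R z, (l.totient : ℝ) * ((ArithmeticFunction.moebius l : ℝ) * ((l:ℝ)⁻¹ / GG R z)) ^ 2
      ≤ (l:ℝ)⁻¹ * (GG R z)⁻¹ ^ 2 := by
    intro l hl
    have hl1 : 1 ≤ l := (mem_LL.1 hl).1.1
    have hl' : (0:ℝ) < l := by exact_mod_cast hl1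
    have hm : (ArithmeticFunction.moebius l : ℝ) ^ 2 ≤ 1 := by
      rw [sq_le_one_iff_abs_le_one]
      exact_mod_cast ArithmeticFunction.abs_moebius_le_one (n := l)
    have ht : (l.totient : ℝ) ≤ l := by exact_mod_cast Nat.totient_le l
    calc _ = (l.totient : ℝ) * (ArithmeticFunction.moebius l : ℝ) ^ 2 * ((l:ℝ)⁻¹ ^ 2 * (GG R z)⁻¹ ^ 2) := by
          rw [div_eq_mul_inv]; ring
      _ ≤ (l:ℝ) * 1 * ((l:ℝ)⁻¹ ^ 2 * (GG R z)⁻¹ ^ 2) := by gcongr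
      _ = _ := by field_simp
  refine (sum_le_sum h1).trans ?_
  rw [← sum_mul]
  change GG R z * _ ≤ _
  apply le_of_eq; field_simp

lemma VV_ge {R z : ℕ} (hR : 1 ≤ R) : (GG R z)⁻¹ ^ 2 ≤ VV R z := by
  rw [VV_eq]
  refine le_trans ?_ (single_le_sum (fun i _ => by positivity) (one_mem_LL hR))
  simp

lemma smooth_decomp (z : ℕ) : ∀ n : ℕ, n ≠ 0 → ∃ s m : ℕ, n = s * m ∧ s ∈ Nat.smoothNumbers (z + 1) ∧
    ∀ p, p.Prime → p ∣ m → z < p := by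
  intro n
  induction n using induction_on_primes with
  | zero => intro h; exact absurd rfl h
  | one =>
    intro _
    refine ⟨1, 1, rfl, Nat.mem_smoothNumbers'.2 ?_, ?_⟩
    · intro p hp h; exact absurd (Nat.dvd_one.1 h) hp.ne_one
    · intro p hp h; exact absurd (Nat.dvd_one.1 h) hp.ne_one
  | prime_mul p k hp ih =>
    intro h
    have hp' : p.Prime := hp
    obtain ⟨s, m, h1, h2, h3⟩ := ih (right_ne_zero_of_mul h)
    rcases le_or_gt p z with hz | hz
    · refine ⟨p * s, m, by rw [h1]; ring, Nat.mul_mem_smoothNumbers ?_ h2, h3⟩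
      exact Nat.mem_smoothNumbers_of_lt hp'.pos (by omega)
    · refine ⟨s, p * m, by rw [h1]; ring, h2, ?_⟩
      intro q hq hqd
      rcases (hq.dvd_mul).1 hqd with h4 | h4
      · rwa [(Nat.prime_dvd_prime_iff_eq hq hp').1 h4]
      · exact h3 q hq h4

lemma sum_inv_sq (R : ℕ) : ∑ k ∈ Icc 1 R, ((k:ℝ) ^ 2)⁻¹ ≤ 2 := by
  have : ∀ R : ℕ, ∑ k ∈ Icc 1 (R+1), ((k:ℝ) ^ 2)⁻¹ ≤ 2 - ((R:ℝ) + 1)⁻¹ := by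
    intro R
    induction R with
    | zero => norm_num
    | succ R ih =>
      rw [sum_Icc_succ_top (by omega)]
      have : ((((R + 1 + 1 : ℕ):ℝ)) ^ 2)⁻¹ ≤ ((R:ℝ) + 1)⁻¹ - ((R:ℝ) + 1 + 1)⁻¹ := by
        push_cast
        rw [inv_sub_inv (by positivity) (by positivity), inv_eq_one_div]
        rw [div_le_div_iff₀ (by positivity) (by positivity)]
        nlinarith
      push_cast at *
      linarith
  rcases R with _ | R
  · simp
  · have h := this R
    have : 0 ≤ ((R:ℝ) + 1)⁻¹ := by positivity
    linarith

lemma smooth_sum_le (R z : ℕ) : ∑ s ∈ Nat.smoothNumbersUpTo R (z+1), (s:ℝ)⁻¹ ≤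
    ∏ p ∈ (z+1).primesBelow, (1 - (p:ℝ)⁻¹)⁻¹ := by
  let f : ℕ →* ℝ := { toFun := fun n => (n:ℝ)⁻¹, map_one' := by simp, map_mul' := fun a b => by push_cast; rw [mul_inv] }
  have hf : ∀ n, f n = (n:ℝ)⁻¹ := fun n => rfl
  have h := (EulerProduct.summable_and_hasSum_smoothNumbers_prod_primesBelow_geometric (f := f) (by
    intro p hp
    rw [hf, Real.norm_of_nonneg (by positivity)]
    exact inv_lt_one_of_one_lt₀ (by exact_mod_cast hp.one_lt)) (z+1)).2
  simp only [hf] at h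
  have h2 : ∑ s ∈ (Nat.smoothNumbersUpTo R (z+1)).subtype (· ∈ Nat.smoothNumbers (z+1)), ((s:ℕ):ℝ)⁻¹ ≤
      ∏ p ∈ (z+1).primesBelow, (1 - (p:ℝ)⁻¹)⁻¹ := sum_le_hasSum _ (fun i _ => by positivity) h
  rwa [sum_subtype_of_mem (fun s : ℕ => (s:ℝ)⁻¹) (fun x hx => (Nat.mem_smoothNumbersUpTo.1 hx).2)] at h2

/-- lower bound for `GG` -/
lemma GG_lower {R z : ℕ} (hR : 1 ≤ R) :
    Real.log R ≤ 2 * (∏ p ∈ (z+1).primesBelow, (1 - (p:ℝ)⁻¹)⁻¹) * GG R z := by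
  have h1 : Real.log R ≤ ∑ n ∈ Icc 1 R, (n:ℝ)⁻¹ := by
    have h := log_add_one_le_harmonic R
    rw [harmonic_eq_sum_Icc] at h
    push_cast at h
    refine le_trans ?_ h
    apply Real.log_le_log (by exact_mod_cast hR)
    norm_num
  refine h1.trans ?_
  set T := (Nat.smoothNumbersUpTo R (z+1)) ×ˢ ((Icc 1 R) ×ˢ LL R z) with hT
  have hsub : Icc 1 R ⊆ T.image fun q => q.1 * (q.2.1 ^ 2 * q.2.2) := by
    intro n hn
    rw [mem_Icc] at hn
    obtain ⟨s, m, h2, h3, h4⟩ := smooth_decomp z n (by omega)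
    have hm0 : m ≠ 0 := by rintro rfl; omega
    have hs0 : s ≠ 0 := by rintro rfl; omega
    obtain ⟨l, b, hl0, hb0, h5, h6⟩ := Nat.sq_mul_squarefree_of_pos (Nat.pos_of_ne_zero hm0)
    have hmn : m ≤ n := by rw [h2]; exact Nat.le_mul_of_pos_left _ (Nat.pos_of_ne_zero hs0)
    have hsn : s ≤ n := by rw [h2]; exact Nat.le_mul_of_pos_right _ (Nat.pos_of_ne_zero hm0)
    have hlm : l ≤ m := Nat.le_of_dvd (by omega) ⟨b^2, by rw [← h5]; ring⟩
    have hbm : b ≤ m := Nat.le_of_dvd (by omega) ⟨b * l, by rw [← h5]; ring⟩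
    rw [mem_image]
    refine ⟨(s, b, l), ?_, by rw [h2, ← h5]⟩
    rw [hT, mem_product, mem_product, Nat.mem_smoothNumbersUpTo, mem_Icc, mem_LL]
    refine ⟨⟨hsn.trans hn.2, h3⟩, ⟨hb0, hbm.trans (hmn.trans hn.2)⟩, ⟨hl0, hlm.trans (hmn.trans hn.2)⟩, h6, ?_⟩
    intro p hp
    have hp' := Nat.mem_primeFactors.1 hp
    exact h4 p hp'.1 (hp'.2.1.trans ⟨b^2, by rw [← h5]; ring⟩)
  have h7 : ∑ n ∈ Icc 1 R, (n:ℝ)⁻¹ ≤ ∑ q ∈ T, (q.1:ℝ)⁻¹ * (((q.2.1:ℝ) ^ 2)⁻¹ * (q.2.2:ℝ)⁻¹) := by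
    refine (sum_le_sum_of_subset_of_nonneg hsub (fun i _ _ => by positivity)).trans ?_
    refine (sum_image_le_of_nonneg (f := fun n : ℕ => (n:ℝ)⁻¹) ?_).trans ?_
    · intro i _; positivity
    · refine le_of_eq (sum_congr rfl fun q _ => ?_)
      push_cast; rw [mul_inv, mul_inv]
  refine h7.trans ?_
  have h8 : ∑ q ∈ T, (q.1:ℝ)⁻¹ * (((q.2.1:ℝ) ^ 2)⁻¹ * (q.2.2:ℝ)⁻¹) =
      (∑ s ∈ Nat.smoothNumbersUpTo R (z+1), (s:ℝ)⁻¹) * ((∑ k ∈ Icc 1 R, ((k:ℝ) ^ 2)⁻¹) * GG R z) := by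
    rw [hT]; unfold GG
    simp only [sum_product, ← mul_sum, ← sum_mul]
  rw [h8]
  have hG := GG_ge_one (z := z) hR
  have hP := smooth_sum_le R z
  have h0 : 0 ≤ ∑ s ∈ Nat.smoothNumbersUpTo R (z+1), (s:ℝ)⁻¹ := sum_nonneg fun i _ => by positivity
  calc _ ≤ (∏ p ∈ (z+1).primesBelow, (1 - (p:ℝ)⁻¹)⁻¹) * (2 * GG R z) := by
        have h9 := sum_inv_sq R
        have h10 : 0 ≤ ∑ k ∈ Icc 1 R, ((k:ℝ) ^ 2)⁻¹ := sum_nonneg fun i _ => by positivity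
        have h11 : 0 ≤ GG R z := by linarith
        gcongr
        exact h0.trans hP
    _ = _ := by ring

lemma pair_sum {R p : ℕ} (hp : p.Prime) :
    ∑ a ∈ Icc 1 R, ∑ b ∈ Icc 1 R, (if p ∣ a.lcm b then ((a.lcm b : ℕ) : ℝ)⁻¹ else 0) ≤
      3 * (1 + Real.log R) ^ 3 / p := by
  set H := ∑ i ∈ Icc 1 R, ((i:ℝ))⁻¹ with hH
  have hH0 : 0 ≤ H := sum_inv_Icc_nonneg R
  have hp' : (0:ℝ) < p := by exact_mod_cast hp.pos
  set F : ℕ × ℕ × ℕ → ℝ := fun q => if p ∣ q.1 * (q.2.1 * q.2.2) then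
    (q.1:ℝ)⁻¹ * ((q.2.1:ℝ)⁻¹ * (q.2.2:ℝ)⁻¹) else 0 with hF
  have hF0 : ∀ q, 0 ≤ F q := by
    intro q; simp only [hF]; split_ifs <;> positivity
  set i : ℕ × ℕ → ℕ × ℕ × ℕ := fun q => (q.1.gcd q.2, q.1 / q.1.gcd q.2, q.2 / q.1.gcd q.2) with hi
  set T := Icc 1 R ×ˢ (Icc 1 R ×ˢ Icc 1 R) with hT
  have hmaps : ∀ q ∈ Icc 1 R ×ˢ Icc 1 R, i q ∈ T ∧
      q.1.lcm q.2 = (i q).1 * ((i q).2.1 * (i q).2.2) ∧ q = ((i q).1 * (i q).2.1, (i q).1 * (i q).2.2) := by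
    rintro ⟨a, b⟩ hq
    rw [mem_product, mem_Icc, mem_Icc] at hq
    simp only at hq
    have hg : 0 < a.gcd b := Nat.gcd_pos_of_pos_left _ (by omega)
    obtain ⟨x, hx⟩ := Nat.gcd_dvd_left a b
    obtain ⟨y, hy⟩ := Nat.gcd_dvd_right a b
    have ex : a / a.gcd b = x := Nat.div_eq_of_eq_mul_right hg hx
    have ey : b / a.gcd b = y := Nat.div_eq_of_eq_mul_right hg hy
    have hx0 : 0 < x := by rcases Nat.eq_zero_or_pos x with h | h; · subst h; omega
                           · exact h
    have hy0 : 0 < y := by rcases Nat.eq_zero_or_pos y with h | h; · subst h; omega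
                           · exact h
    simp only [hi, hT, mem_product, mem_Icc, ex, ey]
    refine ⟨⟨⟨hg, (Nat.gcd_le_left _ (by omega)).trans hq.1.2⟩, ⟨hx0, ?_⟩, ⟨hy0, ?_⟩⟩, ?_, ?_⟩
    · exact (Nat.le_of_dvd (by omega) ⟨a.gcd b, by rw [mul_comm]; exact hx⟩).trans hq.1.2
    · exact (Nat.le_of_dvd (by omega) ⟨a.gcd b, by rw [mul_comm]; exact hy⟩).trans hq.2.2
    · have := Nat.gcd_mul_lcm a b
      apply Nat.eq_of_mul_eq_mul_left hg
      rw [this]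
      nth_rewrite 1 [hx]
      nth_rewrite 2 [hy]
      ring
    · rw [← hx, ← hy]
  have hinj : Set.InjOn i (Icc 1 R ×ˢ Icc 1 R : Finset (ℕ × ℕ)) := by
    intro q hq r hr hqr
    rw [(hmaps q hq).2.2, (hmaps r hr).2.2, hqr]
  have h1 : ∑ a ∈ Icc 1 R, ∑ b ∈ Icc 1 R, (if p ∣ a.lcm b then ((a.lcm b : ℕ) : ℝ)⁻¹ else 0) ≤
      ∑ q ∈ T, F q := by
    rw [← sum_product']
    calc _ = ∑ q ∈ Icc 1 R ×ˢ Icc 1 R, F (i q) := by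
          refine sum_congr rfl fun q hq => ?_
          rw [(hmaps q hq).2.1]
          simp only [hF]
          push_cast
          rw [mul_inv, mul_inv]
      _ = ∑ q ∈ (Icc 1 R ×ˢ Icc 1 R).image i, F q := (sum_image hinj).symm
      _ ≤ _ := by
          refine sum_le_sum_of_subset_of_nonneg ?_ (fun q _ _ => hF0 q)
          intro q hq
          obtain ⟨r, hr, rfl⟩ := mem_image.1 hq
          exact (hmaps r hr).1
  set D : ℕ → ℝ := fun x => if p ∣ x then (x:ℝ)⁻¹ else 0 with hD
  have hDs : ∑ x ∈ Icc 1 R, D x ≤ (p:ℝ)⁻¹ * H := by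
    simp only [hD]
    rw [← sum_filter]
    exact sum_inv_dvd_le p R hp.pos
  have h2 : ∑ q ∈ T, F q ≤ ∑ x ∈ Icc 1 R, ∑ y ∈ Icc 1 R, ∑ w ∈ Icc 1 R,
      (D x * ((y:ℝ)⁻¹ * (w:ℝ)⁻¹) + (x:ℝ)⁻¹ * (D y * (w:ℝ)⁻¹) + (x:ℝ)⁻¹ * ((y:ℝ)⁻¹ * D w)) := by
    rw [hT, sum_product]
    refine sum_le_sum fun x _ => ?_
    rw [sum_product]
    refine sum_le_sum fun y _ => sum_le_sum fun w _ => ?_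
    have hD0 : ∀ x, 0 ≤ D x := by intro x; simp only [hD]; split_ifs <;> positivity
    have hx := hD0 x
    have hy := hD0 y
    have hw := hD0 w
    simp only [hF]
    split_ifs with h
    · rcases hp.dvd_mul.1 h with h3 | h3
      · have e : D x = (x:ℝ)⁻¹ := by simp only [hD]; rw [if_pos h3]
        rw [e]
        have : 0 ≤ (x:ℝ)⁻¹ * (D y * (w:ℝ)⁻¹) + (x:ℝ)⁻¹ * ((y:ℝ)⁻¹ * D w) := by positivity
        linarith
      · rcases hp.dvd_mul.1 h3 with h4 | h4
        · have e : D y = (y:ℝ)⁻¹ := by simp only [hD]; rw [if_pos h4]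
          rw [e]
          have : 0 ≤ D x * ((y:ℝ)⁻¹ * (w:ℝ)⁻¹) + (x:ℝ)⁻¹ * ((y:ℝ)⁻¹ * D w) := by positivity
          linarith
        · have e : D w = (w:ℝ)⁻¹ := by simp only [hD]; rw [if_pos h4]
          rw [e]
          have : 0 ≤ D x * ((y:ℝ)⁻¹ * (w:ℝ)⁻¹) + (x:ℝ)⁻¹ * (D y * (w:ℝ)⁻¹) := by positivity
          linarith
    · positivity
  have h3 : ∑ x ∈ Icc 1 R, ∑ y ∈ Icc 1 R, ∑ w ∈ Icc 1 R,
      (D x * ((y:ℝ)⁻¹ * (w:ℝ)⁻¹) + (x:ℝ)⁻¹ * (D y * (w:ℝ)⁻¹) + (x:ℝ)⁻¹ * ((y:ℝ)⁻¹ * D w)) =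
      3 * ((∑ x ∈ Icc 1 R, D x) * H ^ 2) := by
    simp only [sum_add_distrib, ← mul_sum, ← sum_mul, ← hH]
    ring
  refine h1.trans (h2.trans ?_)
  rw [h3]
  have hHl : H ≤ 1 + Real.log R := sum_inv_Icc_le R
  calc 3 * ((∑ x ∈ Icc 1 R, D x) * H ^ 2) ≤ 3 * ((p:ℝ)⁻¹ * H * H ^ 2) := by gcongr
    _ = 3 * H ^ 3 / p := by field_simp
    _ ≤ _ := by gcongr

end PSRoth

namespace PSRoth
open Finset Filter

noncomputable def PP (y : ℕ) : ℝ := ∏ p ∈ (y+1).primesBelow, (1 - (p:ℝ)⁻¹)⁻¹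

lemma one_le_factor {p : ℕ} (hp : p.Prime) : 1 ≤ (1 - (p:ℝ)⁻¹)⁻¹ := by
  have h2 : (2:ℝ) ≤ p := by exact_mod_cast hp.two_le
  have h3 : (p:ℝ)⁻¹ ≤ 2⁻¹ := by gcongr
  have h4 : 0 < (p:ℝ)⁻¹ := by positivity
  rw [one_le_inv₀ (by linarith)]
  linarith

lemma PP_pos (y : ℕ) : 1 ≤ PP y := by
  unfold PP
  have : ∀ p ∈ (y+1).primesBelow, 1 ≤ (1 - (p:ℝ)⁻¹)⁻¹ := fun p hp => one_le_factor (Nat.prime_of_mem_primesBelow hp)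
  calc (1:ℝ) = ∏ p ∈ (y+1).primesBelow, (1:ℝ) := by simp
    _ ≤ _ := prod_le_prod (fun _ _ => by norm_num) this

lemma PP_split {y v : ℕ} (h : y ≤ v) : PP v = PP y * ∏ p ∈ (Ioc y v).filter Nat.Prime, (1 - (p:ℝ)⁻¹)⁻¹ := by
  unfold PP
  rw [← prod_union]
  · refine prod_congr ?_ fun _ _ => rfl
    ext p
    simp only [Nat.mem_primesBelow, mem_union, mem_filter, mem_Ioc]
    constructor
    · rintro ⟨h1, h2⟩
      by_cases h3 : p < y + 1
      · exact Or.inl ⟨h3, h2⟩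
      · exact Or.inr ⟨⟨by omega, by omega⟩, h2⟩
    · rintro (⟨h1, h2⟩ | ⟨h1, h2⟩) <;> exact ⟨by omega, h2⟩
  · rw [disjoint_left]
    intro p hp hp'
    simp only [Nat.mem_primesBelow, mem_filter, mem_Ioc] at hp hp'
    omega

lemma PP_mono {y v : ℕ} (h : y ≤ v) : PP y ≤ PP v := by
  rw [PP_split h]
  have h1 := PP_pos y
  have h2 : 1 ≤ ∏ p ∈ (Ioc y v).filter Nat.Prime, (1 - (p:ℝ)⁻¹)⁻¹ := by
    calc (1:ℝ) = ∏ p ∈ (Ioc y v).filter Nat.Prime, (1:ℝ) := by simp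
      _ ≤ _ := prod_le_prod (fun _ _ => by norm_num) fun p hp => one_le_factor (mem_filter.1 hp).2
  nlinarith

lemma PP_double {y : ℕ} (hy : 2 ≤ y) : PP (2 * y) ≤ PP y * Real.exp (8 / Real.log y) := by
  rw [PP_split (by omega : y ≤ 2 * y)]
  have h1 := PP_pos y
  have hyR : (2:ℝ) ≤ y := by exact_mod_cast hy
  have hlog : 0 < Real.log y := Real.log_pos (by linarith)
  gcongr
  have h2 : ∀ p ∈ (Ioc y (2*y)).filter Nat.Prime, (1 - (p:ℝ)⁻¹)⁻¹ ≤ Real.exp (2 / (y * Real.log y) * Real.log p) := by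
    intro p hp
    rw [mem_filter, mem_Ioc] at hp
    have hyp : (y:ℝ) ≤ p := by exact_mod_cast hp.1.1.le
    have h3 : (p:ℝ)⁻¹ ≤ 2⁻¹ := by gcongr; linarith
    have h4 : 0 < (p:ℝ)⁻¹ := by have : (0:ℝ) < p := by linarith
                                positivity
    have h5 : (1 - (p:ℝ)⁻¹)⁻¹ ≤ 2 * (p:ℝ)⁻¹ + 1 := by
      rw [inv_le_iff_one_le_mul₀ (by linarith)]
      nlinarith
    refine h5.trans ((Real.add_one_le_exp _).trans ?_)
    apply Real.exp_le_exp.2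
    have h6 : Real.log y ≤ Real.log p := Real.log_le_log (by linarith) hyp
    calc 2 * (p:ℝ)⁻¹ ≤ 2 * (y:ℝ)⁻¹ := by gcongr
      _ = 2 / (y * Real.log y) * Real.log y := by field_simp
      _ ≤ _ := by gcongr
  have h0 : ∀ p ∈ (Ioc y (2*y)).filter Nat.Prime, 0 ≤ (1 - (p:ℝ)⁻¹)⁻¹ := fun p hp =>
    zero_le_one.trans (one_le_factor (mem_filter.1 hp).2)
  refine (prod_le_prod h0 h2).trans ?_
  rw [← Real.exp_sum, ← mul_sum]
  apply Real.exp_le_exp.2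
  have h7 : ∑ p ∈ (Ioc y (2*y)).filter Nat.Prime, Real.log p ≤ Real.log 4 * (2 * y) := by
    have h8 := Chebyshev.theta_le_log4_mul_x (x := 2 * (y:ℝ)) (by positivity)
    refine le_trans ?_ h8
    unfold Chebyshev.theta
    have : ⌊(2 * (y:ℝ))⌋₊ = 2 * y := by
      rw [show (2 * (y:ℝ)) = ((2 * y : ℕ):ℝ) by push_cast; ring]; exact Nat.floor_natCast _
    rw [this]
    refine sum_le_sum_of_subset_of_nonneg ?_ ?_
    · intro p hp
      rw [mem_filter, mem_Ioc] at *
      exact ⟨⟨by omega, hp.1.2⟩, hp.2⟩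
    · intro p hp _
      exact Real.log_natCast_nonneg _
  have h9 : Real.log 4 ≤ 2 := by
    have : Real.log 4 = 2 * Real.log 2 := by
      rw [show (4:ℝ) = 2 ^ 2 by norm_num, Real.log_pow]; norm_num
    rw [this]; linarith [Real.log_two_lt_d9]
  calc 2 / (y * Real.log y) * ∑ p ∈ (Ioc y (2*y)).filter Nat.Prime, Real.log p ≤
        2 / (y * Real.log y) * (2 * (2 * y)) := by
        gcongr
        refine h7.trans ?_
        gcongr
    _ = _ := by field_simp; norm_num

lemma PP_dyadic {w : ℕ} (hw : 2 ≤ w) (j : ℕ) : PP (2 ^ j * w) ≤ PP w * Real.exp (8 / Real.log w * j) := by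
  have hwR : (2:ℝ) ≤ w := by exact_mod_cast hw
  have hlog : 0 < Real.log w := Real.log_pos (by linarith)
  induction j with
  | zero => simp
  | succ j ih =>
    have h1 : w ≤ 2 ^ j * w := Nat.le_mul_of_pos_left _ (by positivity)
    have h2 := PP_double (hw.trans h1)
    have h3 : Real.exp (8 / Real.log ((2 ^ j * w : ℕ):ℝ)) ≤ Real.exp (8 / Real.log w) := by
      apply Real.exp_le_exp.2
      gcongr
    have h4 := PP_pos (2 ^ j * w)
    calc PP (2 ^ (j+1) * w) = PP (2 * (2 ^ j * w)) := by congr 1; ring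
      _ ≤ _ := h2
      _ ≤ PP w * Real.exp (8 / Real.log w * j) * Real.exp (8 / Real.log w) := by
            have := PP_pos w
            gcongr
      _ = PP w * (Real.exp (8 / Real.log w * j) * Real.exp (8 / Real.log w)) := by ring
      _ = _ := by rw [← Real.exp_add]; congr 2; push_cast; ring

lemma PP_pow (k : ℕ) : ∃ C > 0, ∀ w : ℕ, 2 ≤ w → PP (w ^ k) ≤ C * PP w := by
  refine ⟨Real.exp (16 * (k + 1)), by positivity, fun w hw => ?_⟩
  have hwR : (2:ℝ) ≤ w := by exact_mod_cast hw
  have hlog : Real.log 2 ≤ Real.log w := Real.log_le_log (by norm_num) hwR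
  have hl2 := Real.log_two_gt_d9
  set j := ⌈k * Real.log w / Real.log 2⌉₊ with hj
  have h1 : (k * Real.log w / Real.log 2) ≤ j := Nat.le_ceil _
  have h2 : (j:ℝ) < k * Real.log w / Real.log 2 + 1 := Nat.ceil_lt_add_one (by positivity)
  have h3 : w ^ k ≤ 2 ^ j * w := by
    have h4 : (w:ℝ) ^ k ≤ 2 ^ j := by
      rw [← Real.log_le_log_iff (by positivity) (by positivity), Real.log_pow, Real.log_pow]
      rw [div_le_iff₀ (by linarith)] at h1
      exact h1
    have h5 : w ^ k ≤ 2 ^ j := by exact_mod_cast h4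
    exact h5.trans (Nat.le_mul_of_pos_right _ (by omega))
  refine (PP_mono h3).trans ((PP_dyadic hw j).trans ?_)
  rw [mul_comm]
  have := PP_pos w
  have hlw : 0 < Real.log w := by linarith
  suffices h : 8 / Real.log w * j ≤ 16 * (k + 1) by gcongr
  calc 8 / Real.log w * j ≤ 8 / Real.log w * (k * Real.log w / Real.log 2 + 1) := by gcongr
    _ = 8 * (k / Real.log 2) + 8 / Real.log w := by field_simp
    _ ≤ 8 * (k / (1/2)) + 8 / (1/2) := by
      gcongr <;> linarith
    _ = _ := by ring

/-- totient of the primorial -/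
lemma totient_primorial (w : ℕ) : (primorial w : ℝ) = (primorial w).totient * PP w := by
  have h := Nat.totient_eq_mul_prod_factors (primorial w)
  have h1 : (((primorial w).totient : ℚ):ℝ) =
      (((primorial w : ℚ) * ∏ p ∈ (primorial w).primeFactors, (1 - (p:ℚ)⁻¹) : ℚ) : ℝ) := by rw [h]
  push_cast at h1
  rw [h1, primeFactors_primorial]
  unfold PP
  have h2 : Nat.primesLE w = (w+1).primesBelow := rfl
  rw [h2, prod_inv_distrib, mul_assoc, mul_inv_cancel₀, mul_one]
  rw [prod_ne_zero_iff]
  intro p hp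
  have := one_le_factor (Nat.prime_of_mem_primesBelow hp)
  intro h0
  rw [h0] at this
  norm_num at this

end PSRoth

namespace PSRoth
open Finset Filter

def filt (b W M D : ℕ) : Finset ℕ := (range M).filter fun t => D ∣ b + W * t

noncomputable def TT (b W M D : ℕ) (θ : ℝ) : ℂ := ∑ t ∈ filt b W M D, ee (t * θ)

lemma filt_eq (b W M D : ℕ) (hD : 1 ≤ D) (hc : Nat.Coprime W D) :
    ∃ t0 k : ℕ, t0 < D ∧ filt b W M D = (range k).image (fun i => t0 + D * i) ∧ D * k ≤ M + D ∧
      M ≤ D * k + D ∧ D ∣ b + W * t0 := by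
  have : NeZero D := ⟨by omega⟩
  obtain ⟨t0, ht0, hd⟩ : ∃ t0 < D, D ∣ b + W * t0 := by
    refine ⟨((-(b : ZMod D)) * (W : ZMod D)⁻¹).val, ZMod.val_lt _, ?_⟩
    rw [← ZMod.natCast_eq_zero_iff]
    push_cast
    rw [ZMod.natCast_val, ZMod.cast_id', id]
    have := ZMod.coe_mul_inv_eq_one W hc
    linear_combination (-(b : ZMod D)) * this
  refine ⟨t0, (M + D - 1 - t0) / D, ht0, ?_, ?_, ?_, hd⟩
  · ext t
    simp only [filt, mem_filter, mem_range, mem_image]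
    constructor
    · rintro ⟨h1, h2⟩
      have h3 : t ≡ t0 [MOD D] := by
        have h4 : W * t ≡ W * t0 [MOD D] := by
          apply Nat.ModEq.add_left_cancel' b
          exact ((Nat.modEq_zero_iff_dvd.2 h2).trans (Nat.modEq_zero_iff_dvd.2 hd).symm)
        exact Nat.ModEq.cancel_left_of_coprime (by rw [Nat.coprime_comm] at hc; exact hc) h4
      have h5 : t0 = t % D := by
        rw [← Nat.mod_eq_of_lt ht0]; exact h3.symm
      have h6 := Nat.div_add_mod t D
      refine ⟨t / D, ?_, by omega⟩
      rw [Nat.lt_iff_add_one_le, Nat.le_div_iff_mul_le (by omega)]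
      have : (t / D + 1) * D = D * (t / D) + D := by ring
      omega
    · rintro ⟨i, hi, rfl⟩
      rw [Nat.lt_iff_add_one_le, Nat.le_div_iff_mul_le (by omega)] at hi
      have : (i + 1) * D = D * i + D := by ring
      refine ⟨by omega, ?_⟩
      have : b + W * (t0 + D * i) = b + W * t0 + D * (W * i) := by ring
      rw [this]
      exact dvd_add hd (dvd_mul_right _ _)
  · have := Nat.mul_div_le (M + D - 1 - t0) D
    omega
  · have := Nat.lt_mul_div_succ (M + D - 1 - t0) (show 0 < D by omega)
    have e : D * ((M + D - 1 - t0) / D + 1) = D * ((M + D - 1 - t0) / D) + D := by ring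
    omega

lemma filt_sum {b W M D t0 k : ℕ} (hD : 1 ≤ D) (h : filt b W M D = (range k).image (fun i => t0 + D * i))
    (g : ℕ → ℂ) : ∑ t ∈ filt b W M D, g t = ∑ i ∈ range k, g (t0 + D * i) := by
  rw [h, sum_image]
  intro x _ y _ hxy
  have : D * x = D * y := by simpa using hxy
  exact Nat.eq_of_mul_eq_mul_left (by omega) this

lemma TT_far {b W M D : ℕ} (hD : 1 ≤ D) (hc : Nat.Coprime W D) (θ ρ : ℝ) (hρ : 0 < ρ)
    (hθ : ρ ≤ |D * θ - round (D * θ)|) : ‖TT b W M D θ‖ ≤ 1 / ρ := by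
  obtain ⟨t0, k, _, h, _⟩ := filt_eq b W M D hD hc
  unfold TT
  rw [filt_sum hD h]
  have e : ∀ i ∈ range k, ee (((t0 + D * i : ℕ):ℝ) * θ) = ee (t0 * θ) * ee (i * (D * θ)) := by
    intro i _
    rw [← ee_add]; congr 1; push_cast; ring
  rw [sum_congr rfl e, ← mul_sum, norm_mul, norm_ee, one_mul]
  have h0 : (D * θ - round (D * θ)) ≠ 0 := by
    intro h0; rw [h0, abs_zero] at hθ; linarith
  refine (geom_bound _ k h0).trans ?_
  apply one_div_le_one_div_of_le hρ
  have := abs_nonneg ((D:ℝ) * θ - round (D * θ))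
  linarith

lemma filt_card {b W M D : ℕ} (hD : 1 ≤ D) (hc : Nat.Coprime W D) : (#(filt b W M D) : ℝ) ≤ M / D + 1 := by
  obtain ⟨t0, k, _, h, h2, _⟩ := filt_eq b W M D hD hc
  have hD' : (0:ℝ) < D := by exact_mod_cast hD
  have h3 : #(filt b W M D) ≤ k := by
    rw [h]; exact card_image_le.trans (by simp)
  have h4 : (k:ℝ) ≤ M / D + 1 := by
    have : (D:ℝ) * k ≤ M + D := by exact_mod_cast h2
    rw [div_add_one hD'.ne', le_div_iff₀ hD']; linarith
  exact le_trans (by exact_mod_cast h3) h4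

lemma TT_triv {b W M D : ℕ} (hD : 1 ≤ D) (hc : Nat.Coprime W D) (θ : ℝ) : ‖TT b W M D θ‖ ≤ M / D + 1 := by
  refine le_trans ?_ (filt_card (b := b) hD hc)
  unfold TT
  refine (norm_sum_le _ _).trans ?_
  simp [norm_ee]

lemma TT_one (b W M : ℕ) (θ : ℝ) : TT b W M 1 θ = ∑ t ∈ range M, ee (t * θ) := by
  unfold TT filt
  simp

lemma range_compare (M N : ℕ) (g : ℕ → ℂ) (hg : ∀ t, ‖g t‖ ≤ 1) (D : ℕ) (h1 : M ≤ N + D) (h2 : N ≤ M + D) :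
    ‖∑ t ∈ range M, g t - ∑ t ∈ range N, g t‖ ≤ D := by
  have key : ∀ M N : ℕ, M ≤ N → N ≤ M + D → ‖∑ t ∈ range N, g t - ∑ t ∈ range M, g t‖ ≤ D := by
    intro M N h h'
    obtain ⟨j, rfl⟩ := Nat.exists_eq_add_of_le h
    rw [sum_range_add_sub_sum_range]
    refine (norm_sum_le _ _).trans ?_
    calc _ ≤ ∑ i ∈ range j, (1:ℝ) := sum_le_sum fun i _ => hg _
      _ = j := by simp
      _ ≤ _ := by exact_mod_cast (by omega : j ≤ D)
  rcases le_total M N with h | h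
  · rw [norm_sub_rev]; exact key M N h h2
  · exact key N M h h1

lemma TT_near {b W M D : ℕ} (hD : 1 ≤ D) (hc : Nat.Coprime W D) (θ ρ : ℝ)
    (hθ : |θ - round θ| ≤ ρ) :
    ‖TT b W M D θ - (D:ℝ)⁻¹ * TT b W M 1 θ‖ ≤ 1 + (M + D) * (7 * ρ) := by
  obtain ⟨t0, k, ht0, h, h2, h3, _⟩ := filt_eq b W M D hD hc
  have hD' : (0:ℝ) < D := by exact_mod_cast hD
  have hρ : 0 ≤ ρ := (abs_nonneg _).trans hθ
  set β := θ - round θ with hβ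
  have e : ∀ t : ℕ, ee (t * θ) = ee (t * β) := by
    intro t
    rw [show (t:ℝ) * θ = t * β + ((t * round θ : ℤ):ℝ) by rw [hβ]; push_cast; ring, ee_add_int]
  clear_value β
  rw [TT_one]
  unfold TT
  rw [filt_sum hD h]
  simp only [e]
  have blk : ∀ j : ℕ, ‖∑ t ∈ range (D * j), ee (t * β) - D * ∑ i ∈ range j, ee ((t0 + D * i : ℕ) * β)‖ ≤
      j * (D * (D * (7 * ρ))) := by
    intro j
    induction j with
    | zero => simp
    | succ j ih =>
      rw [mul_add, mul_one, sum_range_add, sum_range_succ]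
      have e2 : ∑ t ∈ range (D * j), ee (t * β) + ∑ x ∈ range D, ee ((D * j + x : ℕ) * β) -
          D * (∑ i ∈ range j, ee ((t0 + D * i : ℕ) * β) + ee ((t0 + D * j : ℕ) * β)) =
          (∑ t ∈ range (D * j), ee (t * β) - D * ∑ i ∈ range j, ee ((t0 + D * i : ℕ) * β)) +
          ∑ x ∈ range D, (ee ((D * j + x : ℕ) * β) - ee ((t0 + D * j : ℕ) * β)) := by
        rw [sum_sub_distrib, sum_const, card_range, nsmul_eq_mul]; ring
      rw [e2]
      refine (norm_add_le _ _).trans ?_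
      have h5 : ‖∑ x ∈ range D, (ee ((D * j + x : ℕ) * β) - ee ((t0 + D * j : ℕ) * β))‖ ≤ D * (D * (7 * ρ)) := by
        refine (norm_sum_le _ _).trans ?_
        calc _ ≤ ∑ x ∈ range D, (D * (7 * ρ) : ℝ) := by
              refine sum_le_sum fun x hx => ?_
              rw [mem_range] at hx
              have e3 : ee ((D * j + x : ℕ) * β) - ee ((t0 + D * j : ℕ) * β) =
                  ee ((t0 + D * j : ℕ) * β) * (ee (((x:ℝ) - t0) * β) - 1) := by
                rw [mul_sub, ← ee_add, mul_one]; congr 2; push_cast; ring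
              rw [e3, norm_mul, norm_ee, one_mul]
              refine (norm_ee_sub_one_le _).trans ?_
              rw [abs_mul]
              have h6 : |(x:ℝ) - t0| ≤ D := by
                have a1 : (x:ℝ) < D := by exact_mod_cast hx
                have a2 : (t0:ℝ) < D := by exact_mod_cast ht0
                have a3 : (0:ℝ) ≤ x := by positivity
                have a4 : (0:ℝ) ≤ t0 := by positivity
                rw [abs_le]; constructor <;> linarith
              have h7 := Real.pi_lt_d2
              calc 2 * Real.pi * (|(x:ℝ) - t0| * |β|) ≤ 7 * (D * ρ) := by
                    gcongr; linarith
                _ = _ := by ring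
          _ = _ := by simp
      push_cast
      push_cast at ih h5
      linarith
  have hb := blk k
  have hr := range_compare M (D * k) (fun t => ee (t * β)) (fun t => (norm_ee _).le) D h3 h2
  have e4 : ∑ i ∈ range k, ee ((t0 + D * i : ℕ) * β) - (((D:ℝ)⁻¹ : ℝ) : ℂ) * ∑ t ∈ range M, ee (t * β) =
      -(((D:ℝ)⁻¹ : ℝ) : ℂ) * ((∑ t ∈ range M, ee (t * β) - ∑ t ∈ range (D * k), ee (t * β)) +
        (∑ t ∈ range (D * k), ee (t * β) - D * ∑ i ∈ range k, ee ((t0 + D * i : ℕ) * β))) := by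
    have : (((D:ℝ)⁻¹ : ℝ) : ℂ) * D = 1 := by
      push_cast
      rw [inv_mul_cancel₀]; exact_mod_cast hD'.ne'
    linear_combination (-∑ i ∈ range k, ee ((t0 + D * i : ℕ) * β)) * this
  rw [e4, norm_mul, norm_neg, Complex.norm_real, Real.norm_of_nonneg (by positivity)]
  have h8 : (k:ℝ) * D ≤ M + D := by
    have : (D:ℝ) * k ≤ M + D := by exact_mod_cast h2
    linarith
  calc _ ≤ (D:ℝ)⁻¹ * (D + k * (D * (D * (7 * ρ)))) := by
        gcongr
        exact (norm_add_le _ _).trans (add_le_add hr hb)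
    _ = 1 + k * D * (7 * ρ) := by field_simp
    _ ≤ _ := by gcongr

lemma near_common (θ ρ : ℝ) (Q : ℕ) (hρ : 2 * Q * ρ ≤ 1) :
    (∀ D : ℕ, 1 ≤ D → D ≤ Q → ρ ≤ |D * θ - round (D * θ)|) ∨
    ∃ q : ℕ, 1 ≤ q ∧ q ≤ Q ∧ |q * θ - round (q * θ)| < ρ ∧
      ∀ D : ℕ, 1 ≤ D → D ≤ Q → |D * θ - round (D * θ)| < ρ → q ∣ D := by
  classical
  by_cases hex : ∃ q : ℕ, 1 ≤ q ∧ q ≤ Q ∧ |q * θ - round (q * θ)| < ρ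
  · right
    obtain ⟨h1, h2, h3⟩ := Nat.find_spec hex
    have hmin := fun m => @Nat.find_min _ _ hex m
    set q := Nat.find hex with hq
    refine ⟨q, h1, h2, h3, fun D hD1 hD2 hD3 => ?_⟩
    have hq' : (1:ℝ) ≤ q := by exact_mod_cast h1
    have hQ' : (q:ℝ) ≤ Q := by exact_mod_cast h2
    have hD1' : (1:ℝ) ≤ D := by exact_mod_cast hD1
    have hD2' : (D:ℝ) ≤ Q := by exact_mod_cast hD2
    have hρ0 : 0 < ρ := lt_of_le_of_lt (abs_nonneg _) h3
    set a := round ((D:ℝ) * θ) with ha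
    set c := round ((q:ℝ) * θ) with hc
    have heq : (D:ℤ) * c = q * a := by
      have : |((D * c - q * a : ℤ):ℝ)| < 1 := by
        have e : ((D * c - q * a : ℤ):ℝ) = q * (D * θ - a) - D * (q * θ - c) := by push_cast; ring
        rw [e]
        calc _ ≤ |(q:ℝ) * (D * θ - a)| + |(D:ℝ) * (q * θ - c)| := abs_sub _ _
          _ = q * |D * θ - a| + D * |q * θ - c| := by
            rw [abs_mul, abs_mul, abs_of_nonneg (by linarith : (0:ℝ) ≤ q), abs_of_nonneg (by linarith : (0:ℝ) ≤ D)]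
          _ < q * ρ + D * ρ := by gcongr
          _ ≤ Q * ρ + Q * ρ := by gcongr
          _ ≤ 1 := by linarith
      have h5 : |(D * c - q * a : ℤ)| < 1 := by exact_mod_cast this
      have := Int.abs_lt_one_iff.1 h5
      omega
    have hcop : IsCoprime (q:ℤ) c := by
      rw [Int.isCoprime_iff_gcd_eq_one]
      by_contra hg
      set g := Int.gcd (q:ℤ) c with hgdef
      have hg0 : g ≠ 0 := by
        intro h0; have := (Int.gcd_eq_zero_iff.1 h0).1; omega
      obtain ⟨q1, hq1⟩ : g ∣ q := Int.natCast_dvd_natCast.1 (Int.gcd_dvd_left _ _)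
      obtain ⟨c1, hc1⟩ : (g:ℤ) ∣ c := Int.gcd_dvd_right _ _
      have hg2 : 2 ≤ g := by omega
      have hq10 : 1 ≤ q1 := by
        rcases Nat.eq_zero_or_pos q1 with h | h
        · rw [h] at hq1; omega
        · exact h
      have hlt : q1 < q := by rw [hq1]; nlinarith
      refine hmin q1 hlt ⟨hq10, by omega, ?_⟩
      refine lt_of_le_of_lt (round_le _ c1) ?_
      have hgR : (2:ℝ) ≤ g := by exact_mod_cast hg2
      have e : (g:ℝ) * (q1 * θ - c1) = q * θ - c := by
        have e1 : (q:ℝ) = g * q1 := by exact_mod_cast hq1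
        have e2 : (c:ℝ) = g * c1 := by exact_mod_cast hc1
        rw [e1, e2]; ring
      have e3 : (g:ℝ) * |q1 * θ - c1| < ρ := by
        rw [← abs_of_nonneg (by linarith : (0:ℝ) ≤ g), ← abs_mul, e]; exact h3
      nlinarith [abs_nonneg (q1 * θ - c1)]
    have h6 : (q:ℤ) ∣ D * c := ⟨a, heq⟩
    have h7 := hcop.dvd_of_dvd_mul_right h6
    exact Int.natCast_dvd_natCast.1 h7
  · left
    push Not at hex
    exact fun D h1 h2 => hex D h1 h2

end PSRoth

namespace PSRoth
open Finset Filter ComplexConjugate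

lemma card_LL_le (R z : ℕ) : (#(LL R z) : ℝ) ≤ R := by
  have : #(LL R z) ≤ #(Icc 1 R) := card_le_card (filter_subset _ _)
  rw [Nat.card_Icc] at this
  exact_mod_cast this

lemma lcm_pos {R z a b : ℕ} (ha : a ∈ LL R z) (hb : b ∈ LL R z) : 1 ≤ a.lcm b :=
  Nat.lcm_pos (mem_LL.1 ha).1.1 (mem_LL.1 hb).1.1

lemma lcm_le {R z a b : ℕ} (ha : a ∈ LL R z) (hb : b ∈ LL R z) : a.lcm b ≤ R ^ 2 := by
  have h1 := (mem_LL.1 ha).1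
  have h2 := (mem_LL.1 hb).1
  calc a.lcm b ≤ a * b := Nat.le_of_dvd (Nat.mul_pos h1.1 h2.1) (Nat.lcm_dvd_mul a b)
    _ ≤ R * R := Nat.mul_le_mul h1.2 h2.2
    _ = _ := by ring

lemma lcm_rough {R z a b p : ℕ} (ha : a ∈ LL R z) (hb : b ∈ LL R z) (hp : p.Prime) (h : p ∣ a.lcm b) : z < p := by
  have h1 := mem_LL.1 ha
  have h2 := mem_LL.1 hb
  rcases hp.dvd_mul.1 (h.trans (Nat.lcm_dvd_mul a b)) with h3 | h3
  · exact h1.2.2 p (Nat.mem_primeFactors.2 ⟨hp, h3, by omega⟩)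
  · exact h2.2.2 p (Nat.mem_primeFactors.2 ⟨hp, h3, by omega⟩)

/-- Sum over pairs of the sieve weights. -/
noncomputable def pairs (R z : ℕ) (g : ℕ → ℂ) : ℂ :=
  ∑ a ∈ LL R z, ∑ b ∈ LL R z, ((lam R z a * lam R z b : ℝ) : ℂ) * g (a.lcm b)

lemma pairs_norm {R z : ℕ} (hR : 1 ≤ R) (g : ℕ → ℂ) (B : ℕ → ℝ)
    (h : ∀ a ∈ LL R z, ∀ b ∈ LL R z, ‖g (a.lcm b)‖ ≤ B (a.lcm b)) :
    ‖pairs R z g‖ ≤ ∑ a ∈ LL R z, ∑ b ∈ LL R z, B (a.lcm b) := by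
  unfold pairs
  refine (norm_sum_le _ _).trans (sum_le_sum fun a ha => ?_)
  refine (norm_sum_le _ _).trans (sum_le_sum fun b hb => ?_)
  rw [norm_mul, Complex.norm_real, Real.norm_eq_abs, abs_mul]
  have h1 := abs_lam_le hR ha
  have h2 := abs_lam_le hR hb
  have h3 : |lam R z a| * |lam R z b| ≤ 1 * 1 := by gcongr
  calc _ ≤ 1 * ‖g (a.lcm b)‖ := by gcongr; linarith
    _ ≤ _ := by rw [one_mul]; exact h a ha b hb

lemma pairs_norm_const {R z : ℕ} (hR : 1 ≤ R) (g : ℕ → ℂ) (B : ℝ) (hB : 0 ≤ B)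
    (h : ∀ a ∈ LL R z, ∀ b ∈ LL R z, ‖g (a.lcm b)‖ ≤ B) : ‖pairs R z g‖ ≤ (R:ℝ) ^ 2 * B := by
  refine (pairs_norm hR g (fun _ => B) h).trans ?_
  simp only [sum_const, nsmul_eq_mul]
  have := card_LL_le R z
  calc (#(LL R z) : ℝ) * (#(LL R z) * B) ≤ R * (R * B) := by gcongr
    _ = _ := by ring

lemma VV_pos {R z : ℕ} (hR : 1 ≤ R) : 0 < VV R z := by
  have h := GG_ge_one (z := z) hR
  have := VV_ge (z := z) hR
  have h3 : 0 < (GG R z)⁻¹ ^ 2 := by positivity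
  linarith

lemma VV_inv_ge_one {R z : ℕ} (hR : 1 ≤ R) : 1 ≤ (VV R z)⁻¹ := by
  have h := GG_ge_one (z := z) hR
  have h1 := VV_le (z := z) hR
  rw [one_le_inv₀ (VV_pos hR)]
  exact h1.trans (inv_le_one_of_one_le₀ h)

lemma VV_inv_le {R z : ℕ} (hR : 1 ≤ R) : (VV R z)⁻¹ ≤ (1 + Real.log R) ^ 2 := by
  have h := GG_ge_one (z := z) hR
  have h1 := VV_ge (z := z) hR
  have h2 := GG_le R z
  calc (VV R z)⁻¹ ≤ ((GG R z)⁻¹ ^ 2)⁻¹ := by gcongr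
    _ = (GG R z) ^ 2 := by simp
    _ ≤ _ := by gcongr

lemma main_h0 {R z b W M : ℕ} (hR : 1 ≤ R) (hW : ∀ p, p.Prime → p ∣ W → p ≤ z) (ρ : ℝ) (hρ0 : 0 < ρ)
    (hρ : 2 * (R:ℝ) ^ 2 * ρ ≤ 1) (hz : 1 ≤ z) (θ : ℝ) :
    ‖(((VV R z)⁻¹ : ℝ) : ℂ) * pairs R z (fun D => TT b W M D θ) - TT b W M 1 θ‖ ≤
      (VV R z)⁻¹ * ((R:ℝ) ^ 2 * (2 / ρ + 2 + (M + R ^ 2) * (7 * ρ)) + M * (3 * (1 + Real.log R) ^ 3 / z)) := by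
  have hV := VV_pos (z := z) hR
  have hV1 := VV_inv_ge_one (z := z) hR
  have hR' : (1:ℝ) ≤ R := by exact_mod_cast hR
  have hz' : (1:ℝ) ≤ z := by exact_mod_cast hz
  have hlogR : 0 ≤ Real.log R := Real.log_natCast_nonneg _
  have hcop : ∀ a ∈ LL R z, ∀ c ∈ LL R z, Nat.Coprime W (a.lcm c) := by
    intro a ha c hc
    apply Nat.Coprime.symm
    apply Nat.coprime_of_dvd
    intro p hp h1 h2
    have := lcm_rough ha hc hp h1
    have := hW p hp h2
    omega
  by_cases hnear : |θ - round θ| < ρ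
  · have e : (((VV R z)⁻¹ : ℝ) : ℂ) * pairs R z (fun D => TT b W M D θ) - TT b W M 1 θ =
        (((VV R z)⁻¹ : ℝ) : ℂ) * pairs R z (fun D => TT b W M D θ - (((D:ℝ)⁻¹ : ℝ):ℂ) * TT b W M 1 θ) := by
      have e1 : pairs R z (fun D => TT b W M D θ - (((D:ℝ)⁻¹ : ℝ):ℂ) * TT b W M 1 θ) =
          pairs R z (fun D => TT b W M D θ) - ((VV R z : ℝ) : ℂ) * TT b W M 1 θ := by
        unfold pairs VV
        push_cast
        rw [sum_mul, ← sum_sub_distrib]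
        refine sum_congr rfl fun a _ => ?_
        rw [sum_mul, ← sum_sub_distrib]
        refine sum_congr rfl fun c _ => ?_
        ring
      rw [e1, mul_sub, ← mul_assoc, ← Complex.ofReal_mul, inv_mul_cancel₀ hV.ne', Complex.ofReal_one, one_mul]
    rw [e, norm_mul, Complex.norm_real, Real.norm_of_nonneg (by positivity)]
    gcongr
    have h1 := pairs_norm_const (z := z) hR (fun D => TT b W M D θ - (((D:ℝ)⁻¹ : ℝ):ℂ) * TT b W M 1 θ)
      (1 + (M + R ^ 2) * (7 * ρ)) (by positivity) (by
        intro a ha c hc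
        refine (TT_near (lcm_pos ha hc) (hcop a ha c hc) θ ρ hnear.le).trans ?_
        gcongr
        exact_mod_cast lcm_le ha hc)
    refine h1.trans ?_
    have h2 : 0 ≤ 2 / ρ := by positivity
    have h3 : 0 ≤ (M:ℝ) * (3 * (1 + Real.log R) ^ 3 / z) := by positivity
    have h4 : (R:ℝ) ^ 2 * (1 + (M + R ^ 2) * (7 * ρ)) ≤ (R:ℝ) ^ 2 * (2 / ρ + 2 + (M + R ^ 2) * (7 * ρ)) := by
      gcongr; linarith
    linarith
  · push Not at hnear
    have hT1 : ‖TT b W M 1 θ‖ ≤ 1 / ρ := TT_far le_rfl (by simp) θ ρ hρ0 (by simpa using hnear)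
    obtain ⟨p, hp, hpz, hbd⟩ : ∃ p : ℕ, p.Prime ∧ z ≤ p ∧ ∀ a ∈ LL R z, ∀ c ∈ LL R z,
        ‖TT b W M (a.lcm c) θ‖ ≤ 1 / ρ + 1 + M * (if p ∣ a.lcm c then ((a.lcm c : ℕ):ℝ)⁻¹ else 0) := by
      have hnn : ∀ (p D : ℕ), 0 ≤ (M:ℝ) * (if p ∣ D then ((D : ℕ):ℝ)⁻¹ else 0) := by
        intro p D
        split_ifs <;> positivity
      have hfar : ∀ a ∈ LL R z, ∀ c ∈ LL R z, ρ ≤ |((a.lcm c : ℕ):ℝ) * θ - round (((a.lcm c : ℕ):ℝ) * θ)| → ∀ p : ℕ,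
          ‖TT b W M (a.lcm c) θ‖ ≤ 1 / ρ + 1 + M * (if p ∣ a.lcm c then ((a.lcm c : ℕ):ℝ)⁻¹ else 0) := by
        intro a ha c hc h p
        have h1 := TT_far (b := b) (M := M) (lcm_pos ha hc) (hcop a ha c hc) θ ρ hρ0 h
        have h2 := hnn p (a.lcm c)
        linarith
      rcases near_common θ ρ (R ^ 2) (by push_cast; exact hρ) with h | ⟨q, hq1, hq2, hq3, hq4⟩
      · obtain ⟨p, hp1, hp2⟩ := Nat.exists_infinite_primes z
        exact ⟨p, hp2, hp1, fun a ha c hc => hfar a ha c hc (h _ (lcm_pos ha hc) (lcm_le ha hc)) p⟩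
      · have hqne : q ≠ 1 := by
          rintro rfl
          simp only [Nat.cast_one, one_mul] at hq3
          linarith
        by_cases hz2 : z < q.minFac
        · refine ⟨q.minFac, Nat.minFac_prime hqne, hz2.le, fun a ha c hc => ?_⟩
          by_cases hfa : ρ ≤ |((a.lcm c : ℕ):ℝ) * θ - round (((a.lcm c : ℕ):ℝ) * θ)|
          · exact hfar a ha c hc hfa _
          · push Not at hfa
            have h1 := hq4 _ (lcm_pos ha hc) (lcm_le ha hc) hfa
            rw [if_pos ((Nat.minFac_dvd q).trans h1)]
            have h2 := TT_triv (b := b) (M := M) (lcm_pos ha hc) (hcop a ha c hc) θ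
            rw [div_eq_mul_inv] at h2
            have h3 : 0 < 1 / ρ := by positivity
            linarith
        · obtain ⟨p, hp1, hp2⟩ := Nat.exists_infinite_primes z
          refine ⟨p, hp2, hp1, fun a ha c hc => ?_⟩
          apply hfar a ha c hc
          by_contra hcon
          push Not at hcon
          have h1 := hq4 _ (lcm_pos ha hc) (lcm_le ha hc) hcon
          exact hz2 (lcm_rough ha hc (Nat.minFac_prime hqne) ((Nat.minFac_dvd q).trans h1))
    have h1 := pairs_norm hR (fun D => TT b W M D θ)
      (fun D => 1 / ρ + 1 + M * (if p ∣ D then ((D : ℕ):ℝ)⁻¹ else 0)) hbd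
    have h2 : ∑ a ∈ LL R z, ∑ c ∈ LL R z, (1 / ρ + 1 + M * (if p ∣ a.lcm c then ((a.lcm c : ℕ):ℝ)⁻¹ else 0)) ≤
        (R:ℝ) ^ 2 * (1 / ρ + 1) + M * (3 * (1 + Real.log R) ^ 3 / z) := by
      simp only [sum_add_distrib, sum_const, nsmul_eq_mul, ← mul_sum]
      have hc := card_LL_le R z
      have h3 : ∑ a ∈ LL R z, ∑ c ∈ LL R z, (if p ∣ a.lcm c then ((a.lcm c : ℕ):ℝ)⁻¹ else 0) ≤
          3 * (1 + Real.log R) ^ 3 / z := by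
        have hnn : ∀ a c : ℕ, (0:ℝ) ≤ (if p ∣ a.lcm c then ((a.lcm c : ℕ):ℝ)⁻¹ else 0) := by
          intro a c; split_ifs <;> positivity
        have hsub : LL R z ⊆ Icc 1 R := filter_subset _ _
        calc _ ≤ ∑ a ∈ Icc 1 R, ∑ c ∈ Icc 1 R, (if p ∣ a.lcm c then ((a.lcm c : ℕ):ℝ)⁻¹ else 0) := by
              refine (sum_le_sum_of_subset_of_nonneg hsub (fun a _ _ => sum_nonneg fun c _ => hnn a c)).trans ?_
              exact sum_le_sum fun a _ => sum_le_sum_of_subset_of_nonneg hsub (fun c _ _ => hnn a c)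
          _ ≤ 3 * (1 + Real.log R) ^ 3 / p := pair_sum hp
          _ ≤ _ := by gcongr
      have e : (#(LL R z) : ℝ) * (#(LL R z) * (1 / ρ)) + #(LL R z) * (#(LL R z) * 1) = #(LL R z) * (#(LL R z) * (1/ρ + 1)) := by ring
      rw [e]
      calc _ ≤ (R:ℝ) * (R * (1 / ρ + 1)) + M * (3 * (1 + Real.log R) ^ 3 / z) := by gcongr
        _ = _ := by ring
    refine (norm_sub_le _ _).trans ?_
    rw [norm_mul, Complex.norm_real, Real.norm_of_nonneg (by positivity)]
    have h4 : 1 / ρ ≤ (VV R z)⁻¹ * ((R:ℝ) ^ 2 * (1 / ρ)) := by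
      have h5 : 1 ≤ (R:ℝ) ^ 2 := one_le_pow₀ hR'
      have h6 : 0 < 1 / ρ := by positivity
      calc 1 / ρ = 1 * (1 * (1 / ρ)) := by ring
        _ ≤ _ := by gcongr
    calc _ ≤ (VV R z)⁻¹ * ((R:ℝ) ^ 2 * (1 / ρ + 1) + M * (3 * (1 + Real.log R) ^ 3 / z)) +
          (VV R z)⁻¹ * ((R:ℝ) ^ 2 * (1 / ρ)) := by
          have h7 := hT1.trans h4
          have h8 := h1.trans h2
          gcongr
      _ = (VV R z)⁻¹ * ((R:ℝ) ^ 2 * (2 / ρ + 1) + M * (3 * (1 + Real.log R) ^ 3 / z)) := by ring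
      _ ≤ _ := by
          have h9 : 0 ≤ ((M:ℝ) + R ^ 2) * (7 * ρ) := by positivity
          gcongr ?_ * (?_ * ?_ + ?_)
          · linarith
          · exact le_rfl

end PSRoth

namespace PSRoth
open Finset Filter ComplexConjugate

/-- Fejer kernel -/
noncomputable def fej (H : ℕ) (x : ℝ) : ℝ := ‖∑ j ∈ range H, ee (j * x)‖ ^ 2 / H

lemma fej_nonneg (H : ℕ) (x : ℝ) : 0 ≤ fej H x := by unfold fej; positivity

lemma fej_expand (H : ℕ) (x : ℝ) : ((fej H x : ℝ) : ℂ) =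
    ((H:ℂ))⁻¹ * ∑ j ∈ range H, ∑ k ∈ range H, ee (((j:ℝ) - k) * x) := by
  unfold fej
  push_cast
  have h1 : ((‖∑ j ∈ range H, ee (j * x)‖ : ℂ)) ^ 2 =
      (∑ j ∈ range H, ee (j * x)) * conj (∑ j ∈ range H, ee (j * x)) := by
    rw [Complex.mul_conj, Complex.normSq_eq_norm_sq]; push_cast; ring
  rw [h1, map_sum, sum_mul_sum, div_eq_mul_inv, mul_comm]
  congr 1
  refine sum_congr rfl fun j _ => sum_congr rfl fun k _ => ?_
  rw [← ee_sub]; congr 1; ring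

lemma fej_lower (H : ℕ) (hH : 1 ≤ H) (x : ℝ) (m : ℤ) (h : |x - m| ≤ 1 / (6 * H)) : (H:ℝ) / 4 ≤ fej H x := by
  have hH' : (1:ℝ) ≤ H := by exact_mod_cast hH
  have h1 : ∀ j ∈ range H, (1:ℝ) / 2 ≤ (ee (j * x)).re := by
    intro j hj
    have hj' : (j:ℝ) ≤ H := by exact_mod_cast (mem_range.1 hj).le
    have e : ee (j * x) = ee (j * (x - m)) := by
      rw [show (j:ℝ) * x = j * (x - m) + ((j * m : ℤ):ℝ) by push_cast; ring, ee_add_int]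
    rw [e, ee_re, ← Real.cos_abs, ← Real.cos_pi_div_three]
    apply Real.cos_le_cos_of_nonneg_of_le_pi (abs_nonneg _) (by linarith [Real.pi_pos])
    rw [abs_mul, abs_of_pos (by positivity : (0:ℝ) < 2 * Real.pi), abs_mul, Nat.abs_cast]
    calc 2 * Real.pi * (j * |x - m|) ≤ 2 * Real.pi * (H * (1 / (6 * H))) := by gcongr
      _ = _ := by field_simp; norm_num
  have h2 : (H:ℝ) / 2 ≤ ‖∑ j ∈ range H, ee (j * x)‖ := by
    refine le_trans ?_ (Complex.re_le_norm _)
    rw [Complex.re_sum]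
    calc (H:ℝ) / 2 = ∑ j ∈ range H, (1:ℝ)/2 := by simp; ring
      _ ≤ _ := sum_le_sum h1
  unfold fej
  rw [le_div_iff₀ (by linarith)]
  calc (H:ℝ) / 4 * H = (H / 2) ^ 2 := by ring
    _ ≤ _ := by gcongr

lemma fej_sum (γ : ℝ) (h0 : 71/72 < γ) (h1 : γ < 1) : ∃ C > 0, ∀ (X : ℝ) (b W M D H : ℕ) (θ : ℝ),
    1 ≤ X → 1 ≤ W → 1 ≤ D → Nat.Coprime W D → 1 ≤ H → (H:ℝ) ≤ X ^ (1/72:ℝ) → X ≤ b →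
    (b:ℝ) + W * (M + 2 * D) ≤ 5 * X →
    ‖∑ t ∈ filt b W M D, (((fej H (((b + W * t : ℕ):ℝ) ^ γ) - 1 : ℝ)) : ℂ) * ee (t * θ)‖ ≤ H * (C * X ^ (0.51:ℝ)) := by
  obtain ⟨C, hC, hexp⟩ := expsum_bound h0 h1
  refine ⟨C, hC, fun X b W M D H θ hX hW hD hc hH hHX hb hbd => ?_⟩
  obtain ⟨t0, k, ht0, hf, hk, _, _⟩ := filt_eq b W M D hD hc
  have hH' : (1:ℝ) ≤ H := by exact_mod_cast hH
  have hHC : (H:ℂ) ≠ 0 := by exact_mod_cast (by omega : H ≠ 0)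
  have hXp : 0 ≤ C * X ^ (0.51:ℝ) := by positivity
  -- expand
  have e1 : ∀ t : ℕ, (((fej H (((b + W * t : ℕ):ℝ) ^ γ) - 1 : ℝ)) : ℂ) * ee (t * θ) =
      (H:ℂ)⁻¹ * ∑ j ∈ range H, ∑ l ∈ range H, (if j = l then 0 else
        ee (((j:ℝ) - l) * ((b + W * t : ℕ):ℝ) ^ γ + t * θ)) := by
    intro t
    have e2 : ∀ j ∈ range H, ∑ l ∈ range H, (if j = l then (0:ℂ) else
        ee (((j:ℝ) - l) * ((b + W * t : ℕ):ℝ) ^ γ + t * θ)) =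
        (∑ l ∈ range H, ee (((j:ℝ) - l) * ((b + W * t : ℕ):ℝ) ^ γ)) * ee (t * θ) - ee (t * θ) := by
      intro j hj
      have e3 : ∀ l ∈ range H, (if j = l then (0:ℂ) else
        ee (((j:ℝ) - l) * ((b + W * t : ℕ):ℝ) ^ γ + t * θ)) =
        ee (((j:ℝ) - l) * ((b + W * t : ℕ):ℝ) ^ γ) * ee (t * θ) - if j = l then ee (t * θ) else 0 := by
        intro l _
        split_ifs with h
        · subst h; simp [ee_zero]
        · rw [ee_add]; simp
      rw [sum_congr rfl e3, sum_sub_distrib, ← sum_mul, sum_ite_eq, if_pos hj]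
    rw [sum_congr rfl e2, sum_sub_distrib, ← sum_mul, sum_const, card_range, nsmul_eq_mul]
    push_cast
    rw [fej_expand, mul_sub, ← mul_assoc, ← mul_assoc, inv_mul_cancel₀ hHC]
    push_cast
    ring
  rw [sum_congr rfl fun t _ => e1 t, ← mul_sum, sum_comm]
  rw [norm_mul, norm_inv, Complex.norm_natCast]
  have e4 : ∀ j ∈ range H, ‖∑ t ∈ filt b W M D, ∑ l ∈ range H, (if j = l then (0:ℂ) else
        ee (((j:ℝ) - l) * ((b + W * t : ℕ):ℝ) ^ γ + t * θ))‖ ≤ H * (C * X ^ (0.51:ℝ)) := by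
    intro j hj
    rw [sum_comm]
    refine (norm_sum_le _ _).trans ?_
    calc _ ≤ ∑ l ∈ range H, C * X ^ (0.51:ℝ) := by
          refine sum_le_sum fun l hl => ?_
          by_cases hjl : j = l
          · simp only [if_pos hjl, sum_const_zero, norm_zero]; exact hXp
          · simp only [if_neg hjl]
            rw [filt_sum hD hf]
            have e5 : ∀ i ∈ range k, ee (((j:ℝ) - l) * ((b + W * (t0 + D * i) : ℕ):ℝ) ^ γ + ((t0 + D * i : ℕ):ℝ) * θ) =
                ee (t0 * θ) * ee ((D * θ) * i + ((j:ℝ) - l) * (((b + W * t0) + (W * D) * i : ℕ):ℝ) ^ γ) := by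
              intro i _
              rw [← ee_add, show b + W * (t0 + D * i) = (b + W * t0) + (W * D) * i by ring]
              congr 1; push_cast; ring
            rw [sum_congr rfl e5, ← mul_sum, norm_mul, norm_ee, one_mul]
            have hjH : (j:ℝ) < H := by exact_mod_cast mem_range.1 hj
            have hlH : (l:ℝ) < H := by exact_mod_cast mem_range.1 hl
            have hj0 : (0:ℝ) ≤ j := by positivity
            have hl0 : (0:ℝ) ≤ l := by positivity
            have hWR : (0:ℝ) ≤ W := by positivity
            refine hexp X (D * θ) ((j:ℝ) - l) (b + W * t0) (W * D) k hX ?_ ?_ ?_ ?_ ?_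
            · exact Nat.mul_pos hW hD
            · push_cast
              have : 0 ≤ (W:ℝ) * t0 := by positivity
              linarith
            · push_cast
              have h3 : (D:ℝ) * k ≤ M + D := by exact_mod_cast hk
              have h4 : (t0:ℝ) ≤ D := by exact_mod_cast ht0.le
              calc (b:ℝ) + W * t0 + W * D * k = b + W * (t0 + D * k) := by ring
                _ ≤ b + W * (M + 2 * D) := by
                  have h5 : (t0:ℝ) + D * k ≤ M + 2 * D := by linarith
                  have h6 := mul_le_mul_of_nonneg_left h5 hWR
                  linarith
                _ ≤ _ := hbd
            · have h5 : (j:ℤ) - l ≠ 0 := by omega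
              have h6 := Int.one_le_abs h5
              exact_mod_cast h6
            · refine le_trans ?_ hHX
              rw [abs_le]; constructor <;> linarith
      _ = _ := by simp
  calc (H:ℝ)⁻¹ * _ ≤ (H:ℝ)⁻¹ * ∑ j ∈ range H, H * (C * X ^ (0.51:ℝ)) := by
        gcongr
        exact (norm_sum_le _ _).trans (sum_le_sum e4)
    _ = _ := by simp; field_simp

/-- Sieve weight -/
noncomputable def SS (R z n : ℕ) : ℝ := (∑ d ∈ (LL R z).filter (· ∣ n), lam R z d) ^ 2

lemma SS_eq (R z n : ℕ) : ((SS R z n : ℝ) : ℂ) = pairs R z (fun D => if D ∣ n then 1 else 0) := by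
  unfold SS pairs
  rw [sq, sum_mul_sum]
  push_cast
  rw [sum_filter]
  refine sum_congr rfl fun a _ => ?_
  split_ifs with ha
  · rw [sum_filter]
    refine sum_congr rfl fun c _ => ?_
    by_cases hc : c ∣ n
    · rw [if_pos hc, if_pos (Nat.lcm_dvd ha hc), mul_one]
    · rw [if_neg hc, if_neg (fun h => hc ((Nat.dvd_lcm_right a c).trans h)), mul_zero]
  · symm
    refine sum_eq_zero fun c _ => ?_
    rw [if_neg (fun h => ha ((Nat.dvd_lcm_left a c).trans h)), mul_zero]

lemma SS_nonneg (R z n : ℕ) : 0 ≤ SS R z n := by unfold SS; positivity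

lemma SS_prime {R z p : ℕ} (hR : 1 ≤ R) (hp : p.Prime) (h : R < p) : SS R z p = 1 := by
  unfold SS
  have : (LL R z).filter (· ∣ p) = {1} := by
    ext d
    rw [mem_filter, mem_singleton]
    constructor
    · rintro ⟨h1, h2⟩
      rcases (Nat.dvd_prime hp).1 h2 with h3 | h3
      · exact h3
      · have := (mem_LL.1 h1).1.2; omega
    · rintro rfl; exact ⟨one_mem_LL hR, one_dvd _⟩
  rw [this, sum_singleton, lam_one hR]; norm_num

noncomputable def nu (γ : ℝ) (R z H b W t : ℕ) : ℝ :=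
  (VV R z)⁻¹ * SS R z (b + W * t) * fej H (((b + W * t : ℕ):ℝ) ^ γ)

lemma pairs_add (R z : ℕ) (g h : ℕ → ℂ) : pairs R z (fun D => g D + h D) = pairs R z g + pairs R z h := by
  unfold pairs
  rw [← sum_add_distrib]
  refine sum_congr rfl fun a _ => ?_
  rw [← sum_add_distrib]
  exact sum_congr rfl fun c _ => by ring

lemma pairs_swap (R z M : ℕ) (b W : ℕ) (u : ℕ → ℂ) :
    ∑ t ∈ range M, pairs R z (fun D => if D ∣ b + W * t then 1 else 0) * u t =
      pairs R z (fun D => ∑ t ∈ filt b W M D, u t) := by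
  unfold pairs
  simp only [sum_mul]
  rw [sum_comm]
  refine sum_congr rfl fun a _ => ?_
  rw [sum_comm]
  refine sum_congr rfl fun c _ => ?_
  unfold filt
  rw [sum_filter, mul_sum]
  refine sum_congr rfl fun t _ => ?_
  split_ifs <;> ring

lemma nu_fourier (γ : ℝ) (h0 : 71/72 < γ) (h1 : γ < 1) : ∃ C > 0, ∀ (X : ℝ) (b W M H R z : ℕ) (θ ρ : ℝ),
    1 ≤ X → 1 ≤ W → 1 ≤ H → (H:ℝ) ≤ X ^ (1/72:ℝ) → X ≤ b →
    (b:ℝ) + W * (M + 2 * (R:ℝ) ^ 2) ≤ 5 * X → 1 ≤ R → 1 ≤ z → (∀ p, p.Prime → p ∣ W → p ≤ z) →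
    0 < ρ → 2 * (R:ℝ) ^ 2 * ρ ≤ 1 →
    ‖∑ t ∈ range M, ((nu γ R z H b W t - 1 : ℝ) : ℂ) * ee (t * θ)‖ ≤
      (VV R z)⁻¹ * ((R:ℝ) ^ 2 * (2 / ρ + 2 + (M + R ^ 2) * (7 * ρ)) + M * (3 * (1 + Real.log R) ^ 3 / z)) +
      (VV R z)⁻¹ * ((R:ℝ) ^ 2 * (H * (C * X ^ (0.51:ℝ)))) := by
  obtain ⟨C, hC, hfej⟩ := fej_sum γ h0 h1
  refine ⟨C, hC, fun X b W M H R z θ ρ hX hW hH hHX hb hbd hR hz hWz hρ0 hρ => ?_⟩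
  have hV := VV_pos (z := z) hR
  have hm := main_h0 (b := b) (M := M) hR hWz ρ hρ0 hρ hz θ
  have e : ∑ t ∈ range M, ((nu γ R z H b W t - 1 : ℝ) : ℂ) * ee (t * θ) =
      ((((VV R z)⁻¹ : ℝ) : ℂ) * pairs R z (fun D => TT b W M D θ) - TT b W M 1 θ) +
      (((VV R z)⁻¹ : ℝ) : ℂ) * pairs R z (fun D => ∑ t ∈ filt b W M D,
        (((fej H (((b + W * t : ℕ):ℝ) ^ γ) - 1 : ℝ)) : ℂ) * ee (t * θ)) := by
    have e1 : ∀ t ∈ range M, ((nu γ R z H b W t - 1 : ℝ) : ℂ) * ee (t * θ) =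
        (((VV R z)⁻¹ : ℝ) : ℂ) * (pairs R z (fun D => if D ∣ b + W * t then 1 else 0) *
          ((fej H (((b + W * t : ℕ):ℝ) ^ γ) : ℂ) * ee (t * θ))) - ee (t * θ) := by
      intro t _
      unfold nu
      rw [← SS_eq]
      push_cast; ring
    rw [sum_congr rfl e1, sum_sub_distrib, ← mul_sum, pairs_swap, ← TT_one b W]
    rw [sub_add_eq_add_sub, ← mul_add, ← pairs_add]
    congr 3
    funext D
    unfold TT
    rw [← sum_add_distrib]
    refine sum_congr rfl fun t _ => ?_
    push_cast; ring
  rw [e]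
  refine (norm_add_le _ _).trans (add_le_add hm ?_)
  rw [norm_mul, Complex.norm_real, Real.norm_of_nonneg (by positivity)]
  gcongr
  refine pairs_norm_const hR _ _ (by positivity) ?_
  intro a ha c hc
  have hcop : Nat.Coprime W (a.lcm c) := by
    apply Nat.Coprime.symm
    apply Nat.coprime_of_dvd
    intro p hp h1 h2
    have := lcm_rough ha hc hp h1
    have := hWz p hp h2
    omega
  refine hfej X b W M (a.lcm c) H θ hX hW (lcm_pos ha hc) hcop hH hHX hb ?_
  refine le_trans ?_ hbd
  have : ((a.lcm c : ℕ):ℝ) ≤ (R:ℝ) ^ 2 := by exact_mod_cast lcm_le ha hc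
  gcongr

end PSRoth

namespace PSRoth
open Finset Filter ComplexConjugate

lemma regimes {n : ℕ} [Fact n.Prime] (f ν ν2 : ZMod n → ℝ) (G B η η2 δ1 δ2 : ℝ)
    (hf : ∀ x, 0 ≤ f x) (hfν : ∀ x, f x ≤ ν x) (hfν2 : ∀ x, f x ≤ G * ν2 x)
    (hν : ∀ r, ‖ft (fun x => ν x - 1) r‖ ≤ η * n) (hν2 : ∀ r, ‖ft (fun x => ν2 x - 1) r‖ ≤ η2 * n)
    (hfs : ∑ x, f x ≤ 2 * n) (hG : 0 ≤ G) (hB : ∑ x, f x ^ 2 ≤ B * n)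
    (h1 : 4 * η ≤ δ1 ^ 2) (h2 : 4 * G * η2 ≤ δ2 ^ 2) (hδ2 : 0 < δ2) (h21 : δ2 ≤ δ1)
    (δ : ℝ) (hδ : δ1 ≤ δ) :
    (#(univ.filter fun r => δ ≤ FF f r) : ℝ) ≤ 4 / δ ^ 2 ∧
      ∑ r ∈ univ.filter (fun r => FF f r < δ), FF f r ^ 3 ≤ 32 * δ + 32 * G * δ1 + δ2 * B := by
  have hn : (0:ℝ) < n := by exact_mod_cast (Fact.out : n.Prime).pos
  have hδ1 : 0 < δ1 := by linarith
  have r1 : ∀ δ, δ1 ≤ δ → (#(univ.filter fun r => δ ≤ FF f r) : ℝ) ≤ 4 / δ ^ 2 := by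
    intro δ hδ
    have := restriction f ν 1 η δ hf (by simpa using hfν) zero_le_one hν hfs (by linarith)
      (by have : δ1 ^ 2 ≤ δ ^ 2 := by gcongr
          linarith)
    rw [mul_one] at this
    convert this; rfl
  have r2 : ∀ δ, δ2 ≤ δ → (#(univ.filter fun r => δ ≤ FF f r) : ℝ) ≤ 4 * G / δ ^ 2 := by
    intro δ hδ
    have := restriction f ν2 G η2 δ hf hfν2 hG hν2 hfs (by linarith)
      (by have : δ2 ^ 2 ≤ δ ^ 2 := by gcongr
          linarith)
    convert this; rfl
  refine ⟨r1 δ hδ, ?_⟩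
  have hj : ∀ a b : ℝ, 0 < a → ∃ j : ℕ, b ≤ 2 ^ j * a := by
    intro a b ha
    obtain ⟨j, hj⟩ := pow_unbounded_of_one_lt (b / a) (one_lt_two)
    exact ⟨j, ((div_lt_iff₀ ha).1 hj).le⟩
  obtain ⟨j1, hj1⟩ := hj δ1 δ hδ1
  obtain ⟨j2, hj2⟩ := hj δ2 δ1 hδ2
  have d1 := dyadic univ (FF f) (fun r _ => FF_nonneg f r) 4 δ1 hδ1 (by norm_num) j1 δ hδ hj1
    (fun d hd _ => r1 d hd)
  have d2 := dyadic univ (FF f) (fun r _ => FF_nonneg f r) (4 * G) δ2 hδ2 (by positivity) j2 δ1 h21 hj2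
    (fun d hd _ => r2 d hd)
  have d3 : ∑ r ∈ univ.filter (fun r => FF f r < δ2), FF f r ^ 3 ≤ δ2 * B := by
    calc ∑ r ∈ univ.filter (fun r => FF f r < δ2), FF f r ^ 3
        ≤ ∑ r ∈ univ.filter (fun r => FF f r < δ2), δ2 * FF f r ^ 2 := by
          refine sum_le_sum fun r hr => ?_
          have := (mem_filter.1 hr).2
          have h0 := FF_nonneg f r
          rw [pow_succ, mul_comm]
          gcongr
      _ ≤ ∑ r, δ2 * FF f r ^ 2 := by
          apply sum_le_sum_of_subset_of_nonneg (filter_subset _ _)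
          intro r _ _; positivity
      _ = δ2 * ((∑ x, f x ^ 2) / n) := by
          rw [← mul_sum]
          congr 1
          unfold FF
          simp_rw [div_pow]
          rw [← sum_div, parseval]
          field_simp
      _ ≤ δ2 * B := by
          gcongr
          rw [div_le_iff₀ hn]; exact hB
  have hsplit : ∑ r ∈ univ.filter (fun r => FF f r < δ), FF f r ^ 3 ≤
      ∑ r ∈ univ.filter (fun r => δ1 ≤ FF f r ∧ FF f r < δ), FF f r ^ 3 +
      ∑ r ∈ univ.filter (fun r => δ2 ≤ FF f r ∧ FF f r < δ1), FF f r ^ 3 +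
      ∑ r ∈ univ.filter (fun r => FF f r < δ2), FF f r ^ 3 := by
    simp only [sum_filter]
    rw [← sum_add_distrib, ← sum_add_distrib]
    refine sum_le_sum fun r _ => ?_
    have h0 : 0 ≤ FF f r ^ 3 := by have := FF_nonneg f r; positivity
    split_ifs <;> first | linarith | (exfalso; grind)
  linarith

theorem transf2 (α : ℝ) (hα : 0 < α) :
    ∃ c > 0, ∃ κ > 0, ∃ n0 : ℕ, ∀ (n : ℕ) [Fact n.Prime], n0 ≤ n → ∀ f ν ν2 : ZMod n → ℝ, ∀ G B η η2 : ℝ,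
      (∀ x, 0 ≤ f x) → (∀ x, f x ≤ ν x) → (∀ x, f x ≤ G * ν2 x) → α * n ≤ ∑ x, f x →
      (∀ r, ‖ft (fun x => ν x - 1) r‖ ≤ η * n) → (∀ r, ‖ft (fun x => ν2 x - 1) r‖ ≤ η2 * n) →
      1 ≤ G → 32 * G ≤ B → ∑ x, f x ^ 2 ≤ B * n → η * G ^ 2 ≤ κ → η2 * G * B ^ 2 ≤ κ →
      c * (n:ℝ) ^ 2 ≤ tf f := by
  obtain ⟨c, hc, δ0, hδ0, η0, hη0, n0, hT⟩ := transference α 34 hα (by norm_num)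
  set κ := min (min 1 η0) (δ0 ^ 2 / 4096) with hκ
  have hκp : 0 < κ := by positivity
  have k1 : κ ≤ 1 := (min_le_left _ _).trans (min_le_left _ _)
  have k2 : κ ≤ η0 := (min_le_left _ _).trans (min_le_right _ _)
  have k3 : κ ≤ δ0 ^ 2 / 4096 := min_le_right _ _
  clear_value κ
  refine ⟨c, hc, κ, hκp, n0, ?_⟩
  intro n _ hn f ν ν2 G B η η2 hf hfν hfν2 hfα hν hν2 hG hGB hB hη hη2
  have hn : (0:ℝ) < n := by exact_mod_cast (Fact.out : n.Prime).pos
  have hη0' : 0 ≤ η := by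
    have := (norm_nonneg _).trans (hν 0)
    exact nonneg_of_mul_nonneg_left this hn
  have hη1 : η ≤ κ := by nlinarith [one_le_pow₀ hG (n := 2)]
  have hfs : ∑ x, f x ≤ 2 * n := by
    have h := hν 0
    have e : ft (fun x => ν x - 1) 0 = ((∑ x, ν x - n : ℝ) : ℂ) := by
      unfold ft
      simp [ch_zero]
    rw [e, Complex.norm_real, Real.norm_eq_abs] at h
    have h2 := (le_abs_self _).trans h
    have h3 : ∑ x, f x ≤ ∑ x, ν x := sum_le_sum fun x _ => hfν x
    nlinarith
  refine hT n (by assumption) f ν hf hfν hfα (fun r => (hν r).trans (by gcongr; linarith)) ?_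
  intro δ hδ _
  have hB0 : 0 < B := by linarith
  have h32 : δ0 / B ≤ δ0 / (32 * G) := by gcongr
  obtain ⟨a1, a2⟩ := regimes f ν ν2 G B η η2 (δ0 / (32 * G)) (δ0 / B) hf hfν hfν2 hν hν2 hfs (by linarith) hB
    (by rw [div_pow, le_div_iff₀ (by positivity)]; nlinarith) (by rw [div_pow, le_div_iff₀ (by positivity)]; nlinarith [sq_nonneg δ0])
    (by positivity) h32 δ (by
      refine le_trans ?_ hδ
      rw [div_le_iff₀ (by positivity)]
      nlinarith)
  have hδp : 0 < δ := by linarith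
  constructor
  · refine a1.trans ?_
    gcongr; norm_num
  · refine a2.trans ?_
    have e1 : 32 * G * (δ0 / (32 * G)) = δ0 := by field_simp
    have e2 : δ0 / B * B = δ0 := by field_simp
    rw [e1, e2]; linarith

/-- extension of a function on `[0,M)` to `ZMod n` -/
noncomputable def ext {n : ℕ} (M : ℕ) (u : ℝ) (g : ℕ → ℝ) (x : ZMod n) : ℝ := if x.val < M then g x.val else u

lemma ext_sum {n : ℕ} [Fact n.Prime] {M : ℕ} (hM : M ≤ n) (F : ZMod n → ℕ → ℂ) (hF : ∀ x k, M ≤ k → F x k = 0) :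
    ∑ x : ZMod n, F x x.val = ∑ t ∈ range M, F (t : ZMod n) t := by
  have h1 : ∑ x : ZMod n, F x x.val = ∑ t ∈ range n, F (t : ZMod n) t := by
    refine sum_bij (fun x _ => x.val) (fun x _ => mem_range.2 (ZMod.val_lt x)) (fun x _ y _ h => ZMod.val_injective n h)
      (fun t ht => ⟨(t : ZMod n), mem_univ _, ZMod.val_natCast_of_lt (mem_range.1 ht)⟩) ?_
    intro x _
    simp
  rw [h1]
  symm
  apply sum_subset (range_mono hM)
  intro t _ ht
  exact hF _ _ (by simpa using ht)

lemma ext_ft {n : ℕ} [Fact n.Prime] {M : ℕ} (hM : M ≤ n) (g : ℕ → ℝ) (r : ZMod n) :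
    ft (fun x => ext M 1 g x - 1) r = ∑ t ∈ range M, ((g t - 1 : ℝ) : ℂ) * ee (t * ((r.val : ℝ) / n)) := by
  unfold ft
  have := ext_sum hM (fun x k => (((if k < M then g k else 1) - 1 : ℝ) : ℂ) * ch (r * x)) (by
    intro x k hk; simp [not_lt.2 hk])
  unfold ext
  rw [this]
  refine sum_congr rfl fun t ht => ?_
  rw [if_pos (mem_range.1 ht)]
  congr 1
  have : r * (t : ZMod n) = ((t * r.val : ℕ) : ZMod n) := by push_cast; rw [ZMod.natCast_zmod_val]; ring
  rw [this, ch_natCast]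
  congr 1; push_cast; ring

lemma ext_sum_real {n : ℕ} [Fact n.Prime] {M : ℕ} (hM : M ≤ n) (g : ℕ → ℝ) (k : ℕ) (hk : k ≠ 0) :
    ∑ x : ZMod n, ext M 0 g x ^ k = ∑ t ∈ range M, g t ^ k := by
  have := ext_sum (n := n) hM (fun x k' => (((if k' < M then g k' else 0) ^ k : ℝ) : ℂ)) (by
    intro x k' hk'; simp [not_lt.2 hk', hk])
  unfold ext
  rw [← Complex.ofReal_sum, ← Complex.ofReal_sum] at this
  have h2 := Complex.ofReal_injective this
  rw [h2]
  refine sum_congr rfl fun t ht => ?_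
  rw [if_pos (mem_range.1 ht)]

theorem transf3 (α : ℝ) (hα : 0 < α) :
    ∃ κ > 0, ∃ M0 : ℕ, ∀ M : ℕ, M0 ≤ M → ∀ f ν ν2 : ℕ → ℝ, ∀ G Q η η2 : ℝ,
      (∀ t < M, 0 ≤ f t) → (∀ t < M, f t ≤ ν t) → (∀ t < M, f t ≤ G * ν2 t) → (∀ t < M, f t ≤ Q) →
      α * M ≤ ∑ t ∈ range M, f t →
      (∀ θ : ℝ, ‖∑ t ∈ range M, ((ν t - 1 : ℝ) : ℂ) * ee (t * θ)‖ ≤ η * M) →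
      (∀ θ : ℝ, ‖∑ t ∈ range M, ((ν2 t - 1 : ℝ) : ℂ) * ee (t * θ)‖ ≤ η2 * M) →
      1 ≤ G → 32 * G ≤ Q ^ 2 → η * G ^ 2 ≤ κ → η2 * G * Q ^ 4 ≤ κ → Q ^ 3 ≤ κ * M →
      ∃ a d : ℕ, d ≠ 0 ∧ a + 2 * d < M ∧ f a ≠ 0 ∧ f (a + d) ≠ 0 ∧ f (a + 2 * d) ≠ 0 := by
  obtain ⟨c, hc, κ, hκ, n0, hT⟩ := transf2 (α / 4) (by positivity)
  refine ⟨min κ c, by positivity, max n0 1, ?_⟩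
  intro M hM f ν ν2 G Q η η2 hf hfν hfν2 hfQ hfα hν hν2 hG hGQ hη hη2 hQ
  have hM1 : 1 ≤ M := (le_max_right _ _).trans hM
  have hMn0 : n0 ≤ M := (le_max_left _ _).trans hM
  obtain ⟨n, hnp, hn1, hn2⟩ := Nat.exists_prime_lt_and_le_two_mul (2 * M) (by omega)
  have : Fact n.Prime := ⟨hnp⟩
  have hMn : M ≤ n := by omega
  have hMR : (1:ℝ) ≤ M := by exact_mod_cast hM1
  have hnR1 : (2:ℝ) * M < n := by exact_mod_cast hn1
  have hnR2 : (n:ℝ) ≤ 4 * M := by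
    have : n ≤ 4 * M := by omega
    exact_mod_cast this
  have hη0 : 0 ≤ η := nonneg_of_mul_nonneg_left ((norm_nonneg _).trans (hν 0)) (by linarith)
  have hη20 : 0 ≤ η2 := nonneg_of_mul_nonneg_left ((norm_nonneg _).trans (hν2 0)) (by linarith)
  have hQ0 : 0 ≤ Q := (hf 0 (by omega)).trans (hfQ 0 (by omega))
  have hmain := hT n (by omega) (ext M 0 f) (ext M 1 ν) (ext M 1 ν2) G (Q ^ 2) η η2 ?_ ?_ ?_ ?_ ?_ ?_ hG hGQ ?_
    (hη.trans (min_le_left _ _)) ?_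
  rotate_left
  · intro x; unfold ext; split_ifs with h
    · exact hf _ h
    · exact le_rfl
  · intro x; unfold ext; split_ifs with h
    · exact hfν _ h
    · exact zero_le_one
  · intro x; unfold ext; split_ifs with h
    · exact hfν2 _ h
    · linarith
  · have := ext_sum_real (n := n) hMn f 1 one_ne_zero
    simp only [pow_one] at this
    rw [this]
    refine le_trans ?_ hfα
    nlinarith
  · intro r; rw [ext_ft hMn]
    refine (hν _).trans ?_
    gcongr
  · intro r; rw [ext_ft hMn]
    refine (hν2 _).trans ?_
    gcongr
  · rw [ext_sum_real hMn f 2 two_ne_zero]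
    calc ∑ t ∈ range M, f t ^ 2 ≤ ∑ t ∈ range M, Q ^ 2 := by
          refine sum_le_sum fun t ht => ?_
          have h1 := hf t (mem_range.1 ht)
          have h2 := hfQ t (mem_range.1 ht)
          gcongr
      _ = M * Q ^ 2 := by simp
      _ ≤ Q ^ 2 * n := by rw [mul_comm]; gcongr
  · refine le_trans (le_of_eq ?_) (hη2.trans (min_le_left _ _)); ring
  -- extraction
  by_contra hno
  push Not at hno
  have hz : ∀ x d : ZMod n, d ≠ 0 → ext M 0 f x * ext M 0 f (x + d) * ext M 0 f (x + 2 * d) = 0 := by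
    intro x d hd
    by_contra hne
    have h1 : ext M 0 f x ≠ 0 := fun h => hne (by rw [h]; ring)
    have h2 : ext M 0 f (x + d) ≠ 0 := fun h => hne (by rw [h]; ring)
    have h3 : ext M 0 f (x + 2 * d) ≠ 0 := fun h => hne (by rw [h]; ring)
    have key : ∀ y : ZMod n, ext M 0 f y ≠ 0 → y.val < M ∧ f y.val ≠ 0 := by
      intro y hy
      unfold ext at hy
      split_ifs at hy with h
      · exact ⟨h, hy⟩
      · exact absurd rfl hy
    obtain ⟨a1, a2⟩ := key _ h1
    obtain ⟨b1, b2⟩ := key _ h2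
    obtain ⟨c1, c2⟩ := key _ h3
    set p := x.val with hp
    set q := (x + d).val with hq
    set s := (x + 2 * d).val with hs
    have hpx : (p : ZMod n) = x := ZMod.natCast_zmod_val x
    have hqx : (q : ZMod n) = x + d := ZMod.natCast_zmod_val _
    have hsx : (s : ZMod n) = x + 2 * d := ZMod.natCast_zmod_val _
    have e : ((p + s : ℕ) : ZMod n) = ((2 * q : ℕ) : ZMod n) := by
      push_cast; rw [hpx, hqx, hsx]; ring
    rw [ZMod.natCast_eq_natCast_iff'] at e
    rw [Nat.mod_eq_of_lt (by omega), Nat.mod_eq_of_lt (by omega)] at e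
    have hpq : p ≠ q := by
      intro h
      apply hd
      have : (p : ZMod n) = q := by rw [h]
      rw [hpx, hqx] at this
      simpa using this
    rcases lt_or_gt_of_ne hpq with h | h
    · have h6 := hno p (q - p) (by omega) (by omega) a2 (by rwa [show p + (q - p) = q by omega])
      rw [show p + 2 * (q - p) = s by omega] at h6
      exact c2 h6
    · have h6 := hno s (q - s) (by omega) (by omega) c2 (by rwa [show s + (q - s) = q by omega])
      rw [show s + 2 * (q - s) = p by omega] at h6
      exact a2 h6
  have htf : tf (ext (n := n) M 0 f) = ∑ x : ZMod n, ext M 0 f x ^ 3 := by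
    unfold tf
    refine sum_congr rfl fun x _ => ?_
    rw [sum_eq_single 0 (fun d _ hd => hz x d hd) (by simp)]
    simp only [add_zero, mul_zero]; ring
  rw [htf, ext_sum_real hMn f 3 (by norm_num)] at hmain
  have hle : ∑ t ∈ range M, f t ^ 3 ≤ M * Q ^ 3 := by
    calc ∑ t ∈ range M, f t ^ 3 ≤ ∑ t ∈ range M, Q ^ 3 := by
          refine sum_le_sum fun t ht => ?_
          have h1 := hf t (mem_range.1 ht)
          have h2 := hfQ t (mem_range.1 ht)
          gcongr
      _ = M * Q ^ 3 := by simp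
  have hQc : Q ^ 3 ≤ c * M := hQ.trans (by gcongr; exact min_le_right _ _)
  have h4 : (M:ℝ) * Q ^ 3 ≤ M * (c * M) := by gcongr
  have h5 : c * (2 * (M:ℝ)) ^ 2 ≤ c * (n:ℝ) ^ 2 := by gcongr
  nlinarith [mul_pos hc (mul_pos (by linarith : (0:ℝ) < M) (by linarith : (0:ℝ) < M))]

end PSRoth

namespace PSRoth
open Finset Filter ComplexConjugate

lemma params1 (A : ℝ) (hA : 0 < A) : ∀ᶠ x : ℝ in atTop,
    2 ≤ ⌊√(Real.log x)⌋₊ ∧ (4:ℝ) ^ ⌊√(Real.log x)⌋₊ ≤ x ^ (0.01:ℝ) ∧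
      A * (1 + Real.log x) ^ 9 ≤ ((⌊√(Real.log x)⌋₊ : ℕ):ℝ) ^ 40 := by
  have h1 : Tendsto (fun x : ℝ => √(Real.log x)) atTop atTop := Real.tendsto_sqrt_atTop.comp Real.tendsto_log_atTop
  filter_upwards [h1.eventually_ge_atTop (max 200 (A * 2 ^ 49)), eventually_ge_atTop 1] with x hx hx1
  set s := √(Real.log x) with hs
  have hs1 : 200 ≤ s := (le_max_left _ _).trans hx
  have hs2 : A * 2 ^ 49 ≤ s := (le_max_right _ _).trans hx
  have hL : Real.log x = s ^ 2 := by rw [hs, Real.sq_sqrt (Real.log_nonneg hx1)]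
  clear_value s
  have hw1 : s / 2 ≤ (⌊s⌋₊ : ℝ) := floor_half (by linarith)
  have hw2 : (⌊s⌋₊ : ℝ) ≤ s := Nat.floor_le (by linarith)
  refine ⟨Nat.le_floor (by norm_num; linarith), ?_, ?_⟩
  · rw [← Real.rpow_natCast, Real.rpow_def_of_pos (by norm_num), Real.rpow_def_of_pos (by linarith), hL]
    apply Real.exp_le_exp.2
    have h4 : Real.log 4 ≤ 2 := by
      have := Real.log_le_sub_one_of_pos (show (0:ℝ) < 2 by norm_num)
      rw [show (4:ℝ) = 2 ^ 2 by norm_num, Real.log_pow]; push_cast; linarith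
    have h40 : 0 ≤ Real.log 4 := Real.log_nonneg (by norm_num)
    calc Real.log 4 * (⌊s⌋₊ : ℝ) ≤ 2 * s := by gcongr
      _ ≤ _ := by nlinarith
  · have e1 : (s / 2) ^ 40 ≤ ((⌊s⌋₊ : ℕ):ℝ) ^ 40 := by gcongr
    refine le_trans ?_ e1
    rw [hL]
    have e2 : (1 + s ^ 2) ^ 9 ≤ (2 * s ^ 2) ^ 9 := by
      gcongr; nlinarith
    have e3 : s ^ 19 ≤ s ^ 40 := pow_le_pow_right₀ (by linarith) (by norm_num)
    calc A * (1 + s ^ 2) ^ 9 ≤ A * (2 * s ^ 2) ^ 9 := by gcongr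
      _ = (A * 2 ^ 49) * s ^ 18 / 2 ^ 40 := by ring
      _ ≤ s * s ^ 18 / 2 ^ 40 := by gcongr
      _ = s ^ 19 / 2 ^ 40 := by ring
      _ ≤ s ^ 40 / 2 ^ 40 := by gcongr
      _ = _ := by ring

lemma params2 : ∀ᶠ x : ℝ in atTop, 1 ≤ ⌊x ^ (0.01:ℝ)⌋₊ ∧ ((⌊x ^ (0.01:ℝ)⌋₊ : ℕ):ℝ) ≤ x ^ (0.01:ℝ) ∧
    Real.log x / 200 ≤ Real.log (⌊x ^ (0.01:ℝ)⌋₊ : ℕ) ∧ Real.log (⌊x ^ (0.01:ℝ)⌋₊ : ℕ) ≤ Real.log x := by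
  filter_upwards [(tendsto_rpow_atTop (show (0:ℝ) < 0.005 by norm_num)).eventually_ge_atTop 2, eventually_ge_atTop 1] with x hx hx1
  have hx0 : 0 < x := by linarith
  have e : x ^ (0.01:ℝ) = x ^ (0.005:ℝ) * x ^ (0.005:ℝ) := by rw [← Real.rpow_add hx0]; norm_num
  have h2 : 2 ≤ x ^ (0.01:ℝ) := by rw [e]; nlinarith
  have h3 : x ^ (0.005:ℝ) ≤ (⌊x ^ (0.01:ℝ)⌋₊ : ℝ) := by
    refine le_trans ?_ (floor_half h2)
    rw [e]; nlinarith
  have h4 : (⌊x ^ (0.01:ℝ)⌋₊ : ℝ) ≤ x ^ (0.01:ℝ) := Nat.floor_le (by linarith)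
  refine ⟨Nat.le_floor (by norm_num; linarith), h4, ?_, ?_⟩
  · calc Real.log x / 200 = Real.log (x ^ (0.005:ℝ)) := by rw [Real.log_rpow hx0]; ring
      _ ≤ _ := Real.log_le_log (by positivity) h3
  · refine (Real.log_le_log (by linarith) h4).trans ?_
    rw [Real.log_rpow hx0]
    have := Real.log_nonneg hx1
    linarith

lemma params3 {γ : ℝ} (h0 : 71/72 < γ) (h1 : γ < 1) : ∀ᶠ x : ℝ in atTop,
    6 ≤ ⌊x ^ (1 - γ) / 6⌋₊ ∧ x ^ (1 - γ) / 12 ≤ ((⌊x ^ (1 - γ) / 6⌋₊ : ℕ):ℝ) ∧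
      6 * ((⌊x ^ (1 - γ) / 6⌋₊ : ℕ):ℝ) ≤ x ^ (1 - γ) ∧ x ^ (1 - γ) ≤ x ^ (1/72 : ℝ) := by
  filter_upwards [(tendsto_rpow_atTop (show (0:ℝ) < 1 - γ by linarith)).eventually_ge_atTop 100, eventually_ge_atTop 1] with x hx hx1
  have h3 := floor_half (x := x ^ (1 - γ) / 6) (by linarith)
  have h4 : (⌊x ^ (1 - γ) / 6⌋₊ : ℝ) ≤ x ^ (1 - γ) / 6 := Nat.floor_le (by linarith)
  refine ⟨Nat.le_floor (by norm_num; linarith), by linarith, by linarith, ?_⟩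
  exact Real.rpow_le_rpow_of_exponent_le hx1 (by linarith)

lemma numer1 {x ℓ G C κ M R H z LR : ℝ} (hx : 1 ≤ x) (hC : 0 < C) (hκ : 0 < κ) (hG1 : 1 ≤ G) (hG : G ≤ ℓ ^ 2)
    (hR0 : 0 ≤ R) (hR : R ≤ x ^ (0.01:ℝ)) (hH0 : 0 ≤ H) (hH : H ≤ x ^ (1/72:ℝ))
    (hM : x ^ (0.99:ℝ) ≤ M) (hM2 : M ≤ 2 * x) (hℓ : 1 ≤ ℓ) (hLR0 : 0 ≤ LR) (hLR : LR ≤ ℓ - 1) (hz0 : 0 < z)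
    (hz : 6 / κ * ℓ ^ 9 ≤ z) (hA : (100 + 2 * C) / κ * ℓ ^ 10 ≤ x ^ (0.01:ℝ)) :
    G * (R ^ 2 * (2 / x ^ (-(1/2):ℝ) + 2 + (M + R ^ 2) * (7 * x ^ (-(1/2):ℝ))) + M * (3 * (1 + LR) ^ 3 / z)) +
      G * (R ^ 2 * (H * (C * x ^ (0.51:ℝ)))) ≤ κ / G ^ 2 * M := by
  have hx0 : 0 < x := by linarith
  have hG0 : 0 < G := by linarith
  have hM0 : 0 ≤ M := le_trans (by positivity) hM
  have hR2 : R ^ 2 ≤ x ^ (0.02:ℝ) := by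
    calc R ^ 2 ≤ (x ^ (0.01:ℝ)) ^ 2 := by gcongr
      _ = x ^ (0.02:ℝ) := by rw [← Real.rpow_natCast, ← Real.rpow_mul hx0.le]; norm_num
  have hH2 : H ≤ x ^ (0.02:ℝ) := hH.trans (Real.rpow_le_rpow_of_exponent_le hx (by norm_num))
  have h5 : 1 ≤ x ^ (1/2:ℝ) := Real.one_le_rpow hx (by norm_num)
  have e1 : 2 / x ^ (-(1/2):ℝ) = 2 * x ^ (1/2:ℝ) := by rw [Real.rpow_neg hx0.le]; field_simp
  have h02 : x ^ (0.02:ℝ) ≤ x := by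
    conv_rhs => rw [← Real.rpow_one x]
    exact Real.rpow_le_rpow_of_exponent_le hx (by norm_num)
  have e2 : (M + R ^ 2) * (7 * x ^ (-(1/2):ℝ)) ≤ 21 * x ^ (1/2:ℝ) := by
    have e3 : x * x ^ (-(1/2):ℝ) = x ^ (1/2:ℝ) := by
      nth_rw 1 [← Real.rpow_one x]; rw [← Real.rpow_add hx0]; norm_num
    calc (M + R ^ 2) * (7 * x ^ (-(1/2):ℝ)) ≤ (2 * x + x) * (7 * x ^ (-(1/2):ℝ)) := by gcongr; linarith
      _ = 21 * (x * x ^ (-(1/2):ℝ)) := by ring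
      _ = _ := by rw [e3]
  have f1 : R ^ 2 * (2 / x ^ (-(1/2):ℝ) + 2 + (M + R ^ 2) * (7 * x ^ (-(1/2):ℝ))) ≤ 25 * x ^ (0.55:ℝ) := by
    calc _ ≤ x ^ (0.02:ℝ) * (25 * x ^ (1/2:ℝ)) := by
          gcongr; rw [e1]; linarith
      _ = 25 * x ^ (0.52:ℝ) := by
          rw [show (0.52:ℝ) = 0.02 + 1/2 by norm_num, Real.rpow_add hx0]; ring
      _ ≤ _ := by gcongr; norm_num
  have f2 : R ^ 2 * (H * (C * x ^ (0.51:ℝ))) ≤ C * x ^ (0.55:ℝ) := by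
    calc _ ≤ x ^ (0.02:ℝ) * (x ^ (0.02:ℝ) * (C * x ^ (0.51:ℝ))) := by gcongr
      _ = C * x ^ (0.55:ℝ) := by
        rw [show (0.55:ℝ) = 0.02 + 0.02 + 0.51 by norm_num, Real.rpow_add hx0, Real.rpow_add hx0]; ring
  have hG3 : G ^ 3 ≤ ℓ ^ 6 := by
    calc G ^ 3 ≤ (ℓ ^ 2) ^ 3 := by gcongr
      _ = _ := by ring
  have f3 : G ^ 3 * (3 * (1 + LR) ^ 3 / z) ≤ κ / 2 := by
    calc G ^ 3 * (3 * (1 + LR) ^ 3 / z) ≤ ℓ ^ 6 * (3 * ℓ ^ 3 / z) := by gcongr; linarith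
      _ = 3 * ℓ ^ 9 / z := by ring
      _ ≤ κ / 2 := by
        rw [div_le_iff₀ hz0]
        have := mul_le_mul_of_nonneg_left hz (by positivity : 0 ≤ κ / 2)
        have e : κ / 2 * (6 / κ * ℓ ^ 9) = 3 * ℓ ^ 9 := by field_simp; ring
        linarith
  have f4 : G ^ 3 * (25 + C) * x ^ (0.55:ℝ) ≤ κ / 2 * M := by
    have hA' : (100 + 2 * C) * ℓ ^ 10 ≤ κ * x ^ (0.01:ℝ) := by
      have := mul_le_mul_of_nonneg_left hA hκ.le
      calc (100 + 2 * C) * ℓ ^ 10 = κ * ((100 + 2 * C) / κ * ℓ ^ 10) := by field_simp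
        _ ≤ _ := this
    have hℓ10 : ℓ ^ 6 ≤ ℓ ^ 10 := pow_le_pow_right₀ hℓ (by norm_num)
    have : G ^ 3 * (25 + C) ≤ κ / 2 * x ^ (0.01:ℝ) := by
      calc G ^ 3 * (25 + C) ≤ ℓ ^ 10 * (50 + C) := by
            have := hG3.trans hℓ10
            gcongr; norm_num
        _ ≤ _ := by linarith
    calc G ^ 3 * (25 + C) * x ^ (0.55:ℝ) ≤ κ / 2 * x ^ (0.01:ℝ) * x ^ (0.55:ℝ) := by gcongr
      _ = κ / 2 * x ^ (0.56:ℝ) := by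
        rw [show (0.56:ℝ) = 0.01 + 0.55 by norm_num, Real.rpow_add hx0]; ring
      _ ≤ κ / 2 * x ^ (0.99:ℝ) := by gcongr; norm_num
      _ ≤ _ := by gcongr
  rw [div_mul_eq_mul_div, le_div_iff₀ (by positivity)]
  calc _ ≤ (G * (25 * x ^ (0.55:ℝ) + M * (3 * (1 + LR) ^ 3 / z)) + G * (C * x ^ (0.55:ℝ))) * G ^ 2 := by gcongr
    _ = G ^ 3 * (25 + C) * x ^ (0.55:ℝ) + G ^ 3 * (3 * (1 + LR) ^ 3 / z) * M := by ring
    _ ≤ κ / 2 * M + κ / 2 * M := by gcongr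
    _ = κ * M := by ring

lemma numer2 {x ℓ G C κ M H : ℝ} (hx : 1 ≤ x) (hC : 0 < C) (hκ : 0 < κ) (hG1 : 1 ≤ G) (hG : G ≤ ℓ ^ 2)
    (hH0 : 0 < H) (hH : H ≤ x ^ (1/72:ℝ))
    (hM : x ^ (0.99:ℝ) ≤ M) (hℓ : 1 ≤ ℓ) (hA : (100 + 2 * C) / κ * ℓ ^ 10 ≤ x ^ (0.01:ℝ)) :
    H * (C * x ^ (0.51:ℝ)) ≤ κ / (G * (G * H) ^ 4) * M ∧ (G * H) ^ 3 ≤ κ * M := by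
  have hx0 : 0 < x := by linarith
  have hG0 : 0 < G := by linarith
  have hH2 : H ≤ x ^ (0.02:ℝ) := hH.trans (Real.rpow_le_rpow_of_exponent_le hx (by norm_num))
  have hA' : (100 + 2 * C) * ℓ ^ 10 ≤ κ * x ^ (0.01:ℝ) := by
    have := mul_le_mul_of_nonneg_left hA hκ.le
    calc (100 + 2 * C) * ℓ ^ 10 = κ * ((100 + 2 * C) / κ * ℓ ^ 10) := by field_simp
      _ ≤ _ := this
  have hp : ∀ k : ℕ, H ^ k ≤ x ^ (0.02 * k : ℝ) := by
    intro k
    rw [Real.rpow_mul hx0.le, Real.rpow_natCast]; gcongr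
  have h5 : G ^ 5 ≤ ℓ ^ 10 := by
    calc G ^ 5 ≤ (ℓ ^ 2) ^ 5 := by gcongr
      _ = _ := by ring
  have hℓ0 : 0 < ℓ ^ 10 := by positivity
  constructor
  · rw [div_mul_eq_mul_div, le_div_iff₀ (by positivity)]
    calc H * (C * x ^ (0.51:ℝ)) * (G * (G * H) ^ 4) = C * G ^ 5 * H ^ 5 * x ^ (0.51:ℝ) := by ring
      _ ≤ C * ℓ ^ 10 * x ^ (0.02 * (5:ℕ) : ℝ) * x ^ (0.51:ℝ) := by gcongr; exact hp 5
      _ ≤ κ * x ^ (0.01:ℝ) * x ^ (0.02 * (5:ℕ) : ℝ) * x ^ (0.51:ℝ) := by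
          have hCl : C * ℓ ^ 10 ≤ κ * x ^ (0.01:ℝ) := by nlinarith
          gcongr ?_ * _ * _
      _ = κ * x ^ (0.62:ℝ) := by
          rw [show (0.62:ℝ) = 0.01 + 0.02 * (5:ℕ) + 0.51 by norm_num, Real.rpow_add hx0, Real.rpow_add hx0]; ring
      _ ≤ κ * x ^ (0.99:ℝ) := by gcongr; norm_num
      _ ≤ _ := by gcongr
  · have h3 : G ^ 3 ≤ ℓ ^ 10 := (pow_le_pow_right₀ hG1 (by norm_num)).trans h5
    calc (G * H) ^ 3 = G ^ 3 * H ^ 3 := by ring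
      _ ≤ ℓ ^ 10 * x ^ (0.02 * (3:ℕ) : ℝ) := by gcongr; exact hp 3
      _ ≤ κ * x ^ (0.01:ℝ) * x ^ (0.02 * (3:ℕ) : ℝ) := by gcongr; nlinarith
      _ = κ * x ^ (0.07:ℝ) := by
          rw [show (0.07:ℝ) = 0.01 + 0.02 * (3:ℕ) by norm_num, Real.rpow_add hx0]; ring
      _ ≤ κ * x ^ (0.99:ℝ) := by gcongr; norm_num
      _ ≤ _ := by gcongr

end PSRoth

namespace PSRoth
open Finset Filter ComplexConjugate

lemma fej_ps {γ : ℝ} (h0 : 71/72 < γ) (h1 : γ < 1) {x : ℝ} (hx : 1 ≤ x) {H p : ℕ} (hH : 1 ≤ H)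
    (hHx : 6 * (H:ℝ) ≤ x ^ (1 - γ)) (hp : x ≤ p) (hps : IsPS γ p) : (H:ℝ) / 4 ≤ fej H ((p:ℝ) ^ γ) := by
  obtain ⟨m, hm1, hm2⟩ := hps
  have hx0 : 0 < x := by linarith
  have hH0 : (0:ℝ) < H := by exact_mod_cast hH
  have hp0 : (0:ℝ) < p := by linarith
  refine fej_lower H hH _ (m : ℤ) ?_
  have hd := (rpow_first_diff (by linarith : 0 < γ) h1 hp0 (lt_add_one (p:ℝ))).2
  have h3 : (p:ℝ) ^ (γ - 1) ≤ x ^ (γ - 1) := Real.rpow_le_rpow_of_nonpos hx0 hp (by linarith)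
  have h4 : x ^ (γ - 1) = 1 / x ^ (1 - γ) := by
    rw [show γ - 1 = -(1 - γ) by ring, Real.rpow_neg hx0.le, one_div]
  have h5 : 1 / x ^ (1 - γ) ≤ 1 / (6 * (H:ℝ)) := by gcongr
  have h6 : 0 < (p:ℝ) ^ (γ - 1) := by positivity
  push_cast
  rw [abs_sub_comm, abs_of_nonneg (by linarith)]
  nlinarith

lemma numer3 {G H : ℝ} (hG : 1 ≤ G) (hH : 6 ≤ H) : 32 * G ≤ (G * H) ^ 2 := by
  have : (36:ℝ) ≤ H ^ 2 := by nlinarith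
  have h2 : G ≤ G ^ 2 := by nlinarith
  calc 32 * G ≤ 36 * G ^ 2 := by nlinarith
    _ ≤ H ^ 2 * G ^ 2 := by gcongr
    _ = _ := by ring

lemma numer4 {G H κ : ℝ} (hG : 1 ≤ G) (hH : 6 ≤ H) : κ / (G * (G * H) ^ 4) * G * (G * H) ^ 4 = κ := by
  have hG0 : G ≠ 0 := by linarith
  have hH0 : H ≠ 0 := by linarith
  field_simp

lemma pigeon {X W : ℕ} (hW : 1 ≤ W) (S : Finset ℕ) (hS : ∀ p ∈ S, X < p ∧ p ≤ 2 * X ∧ Nat.Coprime W p) (c : ℝ)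
    (hc : c * W.totient ≤ #S) : ∃ b, X < b ∧ b ≤ X + W ∧
      c ≤ #((range (X / W + 1)).filter fun t => b + W * t ∈ S) := by
  set g : ℕ → ℕ := fun p => X + 1 + (p - X - 1) % W with hg
  have hgp : ∀ p ∈ S, g p + W * ((p - X - 1) / W) = p := by
    intro p hp
    have h1 := (hS p hp).1
    have h2 := Nat.mod_add_div (p - X - 1) W
    simp only [hg]; omega
  have hmaps : ∀ p ∈ S, g p ∈ (Ico (X + 1) (X + 1 + W)).filter (fun m => W.Coprime m) := by
    intro p hp
    rw [mem_filter, mem_Ico]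
    have h3 := Nat.mod_lt (p - X - 1) hW
    refine ⟨⟨by simp only [hg]; omega, by simp only [hg]; omega⟩, ?_⟩
    have h4 := (hS p hp).2.2
    rw [← hgp p hp, Nat.coprime_add_mul_left_right] at h4
    exact h4
  have hcard := Nat.filter_coprime_Ico_eq_totient W (X + 1)
  have hne : ((Ico (X + 1) (X + 1 + W)).filter (fun m => W.Coprime m)).Nonempty := by
    rw [← card_pos, hcard]; exact Nat.totient_pos.2 hW
  obtain ⟨b, hb, hbc⟩ := exists_le_card_fiber_of_nsmul_le_card_of_maps_to (b := c) hmaps hne (by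
    rw [hcard, nsmul_eq_mul, mul_comm]; exact hc)
  rw [mem_filter, mem_Ico] at hb
  refine ⟨b, by omega, by omega, hbc.trans ?_⟩
  norm_cast
  refine card_le_card_of_injOn (fun p => (p - X - 1) / W) ?_ ?_
  · intro p hp
    have hp' := mem_filter.1 hp
    have h5 := hgp p hp'.1
    rw [hp'.2] at h5
    simp only [coe_filter, Set.mem_ofPred_eq, mem_range]
    refine ⟨?_, by rw [h5]; exact hp'.1⟩
    have := (hS p hp'.1).2.1
    exact Nat.lt_succ_of_le (Nat.div_le_div_right (by omega))
  · intro p hp q hq hpq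
    have hp' := mem_filter.1 hp
    have hq' := mem_filter.1 hq
    have h5 := hgp p hp'.1
    have h6 := hgp q hq'.1
    simp only at hpq
    rw [hp'.2, hpq] at h5
    rw [hq'.2] at h6
    omega

set_option maxHeartbeats 1000000 in
theorem ap_of_dense {γ : ℝ} (h0 : 71/72 < γ) (h1 : γ < 1) (c0 : ℝ) (hc0 : 0 < c0) :
    ∀ᶠ X : ℕ in atTop, ∀ S : Finset ℕ, (∀ p ∈ S, p.Prime ∧ IsPS γ p ∧ X < p ∧ p ≤ 2 * X) →
      c0 * ((X:ℝ) ^ γ / Real.log X) ≤ #S → ∃ a d : ℕ, d ≠ 0 ∧ a ∈ S ∧ a + d ∈ S ∧ a + 2 * d ∈ S := by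
  obtain ⟨CP, hCP, hPP⟩ := PP_pow 40
  obtain ⟨κ, hκ, M0, hT⟩ := transf3 (c0 / (38400 * CP)) (by positivity)
  obtain ⟨C1, hC1, hnu⟩ := nu_fourier γ h0 h1
  obtain ⟨C2, hC2, hfej⟩ := fej_sum γ h0 h1
  have ev1 := eventually_nat (params1 (6 / κ) (by positivity))
  have ev2 := eventually_nat params2
  have ev3 := eventually_nat (params3 h0 h1)
  have ev4 := eventually_nat (eventually_log_pow ((100 + 2 * C1) / κ) 1 0.01 10 (by positivity) one_pos (by norm_num))
  have ev5 := eventually_nat (eventually_log_pow ((100 + 2 * C2) / κ) 1 0.01 10 (by positivity) one_pos (by norm_num))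
  have ev6 := eventually_nat ((tendsto_rpow_atTop (show (0:ℝ) < 0.01 by norm_num)).eventually_ge_atTop (max 4 M0))
  filter_upwards [ev1, ev2, ev3, ev4, ev5, ev6, eventually_ge_atTop 3] with X p1 p2 p3 p4 p5 p6 hX3
  intro S hS hSc
  have hXR : (3:ℝ) ≤ X := by exact_mod_cast hX3
  set x : ℝ := ((X:ℕ):ℝ) with hx
  set w := ⌊√(Real.log x)⌋₊ with hw
  set R := ⌊x ^ (0.01:ℝ)⌋₊ with hR
  set H := ⌊x ^ (1 - γ) / 6⌋₊ with hH
  clear_value w R H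
  obtain ⟨w1, w2, w3⟩ := p1
  obtain ⟨r1, r2, r3, r4⟩ := p2
  obtain ⟨k1, k2, k3, k4⟩ := p3
  rw [one_mul] at p4 p5
  have q1 : 4 ≤ x ^ (0.01:ℝ) := (le_max_left _ _).trans p6
  have q2 : (M0:ℝ) ≤ x ^ (0.01:ℝ) := (le_max_right _ _).trans p6
  have hx0 : 0 < x := by linarith
  have hx1 : 1 ≤ x := by linarith
  have hlog : 0 < Real.log x := Real.log_pos (by linarith)
  set W := primorial w with hW
  have hWpos : 1 ≤ W := primorial_pos w
  have hWx : (W:ℝ) ≤ x ^ (0.01:ℝ) := by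
    refine le_trans ?_ w2
    exact_mod_cast primorial_le_four_pow w
  have hWR : (1:ℝ) ≤ W := by exact_mod_cast hWpos
  have hWprime : ∀ p : ℕ, p.Prime → p ∣ W → p ≤ w := by
    intro p hp hd
    exact (hp.dvd_primorial_iff).1 hd
  have htot : (W:ℝ) = W.totient * PP w := totient_primorial w
  clear_value W
  have hrp : ∀ a b : ℝ, a ≤ b → x ^ a ≤ x ^ b := fun a b h => Real.rpow_le_rpow_of_exponent_le hx1 h
  have hx1' : x ^ (1:ℝ) = x := Real.rpow_one x
  have hwX : w < X := by
    have a1 : (w:ℝ) < 4 ^ w := by exact_mod_cast Nat.lt_pow_self (by norm_num)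
    have a2 := hrp 0.01 1 (by norm_num)
    have : (w:ℝ) < x := a1.trans_le (w2.trans (a2.trans hx1'.le))
    rw [hx] at this
    exact_mod_cast this
  have hφ : (0:ℝ) < W.totient := by exact_mod_cast Nat.totient_pos.2 hWpos
  obtain ⟨b, hb1, hb2, hcnt⟩ := pigeon hWpos S (fun p hp => by
    obtain ⟨a1, a2, a3, a4⟩ := hS p hp
    refine ⟨a3, a4, ?_⟩
    rw [Nat.coprime_comm, Nat.Prime.coprime_iff_not_dvd a1]
    intro hd
    have := hWprime p a1 hd
    omega) (c0 * (x ^ γ / Real.log x) / W.totient) (by rw [div_mul_cancel₀ _ hφ.ne']; exact hSc)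
  set M := X / W + 1 with hM
  have hM1 : (X:ℝ) / W ≤ M := by
    rw [div_le_iff₀ (by linarith)]
    have : X ≤ (X / W + 1) * W := by
      have a := Nat.mod_add_div X W
      have a' := Nat.mod_lt X hWpos
      nlinarith
    exact_mod_cast this
  have hM2 : (W:ℝ) * M ≤ x + W := by
    have : W * (X / W + 1) ≤ X + W := by
      have := Nat.mul_div_le X W
      nlinarith
    rw [hx, hM]
    exact_mod_cast this
  clear_value M
  have hWx2 : (W:ℝ) ≤ x := hWx.trans ((hrp 0.01 1 (by norm_num)).trans hx1'.le)
  have hM3 : (M:ℝ) ≤ 2 * x / W := by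
    rw [le_div_iff₀ (by linarith)]; linarith
  have hM4 : x ^ (0.99:ℝ) ≤ M := by
    refine le_trans ?_ hM1
    rw [le_div_iff₀ (by linarith)]
    calc x ^ (0.99:ℝ) * W ≤ x ^ (0.99:ℝ) * x ^ (0.01:ℝ) := by gcongr
      _ = x := by rw [← Real.rpow_add hx0]; norm_num
  have hM5 : (M:ℝ) ≤ 2 * x := hM3.trans (div_le_self (by linarith) hWR)
  have hM6 : M0 ≤ M := by
    have := hrp 0.01 0.99 (by norm_num)
    have : (M0:ℝ) ≤ M := by linarith
    exact_mod_cast this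
  set z := w ^ 40 with hz
  have hzw : w ≤ z := Nat.le_self_pow (by norm_num) w
  have hzR : ((z:ℕ):ℝ) = (w:ℝ) ^ 40 := by rw [hz]; push_cast; rfl
  have hPPz : PP z ≤ CP * PP w := hPP w w1
  clear_value z
  have hz1 : 1 ≤ z := by omega
  have hz0 : (0:ℝ) < z := by exact_mod_cast hz1
  set G := (VV R z)⁻¹ with hG
  have hG1 : 1 ≤ G := VV_inv_ge_one r1
  have hlR0 : 0 ≤ Real.log R := Real.log_natCast_nonneg R
  have hG2 : G ≤ (1 + Real.log x) ^ 2 := (VV_inv_le r1).trans (by gcongr)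
  have hH1 : 1 ≤ H := by omega
  have hHR : (6:ℝ) ≤ H := by exact_mod_cast k1
  have hHx : (H:ℝ) ≤ x ^ (1/72:ℝ) := by linarith
  have hGlow : Real.log x / (400 * CP * PP w) ≤ G := by
    have a1 : GG R z ≤ G := by
      rw [hG, le_inv_comm₀ (by linarith [GG_ge_one (z := z) r1]) (VV_pos r1)]
      exact VV_le r1
    have a2 : Real.log R ≤ 2 * PP z * GG R z := GG_lower r1
    have a3 := PP_pos w
    have a4 := GG_ge_one (z := z) r1
    have a5 : 2 * PP z * GG R z ≤ 2 * (CP * PP w) * G := by gcongr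
    rw [div_le_iff₀ (by positivity)]
    linarith
  have hbR : x ≤ b := by rw [hx]; exact_mod_cast hb1.le
  have hb2R : (b:ℝ) ≤ x + W := by rw [hx]; exact_mod_cast hb2
  have h03 : 4 * x ^ (0.03:ℝ) ≤ x := by
    calc 4 * x ^ (0.03:ℝ) ≤ x ^ (0.01:ℝ) * x ^ (0.03:ℝ) := by gcongr
      _ = x ^ (0.04:ℝ) := by rw [← Real.rpow_add hx0]; norm_num
      _ ≤ x ^ (1:ℝ) := hrp _ _ (by norm_num)
      _ = x := hx1'
  have hR2 : (R:ℝ) ^ 2 ≤ x ^ (0.02:ℝ) := by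
    calc (R:ℝ) ^ 2 ≤ (x ^ (0.01:ℝ)) ^ 2 := by gcongr
      _ = x ^ (0.02:ℝ) := by rw [← Real.rpow_natCast, ← Real.rpow_mul hx0.le]; norm_num
  have hRbig : (W:ℝ) * (R:ℝ) ^ 2 ≤ x ^ (0.03:ℝ) := by
    calc (W:ℝ) * (R:ℝ) ^ 2 ≤ x ^ (0.01:ℝ) * x ^ (0.02:ℝ) := by gcongr
      _ = _ := by rw [← Real.rpow_add hx0]; norm_num
  have hW03 : (W:ℝ) ≤ x ^ (0.03:ℝ) := hWx.trans (hrp _ _ (by norm_num))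
  have hbd : (b:ℝ) + W * (M + 2 * (R:ℝ) ^ 2) ≤ 5 * x := by
    have : (W:ℝ) * (M + 2 * (R:ℝ) ^ 2) = W * M + 2 * (W * (R:ℝ) ^ 2) := by ring
    linarith
  have hρ : 2 * (R:ℝ) ^ 2 * x ^ (-(1/2):ℝ) ≤ 1 := by
    calc 2 * (R:ℝ) ^ 2 * x ^ (-(1/2):ℝ) ≤ x ^ (0.01:ℝ) * x ^ (0.02:ℝ) * x ^ (-(1/2):ℝ) := by gcongr; linarith
      _ = x ^ (-0.47:ℝ) := by rw [← Real.rpow_add hx0, ← Real.rpow_add hx0]; norm_num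
      _ ≤ x ^ (0:ℝ) := hrp _ _ (by norm_num)
      _ = 1 := Real.rpow_zero x
  -- the functions
  have hfp : ∀ p ∈ S, (H:ℝ) / 4 ≤ fej H ((p:ℝ) ^ γ) ∧ SS R z p = 1 := by
    intro p hp
    obtain ⟨a1, a2, a3, a4⟩ := hS p hp
    have a5 : x ≤ p := by rw [hx]; exact_mod_cast a3.le
    refine ⟨fej_ps h0 h1 hx1 hH1 k3 a5 a2, SS_prime r1 a1 ?_⟩
    have a6 := hrp 0.01 1 (by norm_num)
    have a7 : (R:ℝ) ≤ x := r2.trans (a6.trans hx1'.le)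
    rw [hx] at a7
    have : R ≤ X := by exact_mod_cast a7
    omega
  set f : ℕ → ℝ := fun t => if b + W * t ∈ S then G * H / 4 else 0 with hf
  obtain ⟨n1, n2⟩ := numer2 hx1 hC2 hκ hG1 hG2 (by linarith : (0:ℝ) < H) hHx hM4 (by linarith) p5
  have n3 := numer1 (LR := Real.log R) hx1 hC1 hκ hG1 hG2 (by positivity) r2 (by positivity) hHx hM4 hM5
    (by linarith) hlR0 (by linarith) hz0 (by rw [hzR]; exact w3) p4
  have hGH : 0 ≤ G * H := by positivity
  have hfin := hT M hM6 f (nu γ R z H b W) (fun t => fej H (((b + W * t : ℕ):ℝ) ^ γ)) G (G * H)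
    (κ / G ^ 2) (κ / (G * (G * H) ^ 4)) ?_ ?_ ?_ ?_ ?_ ?_ ?_ hG1 ?_ ?_ ?_ n2
  · obtain ⟨a, d, hd, hadM, ha, hb', hc'⟩ := hfin
    have key : ∀ t, f t ≠ 0 → b + W * t ∈ S := by
      intro t ht
      by_contra hn
      exact ht (by simp only [hf]; rw [if_neg hn])
    refine ⟨b + W * a, W * d, Nat.mul_ne_zero (by omega) hd, key a ha, ?_, ?_⟩
    · rw [show b + W * a + W * d = b + W * (a + d) by ring]; exact key _ hb'
    · rw [show b + W * a + 2 * (W * d) = b + W * (a + 2 * d) by ring]; exact key _ hc'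
  · intro t _; simp only [hf]; split_ifs <;> positivity
  · intro t _
    simp only [hf]
    split_ifs with h
    · obtain ⟨u1, u2⟩ := hfp _ h
      unfold nu
      rw [← hG, u2, mul_one]
      calc G * H / 4 = G * (H / 4) := by ring
        _ ≤ _ := by gcongr
    · unfold nu
      have := SS_nonneg R z (b + W * t)
      have := fej_nonneg H (((b + W * t : ℕ):ℝ) ^ γ)
      rw [← hG]; positivity
  · intro t _
    simp only [hf]
    split_ifs with h
    · obtain ⟨u1, u2⟩ := hfp _ h
      calc G * H / 4 = G * (H / 4) := by ring
        _ ≤ _ := by gcongr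
    · have := fej_nonneg H (((b + W * t : ℕ):ℝ) ^ γ)
      positivity
  · intro t _
    simp only [hf]
    split_ifs <;> linarith
  · -- mean
    have e1 : ∑ t ∈ range M, f t = G * H / 4 * #((range M).filter fun t => b + W * t ∈ S) := by
      simp only [hf]
      rw [← sum_filter, sum_const, nsmul_eq_mul, mul_comm]
    rw [e1]
    have hPw := PP_pos w
    have hxx : x ^ (1 - γ) * x ^ γ = x := by rw [← Real.rpow_add hx0]; simp
    calc c0 / (38400 * CP) * M ≤ c0 / (38400 * CP) * (2 * x / W) := by gcongr
      _ = (Real.log x / (400 * CP * PP w)) * (x ^ (1 - γ) / 12) / 4 * (c0 * (x ^ γ / Real.log x) / W.totient) := by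
        rw [htot]
        have hP0 : PP w ≠ 0 := by linarith
        field_simp
        linear_combination (-38400) * hxx
      _ ≤ _ := by gcongr
  · intro θ
    refine le_trans (hnu x b W M H R z θ (x ^ (-(1/2):ℝ)) hx1 hWpos hH1 hHx hbR hbd r1 hz1
      (fun p hp hd => (hWprime p hp hd).trans hzw) (by positivity) hρ) ?_
    rw [← hG]
    exact n3
  · intro θ
    have h5 := hfej x b W M 1 H θ hx1 hWpos le_rfl (Nat.coprime_one_right W) hH1 hHx hbR (by
      have r1R : (1:ℝ) ≤ R := by exact_mod_cast r1
      have : (1:ℝ) ≤ (R:ℝ) ^ 2 := one_le_pow₀ r1R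
      refine le_trans ?_ hbd
      push_cast
      gcongr)
    have e : filt b W M 1 = range M := by simp [filt]
    rw [e] at h5
    exact h5.trans n1
  · exact numer3 hG1 hHR
  · rw [div_mul_cancel₀ _ (by positivity)]
  · exact (numer4 hG1 hHR).le

end PSRoth

namespace PSRoth
open Finset Filter

noncomputable def gg (γ : ℝ) (N : ℕ) : ℝ := (N:ℝ) ^ γ / Real.log N

lemma gg_nonneg (γ : ℝ) (N : ℕ) : 0 ≤ gg γ N := by
  unfold gg
  have := Real.log_natCast_nonneg N
  positivity

lemma gg_large {γ : ℝ} (h0 : 71/72 < γ) (K : ℝ) : ∀ᶠ N : ℕ in atTop, K ≤ gg γ N := by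
  have ev1 := eventually_nat (eventually_log_pow 1 1 (1/2) 1 one_pos one_pos (by norm_num))
  have ev2 := eventually_nat ((tendsto_rpow_atTop (show (0:ℝ) < 1/4 by norm_num)).eventually_ge_atTop (max K 1))
  filter_upwards [ev1, ev2, eventually_ge_atTop 3] with N a1 a2 hN
  have hNR : (3:ℝ) ≤ N := by exact_mod_cast hN
  have hlog : 0 < Real.log N := Real.log_pos (by linarith)
  rw [one_mul, one_mul, pow_one] at a1
  have a3 : K ≤ (N:ℝ) ^ (1/4:ℝ) := (le_max_left _ _).trans a2
  unfold gg
  rw [le_div_iff₀ hlog]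
  calc K * Real.log N ≤ (N:ℝ) ^ (1/4:ℝ) * (N:ℝ) ^ (1/2:ℝ) := by
        gcongr; linarith
    _ = (N:ℝ) ^ (3/4:ℝ) := by rw [← Real.rpow_add (by linarith)]; norm_num
    _ ≤ _ := Real.rpow_le_rpow_of_exponent_le (by linarith) (by linarith)

lemma gg_double {γ : ℝ} (h0 : 71/72 < γ) : ∀ᶠ X : ℕ in atTop, ∀ N, 2 * X ≤ N → N ≤ 2 * X + 1 →
    5 / 4 * gg γ X ≤ gg γ N := by
  have ev1 := eventually_nat (Real.tendsto_log_atTop.eventually_ge_atTop (20:ℝ))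
  filter_upwards [ev1, eventually_ge_atTop 3] with X a1 hX N hN1 hN2
  have hXR : (3:ℝ) ≤ X := by exact_mod_cast hX
  have b1 : 2 * (X:ℝ) ≤ N := by exact_mod_cast hN1
  have b2 : (N:ℝ) ≤ 3 * X := by
    have : N ≤ 3 * X := by omega
    exact_mod_cast this
  have hX0 : (0:ℝ) < X := by linarith
  have l1 : Real.log N ≤ 11 / 10 * Real.log X := by
    have e1 := Real.log_le_log (by linarith : (0:ℝ) < N) b2
    rw [Real.log_mul (by norm_num) hX0.ne'] at e1
    have e2 := Real.log_le_sub_one_of_pos (show (0:ℝ) < 3 by norm_num)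
    linarith
  have hlN : 0 < Real.log N := Real.log_pos (by linarith)
  have hlX : 0 < Real.log X := by linarith
  have p1 : 7 / 5 * (X:ℝ) ^ γ ≤ (N:ℝ) ^ γ := by
    have e3 : (7/5:ℝ) ≤ 2 ^ γ := by
      calc (7/5:ℝ) ≤ √2 := by
            apply Real.le_sqrt_of_sq_le; norm_num
        _ = 2 ^ (1/2:ℝ) := Real.sqrt_eq_rpow 2
        _ ≤ _ := Real.rpow_le_rpow_of_exponent_le (by norm_num) (by linarith)
    calc 7 / 5 * (X:ℝ) ^ γ ≤ 2 ^ γ * (X:ℝ) ^ γ := by gcongr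
      _ = (2 * (X:ℝ)) ^ γ := by rw [Real.mul_rpow (by norm_num) hX0.le]
      _ ≤ _ := Real.rpow_le_rpow (by linarith) b1 (by linarith)
  unfold gg
  have hXg : 0 < (X:ℝ) ^ γ := by positivity
  calc 5 / 4 * ((X:ℝ) ^ γ / Real.log X) ≤ (7 / 5 * (X:ℝ) ^ γ) / (11 / 10 * Real.log X) := by
        rw [mul_div_assoc', div_le_div_iff₀ hlX (by positivity)]
        nlinarith [mul_pos hXg hlX]
    _ ≤ _ := by gcongr

open Classical in
lemma count_le {γ : ℝ} (A : Set ℕ) (c : ℝ) (hc : 0 < c) (X0 : ℕ)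
    (h1 : ∀ X, X0 ≤ X → (#((Ioc X (2 * X)).filter (· ∈ A)) : ℝ) ≤ c * gg γ X)
    (h2 : ∀ X, X0 ≤ X → 1 ≤ c * gg γ X)
    (h3 : ∀ X, X0 ≤ X → ∀ N, 2 * X ≤ N → N ≤ 2 * X + 1 → 5 / 4 * gg γ X ≤ gg γ N) (N : ℕ) :
    (#((Icc 1 N).filter (· ∈ A)) : ℝ) ≤ 2 * X0 + 2 + 8 * (c * gg γ N) := by
  induction N using Nat.strong_induction_on with
  | _ N ih =>
    have hg := gg_nonneg γ N
    by_cases hN : N ≤ 2 * X0 + 2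
    · have e1 : (#((Icc 1 N).filter (· ∈ A)) : ℝ) ≤ N := by
        have := card_filter_le (Icc 1 N) (· ∈ A)
        rw [Nat.card_Icc] at this
        exact_mod_cast this
      have e2 : (N:ℝ) ≤ 2 * X0 + 2 := by exact_mod_cast hN
      have e3 : 0 ≤ c * gg γ N := by positivity
      linarith
    · set X := N / 2 with hX
      have hX1 : X0 ≤ X := by omega
      have i1 := ih X (by omega)
      have i2 := h1 X hX1
      have i3 := h2 X hX1
      have i4 := h3 X hX1 N (by omega) (by omega)
      have hsub : (Icc 1 N).filter (· ∈ A) ⊆ ((Icc 1 X).filter (· ∈ A) ∪ (Ioc X (2 * X)).filter (· ∈ A)) ∪ {N} := by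
        intro p hp
        simp only [mem_union, mem_filter, mem_Icc, mem_Ioc, mem_singleton] at hp ⊢
        by_cases q1 : p ≤ X
        · exact Or.inl (Or.inl ⟨⟨hp.1.1, q1⟩, hp.2⟩)
        · by_cases q2 : p ≤ 2 * X
          · exact Or.inl (Or.inr ⟨⟨by omega, q2⟩, hp.2⟩)
          · right; omega
      have hcard := (card_le_card hsub).trans ((card_union_le _ _).trans (Nat.add_le_add_right (card_union_le _ _) _))
      rw [card_singleton] at hcard
      have hcR : (#((Icc 1 N).filter (· ∈ A)) : ℝ) ≤ #((Icc 1 X).filter (· ∈ A)) +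
        #((Ioc X (2 * X)).filter (· ∈ A)) + 1 := by exact_mod_cast hcard
      have i5 := mul_le_mul_of_nonneg_left i4 hc.le
      nlinarith

open Classical in
lemma card_eq (A : Set ℕ) (N : ℕ) : Nat.card ↥(A ∩ Set.Icc 1 N) = #((Icc 1 N).filter (· ∈ A)) := by
  have : A ∩ Set.Icc 1 N = (((Icc 1 N).filter (· ∈ A) : Finset ℕ) : Set ℕ) := by
    ext p; simp; tauto
  rw [this, Nat.card_coe_set_eq, Set.ncard_coe_finset]

open Classical in
lemma ps_lower {γ : ℝ} (h0 : 71/72 < γ) (h1 : γ < 1) (Pγ : Set ℕ)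
    (hP : ∀ p : ℕ, p.Prime → IsPS γ p → p ∈ Pγ) :
    ∀ᶠ N : ℕ in atTop, gg γ N / 8000 ≤ #((Icc 1 N).filter (· ∈ Pγ)) := by
  have ht : Tendsto (fun N : ℕ => N / 4) atTop atTop := Nat.tendsto_div_const_atTop (by norm_num)
  have ev := ht.eventually (ps_count_lower h0 h1)
  filter_upwards [ev, eventually_ge_atTop 100] with N a1 hN
  have hsub : (Ioc (N / 4) (4 * (N / 4))).filter (fun p => p.Prime ∧ IsPS γ p) ⊆ (Icc 1 N).filter (· ∈ Pγ) := by
    intro p hp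
    rw [mem_filter, mem_Ioc] at hp
    rw [mem_filter, mem_Icc]
    exact ⟨⟨by omega, by omega⟩, hP p hp.2.1 hp.2.2⟩
  have hc : (#((Ioc (N / 4) (4 * (N / 4))).filter (fun p => p.Prime ∧ IsPS γ p)) : ℝ) ≤ #((Icc 1 N).filter (· ∈ Pγ)) := by
    exact_mod_cast card_le_card hsub
  refine le_trans ?_ (a1.trans hc)
  have hn : (N:ℝ) ≤ 8 * ((N / 4 : ℕ):ℝ) := by
    have : N ≤ 8 * (N / 4) := by omega
    exact_mod_cast this
  have hn2 : ((N / 4 : ℕ):ℝ) ≤ N := by exact_mod_cast Nat.div_le_self N 4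
  have hn3 : (25:ℝ) ≤ ((N / 4 : ℕ):ℝ) := by
    have : 25 ≤ N / 4 := by omega
    exact_mod_cast this
  set m : ℝ := ((N / 4 : ℕ):ℝ) with hm
  clear_value m
  have hl : Real.log m ≤ Real.log N := Real.log_le_log (by linarith) hn2
  have hl0 : 0 < Real.log m := Real.log_pos (by linarith)
  have hl1 : 0 < Real.log N := by linarith
  have hpw : (N:ℝ) ^ γ ≤ 8 * m ^ γ := by
    calc (N:ℝ) ^ γ ≤ (8 * m) ^ γ := Real.rpow_le_rpow (by linarith) hn (by linarith)
      _ = 8 ^ γ * m ^ γ := Real.mul_rpow (by norm_num) (by linarith)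
      _ ≤ 8 ^ (1:ℝ) * m ^ γ := by
        have : (8:ℝ) ^ γ ≤ 8 ^ (1:ℝ) := Real.rpow_le_rpow_of_exponent_le (by norm_num) h1.le
        have hm0 : 0 ≤ m ^ γ := Real.rpow_nonneg (by linarith) _
        gcongr
      _ = _ := by rw [Real.rpow_one]
  unfold gg
  have hm0 : 0 ≤ m ^ γ := Real.rpow_nonneg (by linarith) _
  calc (N:ℝ) ^ γ / Real.log N / 8000 ≤ 8 * m ^ γ / Real.log m / 8000 := by gcongr
    _ = _ := by field_simp; norm_num

open Classical in
theorem main_aux (γ : ℝ) (h0 : 71 / 72 < γ) (h1 : γ < 1)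
    (Pγ : Set ℕ)
    (hPγ : Pγ = {p : ℕ | p.Prime ∧ ∃ n : ℕ, (p : ℤ) = ⌊(n : ℝ) ^ (1 / γ)⌋})
    (A : Set ℕ) (hA : A ⊆ Pγ)
    (hdens : 0 < Filter.limsup (fun N : ℕ =>
      (Nat.card ↥(A ∩ Set.Icc 1 N) : ℝ) / (Nat.card ↥(Pγ ∩ Set.Icc 1 N) : ℝ))
      Filter.atTop) :
    ∃ a ∈ A, ∃ d : ℕ, d ≠ 0 ∧ a + d ∈ A ∧ a + 2 * d ∈ A := by
  have hmem : ∀ p : ℕ, p ∈ Pγ ↔ p.Prime ∧ IsPS γ p := by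
    intro p
    rw [hPγ, isPS_iff (by linarith)]; rfl
  by_contra hno
  push Not at hno
  obtain ⟨c1, hc1, hlt⟩ := exists_between hdens
  have hfreq := frequently_lt_of_lt_limsup (by
    apply IsBoundedUnder.isCoboundedUnder_le
    exact isBoundedUnder_of ⟨0, fun N => by positivity⟩) hlt
  set c : ℝ := c1 / 128000 with hc
  have hcp : 0 < c := by positivity
  have ev1 := ap_of_dense h0 h1 c hcp
  have ev2 := gg_large h0 (1 / c)
  have ev3 := gg_double h0
  obtain ⟨X0, hX0⟩ := eventually_atTop.1 (ev1.and (ev2.and ev3))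
  have hup := count_le (γ := γ) A c hcp X0 (by
    intro X hX
    by_contra hgt
    push Not at hgt
    obtain ⟨a, d, hd, s1, s2, s3⟩ := (hX0 X hX).1 ((Ioc X (2 * X)).filter (· ∈ A)) (by
      intro p hp
      rw [mem_filter, mem_Ioc] at hp
      have := (hmem p).1 (hA hp.2)
      exact ⟨this.1, this.2, hp.1.1, hp.1.2⟩) hgt.le
    exact hno a (mem_filter.1 s1).2 d hd (mem_filter.1 s2).2 (mem_filter.1 s3).2) (by
    intro X hX
    have := (hX0 X hX).2.1
    rwa [div_le_iff₀' hcp] at this) (fun X hX => (hX0 X hX).2.2)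
  have ev4 := ps_lower h0 h1 Pγ (fun p h2 h3 => (hmem p).2 ⟨h2, h3⟩)
  have ev5 := gg_large h0 (max 1 ((2 * X0 + 2) * 16000 / c1))
  obtain ⟨N, n1, n2, n3⟩ := (hfreq.and_eventually (ev4.and ev5)).exists
  rw [card_eq, card_eq] at n1
  have g1 : 1 ≤ gg γ N := (le_max_left _ _).trans n3
  have g2 : (2 * X0 + 2) * 16000 / c1 ≤ gg γ N := (le_max_right _ _).trans n3
  rw [div_le_iff₀ hc1] at g2
  have n4 : (0:ℝ) < #((Icc 1 N).filter (· ∈ Pγ)) := by linarith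
  rw [lt_div_iff₀ n4] at n1
  have n5 := hup N
  have n6 := mul_le_mul_of_nonneg_left n2 hc1.le
  have e : 8 * (c * gg γ N) = c1 * gg γ N / 16000 := by rw [hc]; ring
  rw [e] at n5
  linarith

end PSRoth


open Filter

/-- **Roth's theorem in the Piatetski–Shapiro primes.**
For `γ ∈ (71/72, 1)`, every subset `A` of the Piatetski–Shapiro primes
`P_γ = {p prime : ∃ n, p = ⌊n^(1/γ)⌋}` with positive relative upper density
contains a nontrivial three-term arithmetic progression. -/
theorem roth_in_piatetski_shapiro_primes
    (γ : ℝ) (hγ₁ : 71 / 72 < γ) (hγ₂ : γ < 1)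
    (Pγ : Set ℕ)
    (hPγ : Pγ = {p : ℕ | p.Prime ∧ ∃ n : ℕ, (p : ℤ) = ⌊(n : ℝ) ^ (1 / γ)⌋})
    (A : Set ℕ) (hA : A ⊆ Pγ)
    (hdens : 0 < Filter.limsup (fun N : ℕ =>
      (Nat.card ↥(A ∩ Set.Icc 1 N) : ℝ) / (Nat.card ↥(Pγ ∩ Set.Icc 1 N) : ℝ))
      Filter.atTop) :
    ∃ a ∈ A, ∃ d : ℕ, d ≠ 0 ∧ a + d ∈ A ∧ a + 2 * d ∈ A := by
  exact PSRoth.main_aux γ hγ₁ hγ₂ Pγ hPγ A hA hdens
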